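/- Let P be a 4-blocked point set. Suppose that no colour class of P consists of exactly four points in convex position, and that some colour class of P consists of exactly four points that are not in convex position. Then P is {4,2,2,2}-blocked. -/

import Mathlib

/-- `x` blocks `v` and `w` if `x` lies strictly between `v` and `w`. -/
def Blocks {E : Type*} [AddCommGroup E] [Module ℝ E] (x v w : E) : Prop :=
  x ∈ openSegment ℝ v w

/-- `v` and `w` are visible with respect to `P` if no point of `P` blocks them. -/
def Visible {E : Type*} [AddCommGroup E] [Module ℝ E] (P : Set E) (v w : E) : Prop :=
  ∀ x ∈ P, ¬ Blocks x v w

/-- `c` is a blocked colouring of `P`: distinct points of `P` are visible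
iff they get different colours. -/
def BlockedColouring {E : Type*} [AddCommGroup E] [Module ℝ E] {k : ℕ}
    (P : Set E) (c : E → Fin k) : Prop :=
  ∀ v ∈ P, ∀ w ∈ P, v ≠ w → (Visible P v w ↔ c v ≠ c w)

/-- `P` is `k`-blocked. -/
def KBlocked {E : Type*} [AddCommGroup E] [Module ℝ E] (k : ℕ) (P : Set E) : Prop :=
  P.Finite ∧ ∃ c : E → Fin k, BlockedColouring P c

/-- `P` is `{n₁,…,n_k}`-blocked where `N` is the multiset of colour class sizes. -/
def IsNBlocked {E : Type*} [AddCommGroup E] [Module ℝ E] (N : Multiset ℕ) (P : Set E) : Prop :=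
  P.Finite ∧ ∃ (k : ℕ) (c : E → Fin k), BlockedColouring P c ∧
    N = Finset.univ.val.map (fun i : Fin k => (P ∩ c ⁻¹' {i}).ncard)

/-- A multiset of positive integers is representable if some planar point set is
`N`-blocked. -/
def Representable (N : Multiset ℕ) : Prop :=
  ∃ P : Set (ℝ × ℝ), IsNBlocked N P

/-- A set is in convex position if no point lies in the convex hull of the others. -/
def ConvexPosition {E : Type*} [AddCommGroup E] [Module ℝ E] (K : Set E) : Prop :=
  ∀ x ∈ K, x ∉ convexHull ℝ (K \ {x})

/-- `P` is `N`-midpoint-blocked: `N`-blocked, and midpoints of monochromatic pairs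
belong to `P`. -/
def IsNMidpointBlocked {E : Type*} [AddCommGroup E] [Module ℝ E]
    (N : Multiset ℕ) (P : Set E) : Prop :=
  P.Finite ∧ ∃ (k : ℕ) (c : E → Fin k), BlockedColouring P c ∧
    (∀ v ∈ P, ∀ w ∈ P, v ≠ w → c v = c w → midpoint ℝ v w ∈ P) ∧
    N = Finset.univ.val.map (fun i : Fin k => (P ∩ c ⁻¹' {i}).ncard)
/-! ### Orientation of point triples -/

/-- The signed area of the parallelogram spanned by `q - p` and `r - p`. -/
def orient (p q r : ℝ × ℝ) : ℝ :=
  (q.1 - p.1) * (r.2 - p.2) - (q.2 - p.2) * (r.1 - p.1)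

lemma orient_rotate (p q r : ℝ × ℝ) : orient q r p = orient p q r := by
  unfold orient; ring

lemma orient_swap (p q r : ℝ × ℝ) : orient q p r = -orient p q r := by
  unfold orient; ring

lemma orient_self_left (p q : ℝ × ℝ) : orient p p q = 0 := by
  unfold orient; ring

lemma orient_self_right (p q : ℝ × ℝ) : orient p q q = 0 := by
  unfold orient; ring

lemma orient_self_outer (p q : ℝ × ℝ) : orient p q p = 0 := by
  unfold orient; ring

lemma orient_affine (p q r s : ℝ × ℝ) :
    orient p q r = orient s q r + orient p s r + orient p q s := by
  unfold orient; ring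

lemma orient_mul_orient (a b c d e : ℝ × ℝ) :
    orient a b c * orient a d e = orient a b d * orient a c e - orient a b e * orient a c d := by
  unfold orient; ring

lemma orient_smul_add_smul {a b : ℝ} (hab : a + b = 1) (p q v w : ℝ × ℝ) :
    orient p q (a • v + b • w) = a * orient p q v + b * orient p q w := by
  obtain rfl : a = 1 - b := by linarith
  simp only [orient, Prod.fst_add, Prod.snd_add, Prod.smul_fst, Prod.smul_snd, smul_eq_mul]
  ring

lemma orient_eq_zero_of_mem_openSegment {x v w : ℝ × ℝ} (h : x ∈ openSegment ℝ v w) :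
    orient x v w = 0 := by
  obtain ⟨a, b, -, -, hab, rfl⟩ := h
  rw [← orient_rotate, orient_smul_add_smul hab, orient_self_outer, orient_self_right]
  ring

lemma orient_eq_zero_of_between {x v w y : ℝ × ℝ} (h : x ∈ openSegment ℝ v w)
    (h0 : orient x v y = 0) : orient v w y = 0 := by
  obtain ⟨a, b, -, hb, hab, rfl⟩ := h
  have : orient (a • v + b • w) v y = -b * orient v w y := by
    obtain rfl : a = 1 - b := by linarith
    simp only [orient, Prod.fst_add, Prod.snd_add, Prod.smul_fst, Prod.smul_snd, smul_eq_mul]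
    ring
  rw [this] at h0
  exact (mul_eq_zero.1 h0).resolve_left (neg_ne_zero.2 hb.ne')

lemma convex_setOf_orient_mul_lt (p q : ℝ × ℝ) (e t : ℝ) :
    Convex ℝ {u | e * orient p q u < t} := by
  intro v hv w hw a b ha hb hab
  simp only [Set.mem_ofPred_eq] at *
  rw [orient_smul_add_smul hab]
  rcases ha.eq_or_lt with rfl | ha
  · obtain rfl : b = 1 := by linarith
    simpa using hw
  · obtain rfl : a = 1 - b := by linarith
    nlinarith [mul_pos ha (sub_pos.2 hv), mul_nonneg hb (sub_nonneg.2 hw.le)]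

lemma convex_setOf_le_orient_mul (p q : ℝ × ℝ) (e t : ℝ) :
    Convex ℝ {u | t ≤ e * orient p q u} := by
  intro v hv w hw a b ha hb hab
  simp only [Set.mem_ofPred_eq] at *
  rw [orient_smul_add_smul hab]
  obtain rfl : a = 1 - b := by linarith
  nlinarith [mul_nonneg ha (sub_nonneg.2 hv), mul_nonneg hb (sub_nonneg.2 hw)]

/-- A point of a line through two other points is strictly between two of the three. -/
lemma between_of_orient_eq_zero {x v w : ℝ × ℝ} (h : orient x v w = 0) (hxv : x ≠ v)
    (hvw : v ≠ w) (hwx : w ≠ x) :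
    x ∈ openSegment ℝ v w ∨ v ∈ openSegment ℝ w x ∨ w ∈ openSegment ℝ x v := by
  have hcol : Collinear ℝ ({x, v, w} : Set (ℝ × ℝ)) := by
    rw [collinear_iff_of_mem (p₀ := x) (by simp)]
    refine ⟨v - x, ?_⟩
    have hne : v.1 - x.1 ≠ 0 ∨ v.2 - x.2 ≠ 0 := by
      by_contra! hc
      exact hxv (Prod.ext (by linarith [hc.1]) (by linarith [hc.2]))
    unfold orient at h
    intro p hp
    simp only [Set.mem_insert_iff, Set.mem_singleton_iff] at hp
    rcases hp with rfl | rfl | rfl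
    · exact ⟨0, by simp⟩
    · exact ⟨1, by simp⟩
    · rcases hne with hn | hn
      · refine ⟨(p.1 - x.1) / (v.1 - x.1), Prod.ext ?_ ?_⟩ <;>
          simp <;> field_simp <;> linarith
      · refine ⟨(p.2 - x.2) / (v.2 - x.2), Prod.ext ?_ ?_⟩ <;>
          simp <;> field_simp <;> linarith
  have key : ∀ {a b c : ℝ × ℝ}, Wbtw ℝ a b c → a ≠ b → b ≠ c → b ∈ openSegment ℝ a c := by
    intro a b c hb hab hbc
    exact mem_openSegment_of_ne_left_right hab hbc.symm (mem_segment_iff_wbtw.2 hb)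
  rcases hcol.wbtw_or_wbtw_or_wbtw with hb | hb | hb
  · exact Or.inr (Or.inl (by rw [openSegment_symm]; exact key hb hxv hvw))
  · exact Or.inr (Or.inr (by rw [openSegment_symm]; exact key hb hvw hwx))
  · exact Or.inl (by rw [openSegment_symm]; exact key hb hwx hxv)

/-! ### Blocked colourings -/

namespace BlockedColouring

variable {k : ℕ} {P : Set (ℝ × ℝ)} {c : ℝ × ℝ → Fin k}

lemma exists_mem_openSegment (hc : BlockedColouring P c) {v w : ℝ × ℝ} (hv : v ∈ P) (hw : w ∈ P)
    (hvw : v ≠ w) (h : c v = c w) : ∃ x ∈ P, x ∈ openSegment ℝ v w := by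
  by_contra! hx
  exact (hc v hv w hw hvw).1 hx h

lemma eq_of_mem_openSegment (hc : BlockedColouring P c) {x v w : ℝ × ℝ} (hx : x ∈ P) (hv : v ∈ P)
    (hw : w ∈ P) (h : x ∈ openSegment ℝ v w) : c v = c w := by
  by_contra hne
  exact (hc v hv w hw (fun e => hne (e ▸ rfl))).2 hne x hx h

lemma comp (hc : BlockedColouring P c) {l : ℕ} {f : Fin k → Fin l} (hf : Function.Injective f) :
    BlockedColouring P (f ∘ c) := fun v hv w hw hvw =>
  (hc v hv w hw hvw).trans (not_congr hf.eq_iff.symm)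

lemma inter (hc : BlockedColouring P c) {C : Set (ℝ × ℝ)} (hC : Convex ℝ C) :
    BlockedColouring (P ∩ C) c := fun v hv w hw hvw => by
  rw [← hc v hv.1 w hw.1 hvw]
  exact ⟨fun h x hx hb => h x ⟨hx, hC.openSegment_subset hv.2 hw.2 hb⟩ hb, fun h x hx => h x hx.1⟩

lemma diff_singleton (hc : BlockedColouring P c) {p : ℝ × ℝ} (hp : p ∉ convexHull ℝ (P \ {p})) :
    BlockedColouring (P \ {p}) c := fun v hv w hw hvw => by
  rw [← hc v hv.1 w hw.1 hvw]
  refine ⟨fun h x hx hb => h x ⟨hx, ?_⟩ hb, fun h x hx => h x hx.1⟩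
  rintro rfl
  exact hp ((convex_convexHull ℝ _).openSegment_subset (subset_convexHull ℝ _ hv)
    (subset_convexHull ℝ _ hw) hb)

end BlockedColouring

lemma exists_notMem_convexHull_diff_singleton {P : Set (ℝ × ℝ)} (hfin : P.Finite)
    (hne : P.Nonempty) : ∃ p ∈ P, p ∉ convexHull ℝ (P \ {p}) := by
  obtain ⟨p, hp⟩ := (hfin.isCompact_convexHull (𝕜 := ℝ)).extremePoints_nonempty hne.convexHull
  refine ⟨p, extremePoints_convexHull_subset hp, fun h => ?_⟩
  have := ((convex_convexHull ℝ P).mem_extremePoints_iff_mem_sdiff_convexHull_sdiff.1 hp).2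
  exact this (convexHull_mono (Set.sdiff_subset_sdiff_left (subset_convexHull ℝ P)) h)

lemma left_notMem_openSegment {v w : ℝ × ℝ} (h : v ≠ w) : v ∉ openSegment ℝ v w := by
  rw [left_mem_openSegment_iff]; exact h

namespace BlockedColouring

variable {k : ℕ} {P : Set (ℝ × ℝ)} {c : ℝ × ℝ → Fin k}

lemma ne_of_mem_openSegment (hc : BlockedColouring P c) (hfin : P.Finite) {x v w : ℝ × ℝ}
    (hx : x ∈ P) (hv : v ∈ P) (hw : w ∈ P) (hvw : v ≠ w) (h : x ∈ openSegment ℝ v w) :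
    c x ≠ c v := by
  induction hn : (P ∩ openSegment ℝ v w).ncard using Nat.strong_induction_on
    generalizing v w x with
  | _ n ih =>
    intro hxv
    have hne : v ≠ x := fun e => left_notMem_openSegment hvw (e ▸ h)
    obtain ⟨y, hy, hyb⟩ := hc.exists_mem_openSegment hv hx hne hxv.symm
    have hsub : openSegment ℝ v x ⊆ openSegment ℝ v w := by
      obtain ⟨a, b, ha, hb, hab, rfl⟩ := h
      rintro _ ⟨s, t, hs, ht, hst, rfl⟩
      refine ⟨s + t * a, t * b, by positivity, by positivity, ?_, ?_⟩
      · rw [add_assoc, ← mul_add, hab, mul_one, hst]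
      · rw [smul_add, smul_smul, smul_smul, ← add_assoc, ← add_smul]
    have hxyw : x ∈ openSegment ℝ y w := by
      obtain ⟨s, t, hs, ht, hst, rfl⟩ := hyb
      obtain ⟨a, b, ha, hb, hab, rfl⟩ := h
      have hd : 0 < s + t * a := by positivity
      have hd1 : 0 < s + t * a + t * b := by positivity
      have e1 : s + t * a + t * b = 1 := by rw [add_assoc, ← mul_add, hab, mul_one, hst]
      refine ⟨a / (s + t * a), 1 - a / (s + t * a), by positivity, ?_, by ring, ?_⟩
      · rw [sub_pos, div_lt_one hd]
        obtain rfl : s = 1 - t := by linarith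
        have : t < 1 := by linarith
        obtain rfl : a = 1 - b := by linarith
        nlinarith
      · obtain rfl : s = 1 - t := by linarith
        obtain rfl : b = 1 - a := by linarith
        ext <;> simp <;> field_simp <;> ring
    have hcy : c y = c w := hc.eq_of_mem_openSegment hx hy hw hxyw
    have hvx : c v = c w := hc.eq_of_mem_openSegment hx hv hw h
    refine ih _ ?_ hy hv hx hne hyb rfl (hcy.trans hvx.symm)
    rw [← hn]
    refine Set.ncard_lt_ncard ⟨Set.inter_subset_inter_right _ hsub, fun hs => ?_⟩
      (hfin.subset Set.inter_subset_left)
    have hx' := (hs ⟨hx, h⟩).2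
    rw [openSegment_symm] at hx'
    exact left_notMem_openSegment hne.symm hx'

lemma orient_ne_zero (hc : BlockedColouring P c) (hfin : P.Finite) {x y z : ℝ × ℝ}
    (hx : x ∈ P) (hy : y ∈ P) (hz : z ∈ P) (hxy : x ≠ y) (hyz : y ≠ z) (hzx : z ≠ x)
    (h1 : c x = c y) (h2 : c y = c z) : orient x y z ≠ 0 := fun h => by
  rcases between_of_orient_eq_zero h hxy hyz hzx with hb | hb | hb
  · exact hc.ne_of_mem_openSegment hfin hx hy hz hyz hb h1
  · exact hc.ne_of_mem_openSegment hfin hy hz hx hzx hb h2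
  · exact hc.ne_of_mem_openSegment hfin hz hx hy hxy hb (h2.symm.trans h1.symm)

/-- No four points of a blocked set are collinear. -/
lemma orient_ne_zero_of_between (hc : BlockedColouring P c) (hfin : P.Finite) {x v w y : ℝ × ℝ}
    (hx : x ∈ P) (hv : v ∈ P) (hw : w ∈ P) (hy : y ∈ P) (hvw : v ≠ w) (h : x ∈ openSegment ℝ v w)
    (hyx : y ≠ x) (hyv : y ≠ v) (hyw : y ≠ w) : orient v w y ≠ 0 := fun h0 => by
  have hcvw := hc.eq_of_mem_openSegment hx hv hw h
  have hcx := hc.ne_of_mem_openSegment hfin hx hv hw hvw h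
  rw [← orient_rotate, ← orient_rotate] at h0
  rcases between_of_orient_eq_zero h0 hyv hvw hyw.symm with hb | hb | hb
  · have hcy := hc.ne_of_mem_openSegment hfin hy hv hw hvw hb
    have h0' : orient v x y = 0 := by
      obtain ⟨a, b, -, -, hab, rfl⟩ := h
      obtain ⟨s, t, -, -, hst, rfl⟩ := hb
      rw [orient_smul_add_smul hst, orient_self_outer, ← orient_rotate, ← orient_rotate,
        orient_smul_add_smul hab, orient_self_right, orient_self_outer]
      ring
    rcases between_of_orient_eq_zero h0' (fun e => left_notMem_openSegment hvw (e ▸ h)) hyx.symm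
      hyv with hb' | hb' | hb'
    · exact left_notMem_openSegment hvw ((convex_openSegment v w).openSegment_subset h hb hb')
    · exact hcy (hc.eq_of_mem_openSegment hx hy hv hb')
    · exact hcx (hc.eq_of_mem_openSegment hy hv hx hb').symm
  · exact hc.ne_of_mem_openSegment hfin hv hw hy hyw.symm hb hcvw
  · exact hc.ne_of_mem_openSegment hfin hw hy hv hyv hb
      (hcvw.symm.trans (hc.eq_of_mem_openSegment hw hy hv hb).symm)

end BlockedColouring

/-! ### Monochromatic triangles -/

lemma orient_mul_lt_of_mem_convexHull {x y z u : ℝ × ℝ} (h0 : orient x y z ≠ 0)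
    (hu : u ∈ convexHull ℝ {x, y, z}) (hux : u ≠ x) :
    orient x y z * orient y z u < orient x y z * orient x y z := by
  rw [convexHull_insert (by simp), convexHull_pair] at hu
  rw [mem_convexJoin] at hu
  obtain ⟨x', hx', v, hv, hu⟩ := hu
  obtain rfl : x' = x := hx'
  obtain ⟨a, b, ha, hb, hab, rfl⟩ := hu
  obtain ⟨s, t, hs, ht, hst, rfl⟩ := hv
  have hb' : b ≠ 0 := by
    rintro rfl
    exact hux (by simp [show a = 1 by linarith])
  have hb'' : 0 < b := lt_of_le_of_ne hb hb'.symm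
  rw [orient_smul_add_smul hab, orient_smul_add_smul hst, orient_self_outer, orient_self_right,
    orient_rotate x' y z]
  obtain rfl : a = 1 - b := by linarith
  nlinarith [mul_pos hb'' (mul_self_pos.2 h0)]

lemma notMem_convexHull_of_orient_mul_lt {x y z : ℝ × ℝ} {S : Set (ℝ × ℝ)}
    (hS : ∀ u ∈ S, orient x y z * orient y z u < orient x y z * orient x y z) :
    x ∉ convexHull ℝ S := fun h => by
  have : orient x y z * orient y z x < orient x y z * orient x y z :=
    convexHull_min (s := S) (fun u hu => hS u hu)
      (convex_setOf_orient_mul_lt y z (orient x y z) (orient x y z * orient x y z)) h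
  rw [orient_rotate x y z] at this
  exact lt_irrefl _ this

namespace BlockedColouring

variable {P : Set (ℝ × ℝ)} {c : ℝ × ℝ → Fin 4}

/-- No monochromatic triangle with vertices in `P ∩ conv {x, y, z}` avoids `x`. -/
def MinimalTriangle (P : Set (ℝ × ℝ)) (c : ℝ × ℝ → Fin 4) (x y z : ℝ × ℝ) : Prop :=
  ∀ u ∈ P, ∀ v ∈ P, ∀ w ∈ P, u ∈ convexHull ℝ {x, y, z} → v ∈ convexHull ℝ {x, y, z} →
    w ∈ convexHull ℝ {x, y, z} → u ≠ v → v ≠ w → w ≠ u → c u = c v → c v = c w →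
    u ≠ x → v ≠ x → w ≠ x → False

lemma false_of_minimalTriangle (hc : BlockedColouring P c) (hfin : P.Finite)
    {x y z p q r : ℝ × ℝ} {k : Fin 4} (hx : x ∈ P) (hy : y ∈ P) (hz : z ∈ P) (hxy : x ≠ y)
    (hyz : y ≠ z) (hzx : z ≠ x) (hcxy : c x = c y) (hcyz : c y = c z)
    (hk : ∀ u ∈ P, u ∈ convexHull ℝ {x, y, z} → c u ≠ k)
    (hmin : MinimalTriangle P c x y z)
    (hcol : ∀ u ∈ P, u ∈ convexHull ℝ {x, y, z} → u ≠ x → u ≠ y → u ≠ z → c u ≠ c x)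
    (hp : p ∈ P) (hq : q ∈ P) (hr : r ∈ P) (hpb : p ∈ openSegment ℝ x y)
    (hqb : q ∈ openSegment ℝ y z) (hrb : r ∈ openSegment ℝ z x) (hpq : c p = c q) : False := by
  have h0 : orient x y z ≠ 0 := hc.orient_ne_zero hfin hx hy hz hxy hyz hzx hcxy hcyz
  set D := orient x y z with hD
  have hDD : 0 < D * D := mul_self_pos.2 h0
  have hT := convex_convexHull ℝ {x, y, z}
  have hxT : x ∈ convexHull ℝ {x, y, z} := subset_convexHull ℝ _ (by simp)
  have hyT : y ∈ convexHull ℝ {x, y, z} := subset_convexHull ℝ _ (by simp)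
  have hzT : z ∈ convexHull ℝ {x, y, z} := subset_convexHull ℝ _ (by simp)
  have hpT := hT.openSegment_subset hxT hyT hpb
  have hqT := hT.openSegment_subset hyT hzT hqb
  have hrT := hT.openSegment_subset hzT hxT hrb
  have hzxy : orient z x y = D := by rw [← orient_rotate]
  have hyzx : orient y z x = D := by rw [orient_rotate]
  have e1 : ∀ {s t : ℝ}, s + t = 1 → orient x y (s • y + t • z) = t * D := fun h => by
    rw [orient_smul_add_smul h, orient_self_right]; ring
  have e2 : ∀ {s t : ℝ}, s + t = 1 → orient x y (s • z + t • x) = s * D := fun h => by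
    rw [orient_smul_add_smul h, orient_self_outer]; ring
  -- barycentric coordinates of the blockers
  obtain ⟨p1, p2, hp1, hp2, hp3, hpe⟩ := id hpb
  obtain ⟨q1, q2, hq1, hq2, hq3, hqe⟩ := id hqb
  obtain ⟨r1, r2, hr1, hr2, hr3, hre⟩ := id hrb
  have pyz : orient y z p = p1 * D := by
    rw [← hpe, orient_smul_add_smul hp3, orient_self_outer, hyzx]; ring
  have pzx : orient z x p = p2 * D := by
    rw [← hpe, orient_smul_add_smul hp3, orient_self_right, hzxy]; ring
  have pxy : orient x y p = 0 := by
    rw [← hpe, orient_smul_add_smul hp3, orient_self_right, orient_self_outer]; ring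
  have qyz : orient y z q = 0 := by
    rw [← hqe, orient_smul_add_smul hq3, orient_self_right, orient_self_outer]; ring
  have qzx : orient z x q = q1 * D := by
    rw [← hqe, orient_smul_add_smul hq3, orient_self_outer, hzxy]; ring
  have qxy : orient x y q = q2 * D := by rw [← hqe, e1 hq3]
  have ryz : orient y z r = r2 * D := by
    rw [← hre, orient_smul_add_smul hr3, orient_self_right, hyzx]; ring
  have rzx : orient z x r = 0 := by
    rw [← hre, orient_smul_add_smul hr3, orient_self_right, orient_self_outer]; ring
  have rxy : orient x y r = r1 * D := by rw [← hre, e2 hr3]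
  have hpq' : p ≠ q := fun e => by
    rw [e, qyz] at pyz
    exact mul_ne_zero hp1.ne' h0 pyz.symm
  obtain ⟨w, hw, hwb⟩ := hc.exists_mem_openSegment hp hq hpq' hpq
  have hwT := hT.openSegment_subset hpT hqT hwb
  have hcw := hc.ne_of_mem_openSegment hfin hw hp hq hpq' hwb
  obtain ⟨w1, w2, hw1, hw2, hw3, hwe⟩ := id hwb
  have wyz : orient y z w = w1 * p1 * D := by
    rw [← hwe, orient_smul_add_smul hw3, pyz, qyz]; ring
  have wzx : orient z x w = (w1 * p2 + w2 * q1) * D := by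
    rw [← hwe, orient_smul_add_smul hw3, pzx, qzx]; ring
  have wxy : orient x y w = w2 * q2 * D := by
    rw [← hwe, orient_smul_add_smul hw3, pxy, qxy]; ring
  have hpx : c p ≠ c x := hc.ne_of_mem_openSegment hfin hp hx hy hxy hpb
  have hrz : c r ≠ c z := hc.ne_of_mem_openSegment hfin hr hz hx hzx hrb
  have hwr : w ≠ r := fun e => by
    rw [e, rzx] at wzx
    exact mul_ne_zero (by positivity) h0 wzx.symm
  have offvertex : ∀ u a b d : _, orient y z u = a * D → orient z x u = b * D →
      orient x y u = d * D → 0 < a → 0 < b → 0 < d → u ≠ x ∧ u ≠ y ∧ u ≠ z := by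
    intro u a b d ha hb hd ha' hb' hd'
    refine ⟨?_, ?_, ?_⟩ <;> rintro rfl
    · rw [orient_self_right] at hb; exact mul_ne_zero hb'.ne' h0 hb.symm
    · rw [orient_self_right] at hd; exact mul_ne_zero hd'.ne' h0 hd.symm
    · rw [orient_self_right] at ha; exact mul_ne_zero ha'.ne' h0 ha.symm
  obtain ⟨hwx, hwy, hwz⟩ := offvertex w _ _ _ wyz wzx wxy (by positivity) (by positivity)
    (by positivity)
  have hcwx := hcol w hw hwT hwx hwy hwz
  have two : ∀ j x p w r : Fin 4, x ≠ j → p ≠ x → p ≠ j → w ≠ x → w ≠ j → w ≠ p → r ≠ x → r ≠ j →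
      r ≠ p → w = r := by omega
  have hpx' : p ≠ x := fun e => hpx (e ▸ rfl)
  have hqx' : q ≠ x := fun e => by
    rw [e, hyzx] at qyz; exact h0 qyz
  have hrp : c r ≠ c p := fun e => by
    refine hmin p hp q hq r hr hpT hqT hrT hpq' (fun e => ?_) (fun e => ?_) hpq (hpq ▸ e.symm)
      hpx' hqx' (fun e => ?_)
    · rw [← e, qyz] at ryz; exact mul_ne_zero hr2.ne' h0 ryz.symm
    · rw [e, pxy] at rxy; exact mul_ne_zero hr1.ne' h0 rxy.symm
    · rw [e, orient_self_outer] at rxy; exact mul_ne_zero hr1.ne' h0 rxy.symm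
  have hcwr : c w = c r := two k (c x) (c p) (c w) (c r) (hk x hx hxT) hpx (hk p hp hpT) hcwx
    (hk w hw hwT) hcw (hcxy.trans hcyz ▸ hrz) (hk r hr hrT) hrp
  obtain ⟨s, hs, hsb⟩ := hc.exists_mem_openSegment hr hw hwr.symm hcwr.symm
  have hsT := hT.openSegment_subset hrT hwT hsb
  have hcs := hc.ne_of_mem_openSegment hfin hs hr hw hwr.symm hsb
  obtain ⟨s1, s2, hs1, hs2, hs3, hse⟩ := id hsb
  have syz : orient y z s = (s1 * r2 + s2 * (w1 * p1)) * D := by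
    rw [← hse, orient_smul_add_smul hs3, ryz, wyz]; ring
  have szx : orient z x s = s2 * (w1 * p2 + w2 * q1) * D := by
    rw [← hse, orient_smul_add_smul hs3, rzx, wzx]; ring
  have sxy : orient x y s = (s1 * r1 + s2 * (w2 * q2)) * D := by
    rw [← hse, orient_smul_add_smul hs3, rxy, wxy]; ring
  obtain ⟨hsx, hsy, hsz⟩ := offvertex s _ _ _ syz szx sxy (by positivity) (by positivity)
    (by positivity)
  have hcsp : c s = c p := two k (c x) (c r) (c s) (c p) (hk x hx hxT) (hcxy.trans hcyz ▸ hrz)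
    (hk r hr hrT) (hcol s hs hsT hsx hsy hsz) (hk s hs hsT) hcs hpx (hk p hp hpT) hrp.symm
  refine hmin p hp q hq s hs hpT hqT hsT hpq' (fun e => ?_) (fun e => ?_) hpq
    (hpq.symm.trans hcsp.symm) hpx' hqx' hsx
  · rw [← e, qyz] at syz; exact mul_ne_zero (by positivity) h0 syz.symm
  · rw [e, pxy] at sxy; exact mul_ne_zero (by positivity) h0 sxy.symm

/-- A monochromatic triangle contains points of every colour. -/
lemma exists_mem_convexHull_triple (hc : BlockedColouring P c) (hfin : P.Finite) {x y z : ℝ × ℝ}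
    (hx : x ∈ P) (hy : y ∈ P) (hz : z ∈ P) (hxy : x ≠ y)
    (hyz : y ≠ z) (hzx : z ≠ x) (hcxy : c x = c y) (hcyz : c y = c z) (k : Fin 4) :
    ∃ u ∈ P, u ∈ convexHull ℝ {x, y, z} ∧ c u = k := by
  by_contra! hk
  induction hn : (P ∩ convexHull ℝ {x, y, z}).ncard using Nat.strong_induction_on
    generalizing x y z with
  | _ n ih =>
    have hrot : ∀ a b d : ℝ × ℝ, ({b, d, a} : Set (ℝ × ℝ)) = {a, b, d} := fun a b d => by
      rw [Set.pair_comm, Set.insert_comm]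
    have hmin : ∀ x ∈ P, ∀ y z, x ∈ P → y ∈ P → z ∈ P → x ≠ y → y ≠ z → z ≠ x → c x = c y →
        c y = c z → (∀ u ∈ P, u ∈ convexHull ℝ {x, y, z} → c u ≠ k) →
        (P ∩ convexHull ℝ {x, y, z}).ncard = n → MinimalTriangle P c x y z := by
      intro x hx y z hx hy hz hxy hyz hzx hcxy hcyz hk hn u hu v hv w hw huT hvT hwT huv hvw hwu
        hcuv hcvw hux hvx hwx
      have h0 : orient x y z ≠ 0 := hc.orient_ne_zero hfin hx hy hz hxy hyz hzx hcxy hcyz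
      have hsub : convexHull ℝ {u, v, w} ⊆ convexHull ℝ {x, y, z} := by
        refine convexHull_min ?_ (convex_convexHull ℝ _)
        rintro t (rfl | rfl | rfl) <;> assumption
      refine ih _ ?_ hu hv hw huv hvw hwu hcuv hcvw (fun t ht htT => hk t ht (hsub htT)) rfl
      rw [← hn]
      refine Set.ncard_lt_ncard ⟨Set.inter_subset_inter_right _ hsub, fun hs => ?_⟩
        (hfin.subset Set.inter_subset_left)
      refine notMem_convexHull_of_orient_mul_lt (x := x) (y := y) (z := z) ?_
        (hs ⟨hx, subset_convexHull ℝ _ (by simp)⟩).2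
      rintro t (rfl | rfl | rfl) <;> exact orient_mul_lt_of_mem_convexHull h0 ‹_› ‹_›
    have hmx := hmin x hx y z hx hy hz hxy hyz hzx hcxy hcyz hk hn
    have hyzx := hrot x y z
    have hzxy := hrot y z x
    have hcol : ∀ u ∈ P, u ∈ convexHull ℝ {x, y, z} → u ≠ x → u ≠ y → u ≠ z → c u ≠ c x :=
      fun u hu huT hux huy huz hcu => hmx u hu y hy z hz huT (subset_convexHull ℝ _ (by simp))
        (subset_convexHull ℝ _ (by simp)) huy hyz huz.symm (hcu.trans hcxy) hcyz hux hxy.symm hzx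
    obtain ⟨p, hp, hpb⟩ := hc.exists_mem_openSegment hx hy hxy hcxy
    obtain ⟨q, hq, hqb⟩ := hc.exists_mem_openSegment hy hz hyz hcyz
    obtain ⟨r, hr, hrb⟩ := hc.exists_mem_openSegment hz hx hzx (hcxy.trans hcyz).symm
    have hT := convex_convexHull ℝ {x, y, z}
    have hxT : x ∈ convexHull ℝ {x, y, z} := subset_convexHull ℝ _ (by simp)
    have hyT : y ∈ convexHull ℝ {x, y, z} := subset_convexHull ℝ _ (by simp)
    have hzT : z ∈ convexHull ℝ {x, y, z} := subset_convexHull ℝ _ (by simp)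
    have hpx : c p ≠ c x := hc.ne_of_mem_openSegment hfin hp hx hy hxy hpb
    have hqx : c q ≠ c x := hcxy ▸ hc.ne_of_mem_openSegment hfin hq hy hz hyz hqb
    have hrx : c r ≠ c x := hcxy.trans hcyz ▸ hc.ne_of_mem_openSegment hfin hr hz hx hzx hrb
    have two : ∀ j x p q r : Fin 4, x ≠ j → p ≠ x → p ≠ j → q ≠ x → q ≠ j → r ≠ x → r ≠ j →
        p = q ∨ q = r ∨ r = p := by omega
    rcases two k (c x) (c p) (c q) (c r) (hk x hx hxT) hpx (hk p hp (hT.openSegment_subset hxT hyT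
      hpb)) hqx (hk q hq (hT.openSegment_subset hyT hzT hqb)) hrx
      (hk r hr (hT.openSegment_subset hzT hxT hrb)) with h | h | h
    · exact hc.false_of_minimalTriangle hfin hx hy hz hxy hyz hzx hcxy hcyz hk hmx hcol hp hq hr
        hpb hqb hrb h
    · have hk' : ∀ u ∈ P, u ∈ convexHull ℝ {y, z, x} → c u ≠ k := by rwa [hyzx]
      exact hc.false_of_minimalTriangle hfin hy hz hx hyz hzx hxy hcyz (hcxy.trans hcyz).symm hk'
        (hmin y hy z x hy hz hx hyz hzx hxy hcyz (hcxy.trans hcyz).symm hk' (by rwa [hyzx]))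
        (by rw [hyzx, ← hcxy]; exact fun u hu huT h1 h2 h3 => hcol u hu huT h3 h1 h2)
        hq hr hp hqb hrb hpb h
    · have hk' : ∀ u ∈ P, u ∈ convexHull ℝ {z, x, y} → c u ≠ k := by rwa [hzxy, hyzx]
      exact hc.false_of_minimalTriangle hfin hz hx hy hzx hxy hyz (hcxy.trans hcyz).symm hcxy hk'
        (hmin z hz x y hz hx hy hzx hxy hyz (hcxy.trans hcyz).symm hcxy hk'
          (by rwa [hzxy, hyzx]))
        (by rw [hzxy, hyzx, ← hcyz, ← hcxy]; exact fun u hu huT h1 h2 h3 => hcol u hu huT h2 h3 h1)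
        hr hp hq hrb hpb hqb h

end BlockedColouring

/-- A point of `P` at which `P` lies in a proper cone is a vertex of the convex hull of `P`. -/
lemma notMem_convexHull_diff_singleton_of_cone {P : Set (ℝ × ℝ)} {a b d : ℝ × ℝ} {e : ℝ}
    (he : e ≠ 0) (hab : ∀ u ∈ P, 0 ≤ e * orient a b u) (hda : ∀ u ∈ P, 0 ≤ e * orient d a u)
    (hdab : 0 < e * orient d a b) : a ∉ convexHull ℝ (P \ {a}) := fun h => by
  have key := convexHull_min (s := P \ {a}) (t := {u | -e * orient d b u < -e * orient d b a})
    (fun u hu => ?_) (convex_setOf_orient_mul_lt d b (-e) _) h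
  · simp at key
  have h1 := hab u hu.1
  have h2 := hda u hu.1
  have h3 := orient_affine d b u a
  by_contra hlt
  simp only [Set.mem_ofPred_eq] at hlt
  rw [h3] at hlt
  have z1 : e * orient a b u = 0 := by linarith
  have z2 : e * orient d a u = 0 := by linarith
  have z1' := (mul_eq_zero.1 z1).resolve_left he
  have z2' := (mul_eq_zero.1 z2).resolve_left he
  have hD : orient d a b ≠ 0 := right_ne_zero_of_mul hdab.ne'
  refine hu.2 (Prod.ext ?_ ?_)
  · refine sub_eq_zero.1 ((mul_eq_zero.1 (?_ : (u.1 - a.1) * orient d a b = 0)).resolve_right hD)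
    unfold orient at *
    linear_combination (b.1 - a.1) * z2' - (a.1 - d.1) * z1'
  · refine sub_eq_zero.1 ((mul_eq_zero.1 (?_ : (u.2 - a.2) * orient d a b = 0)).resolve_right hD)
    unfold orient at *
    linear_combination (b.2 - a.2) * z2' - (a.2 - d.2) * z1'

/-! ### A certificate checker for partial order types of blocked sets -/

/-- Partial information about the sign of a real number. -/
inductive Sg
  | unk
  | neg
  | zero
  | pos
  deriving DecidableEq

namespace Sg

/-- `x` has the sign recorded by `s`. -/
def Holds : Sg → ℝ → Prop
  | unk, _ => True
  | neg, x => x < 0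
  | zero, x => x = 0
  | pos, x => 0 < x

/-- The sign of `-x`. -/
def opp : Sg → Sg
  | unk => unk
  | neg => pos
  | zero => zero
  | pos => neg

/-- The sign of `x + y`. -/
def add : Sg → Sg → Sg
  | zero, t => t
  | s, zero => s
  | pos, pos => pos
  | neg, neg => neg
  | _, _ => unk

/-- The sign of `x * y`. -/
def mul : Sg → Sg → Sg
  | zero, _ => zero
  | _, zero => zero
  | pos, t => t
  | neg, t => t.opp
  | unk, _ => unk

/-- The sign of `x` in terms of the signs of `x * y` and of `y`. -/
def div : Sg → Sg → Sg
  | s, pos => s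
  | s, neg => s.opp
  | _, _ => unk

lemma Holds.opp {s : Sg} {x : ℝ} (h : s.Holds x) : s.opp.Holds (-x) := by
  cases s <;> simp_all [Holds, Sg.opp]

lemma Holds.add {s t : Sg} {x y : ℝ} (h : s.Holds x) (h' : t.Holds y) :
    (s.add t).Holds (x + y) := by
  cases s <;> cases t <;> simp_all [Holds, Sg.add] <;> linarith

lemma Holds.mul {s t : Sg} {x y : ℝ} (h : s.Holds x) (h' : t.Holds y) :
    (s.mul t).Holds (x * y) := by
  cases s <;> cases t <;> simp_all [Holds, Sg.mul, Sg.opp] <;> nlinarith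

lemma Holds.div {s t : Sg} {x y : ℝ} (h : s.Holds (x * y)) (h' : t.Holds y) :
    (s.div t).Holds x := by
  cases t <;> cases s <;> simp only [Holds, Sg.div, Sg.opp] at *
  · by_contra! hx; nlinarith
  · exact (mul_eq_zero.1 h).resolve_right h'.ne
  · by_contra! hx; nlinarith
  · by_contra! hx; nlinarith
  · exact (mul_eq_zero.1 h).resolve_right h'.ne'
  · by_contra! hx; nlinarith

lemma Holds.of_mul_pos {s : Sg} {a x : ℝ} (ha : 0 < a) (h : s.Holds x) : s.Holds (a * x) := by
  cases s <;> simp_all [Holds]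
  exact mul_neg_of_pos_of_neg ha h

lemma Holds.unique {s t : Sg} {x : ℝ} (h : s.Holds x) (h' : t.Holds x) (hs : s ≠ unk)
    (ht : t ≠ unk) : s = t := by
  cases s <;> cases t <;> simp_all [Holds] <;> linarith

end Sg

/-- The position of the triple `i, j, k` in a bit mask. -/
def tripleIdx (i j k : ℕ) : ℕ := (i * 16 + j) * 16 + k

/-- Adds the triple `i, j, k` to the bit mask `m`. -/
def addTriple (m i j k : ℕ) : ℕ := m ||| 1 <<< tripleIdx i j k

/-- All triples in the bit mask `m` are triples of labels below `n` satisfying `Q`. -/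
def MaskHolds (n m : ℕ) (Q : ℕ → ℕ → ℕ → Prop) : Prop :=
  ∀ i j k, i < 16 → j < 16 → k < 16 → m.testBit (tripleIdx i j k) = true →
    (i < n ∧ j < n ∧ k < n) ∧ Q i j k

lemma MaskHolds.zero (n : ℕ) (Q : ℕ → ℕ → ℕ → Prop) : MaskHolds n 0 Q := by
  intro i j k _ _ _ h
  simp at h

lemma MaskHolds.insert {n m : ℕ} {Q : ℕ → ℕ → ℕ → Prop} (h : MaskHolds n m Q) (hn : n ≤ 16)
    {a b d : ℕ} (ha : a < n) (hb : b < n) (hd : d < n) (hQ : Q a b d) :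
    MaskHolds n (addTriple m a b d) Q := by
  intro i j k hi hj hk ht
  rw [addTriple, Nat.testBit_or, Nat.one_shiftLeft, Nat.testBit_two_pow] at ht
  rcases Bool.or_eq_true_iff.1 ht with ht | ht
  · exact h i j k hi hj hk ht
  · have := of_decide_eq_true ht
    unfold tripleIdx at this
    obtain ⟨rfl, rfl, rfl⟩ : a = i ∧ b = j ∧ d = k := by omega
    exact ⟨⟨ha, hb, hd⟩, hQ⟩

lemma MaskHolds.mono {n n' m : ℕ} {Q Q' : ℕ → ℕ → ℕ → Prop} (h : MaskHolds n m Q) (hn : n ≤ n')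
    (hQ : ∀ i j k, i < n → j < n → k < n → Q i j k → Q' i j k) : MaskHolds n' m Q' := by
  intro i j k hi hj hk ht
  obtain ⟨⟨h1, h2, h3⟩, h4⟩ := h i j k hi hj hk ht
  exact ⟨⟨h1.trans_le hn, h2.trans_le hn, h3.trans_le hn⟩, hQ i j k h1 h2 h3 h4⟩

/-- A description of some labelled points of a `4`-coloured set: their colours, some positively
oriented triples, some triples `x, v, w` with `x` strictly between `v` and `w`, bounds for the
sizes of the colour classes, labels of vertices of the convex hull, and whether colour `1` is
required to occur at least three times. -/
structure Config where
  cols : List ℕ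
  pos : List (ℕ × ℕ × ℕ)
  btw : List (ℕ × ℕ × ℕ)
  cap : List ℕ
  ext : List ℕ := []
  need : Bool := false

namespace Config

/-- The conditions of a configuration that do not depend on the labelled points. -/
structure Ambient (R : Config) (P : Set (ℝ × ℝ)) (c : ℝ × ℝ → Fin 4) : Prop where
  finite : P.Finite
  blocked : BlockedColouring P c
  cap : ∀ j : Fin 4, (P ∩ c ⁻¹' {j}).ncard ≤ R.cap.getD j 0
  need : R.need = true → 3 ≤ (P ∩ c ⁻¹' {1}).ncard

/-- The labelled points `f` fit the configuration `R`, with orientations multiplied by `e`. -/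
structure Holds (R : Config) (P : Set (ℝ × ℝ)) (c : ℝ × ℝ → Fin 4) (e : ℝ) (f : ℕ → ℝ × ℝ) :
    Prop where
  mem : ∀ i < R.cols.length, f i ∈ P
  col : ∀ i < R.cols.length, (c (f i) : ℕ) = R.cols.getD i 0
  inj : ∀ i < R.cols.length, ∀ j < R.cols.length, f i = f j → i = j
  pos : ∀ t ∈ R.pos, 0 < e * orient (f t.1) (f t.2.1) (f t.2.2)
  btw : ∀ t ∈ R.btw, f t.1 ∈ openSegment ℝ (f t.2.1) (f t.2.2)
  ext : ∀ i ∈ R.ext, f i ∉ convexHull ℝ (P \ {f i})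

/-- The configuration does not occur in any blocked set. -/
def Closed (R : Config) : Prop :=
  ∀ P c e f, e ≠ 0 → R.Ambient P c → R.Holds P c e f → False

end Config

/-- Colours of the labelled points, and bit masks of the positively oriented, the collinear and
the betweenness triples. -/
structure PState where
  cols : List ℕ
  pos : ℕ
  zero : ℕ
  btw : ℕ

namespace PState

/-- The number of labelled points. -/
def size (S : PState) : ℕ := S.cols.length

/-- The colour of a labelled point. -/
def col (S : PState) (i : ℕ) : ℕ := S.cols.getD i 0

/-- The known sign of a triple. -/
def sgn (S : PState) (i j k : ℕ) : Sg :=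
  if S.pos.testBit (tripleIdx i j k) then .pos
  else if S.pos.testBit (tripleIdx j i k) then .neg
  else if S.zero.testBit (tripleIdx i j k) || i == j || j == k || i == k then .zero
  else .unk

/-- Records a positively oriented triple. -/
def addPos (S : PState) (i j k : ℕ) : PState :=
  { S with pos := addTriple (addTriple (addTriple S.pos i j k) j k i) k i j }

/-- Records a collinear triple. -/
def addZero (S : PState) (i j k : ℕ) : PState :=
  { S with zero := addTriple (addTriple (addTriple (addTriple (addTriple (addTriple S.zero
      i j k) j k i) k i j) j i k) i k j) k j i }

/-- Records the sign of a triple. -/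
def addSgn (S : PState) (i j k : ℕ) : Sg → PState
  | .unk => S
  | .pos => S.addPos i j k
  | .neg => S.addPos j i k
  | .zero => S.addZero i j k

/-- Records that `x` is between `v` and `w`. -/
def addBtw (S : PState) (x v w : ℕ) : PState :=
  { S.addZero x v w with btw := addTriple (addTriple S.btw x v w) x w v }

/-- Adds a point of colour `j`. -/
def addPoint (S : PState) (j : ℕ) : PState := { S with cols := S.cols ++ [j] }

/-- The number of labelled points of colour `j`. -/
def count (S : PState) (j : ℕ) : ℕ := ((List.range S.size).filter fun i => S.col i == j).length

/-- `x` cannot be between `v` and `w`. -/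
def excluded (S : PState) (x v w : ℕ) : Bool :=
  S.sgn x v w == .pos || S.sgn x v w == .neg ||
    (List.range S.size).any fun y => !(y == x || y == v || y == w) &&
      (S.zero.testBit (tripleIdx x v y) || S.zero.testBit (tripleIdx x w y) ||
        S.zero.testBit (tripleIdx v w y))

/-- The labelled points `f` fit the state `S`. -/
structure Sat (S : PState) (R : Config) (P : Set (ℝ × ℝ)) (c : ℝ × ℝ → Fin 4) (e : ℝ)
    (f : ℕ → ℝ × ℝ) : Prop where
  le : S.size ≤ 16
  mem : ∀ i < S.size, f i ∈ P
  col : ∀ i < S.size, (c (f i) : ℕ) = S.col i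
  inj : ∀ i < S.size, ∀ j < S.size, f i = f j → i = j
  pos : MaskHolds S.size S.pos fun i j k => 0 < e * orient (f i) (f j) (f k)
  zero : MaskHolds S.size S.zero fun i j k => e * orient (f i) (f j) (f k) = 0
  btw : MaskHolds S.size S.btw fun i j k => f i ∈ openSegment ℝ (f j) (f k)
  ext : ∀ i ∈ R.ext, i < S.size ∧ f i ∉ convexHull ℝ (P \ {f i})

/-- Some labelled points fit the state `S`. -/
def Realizable (S : PState) (R : Config) (P : Set (ℝ × ℝ)) (c : ℝ × ℝ → Fin 4) (e : ℝ) : Prop :=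
  ∃ f, S.Sat R P c e f

variable {S : PState} {R : Config} {P : Set (ℝ × ℝ)} {c : ℝ × ℝ → Fin 4} {e : ℝ} {f : ℕ → ℝ × ℝ}

lemma Sat.sgn (h : S.Sat R P c e f) {i j k : ℕ} (hi : i < 16) (hj : j < 16) (hk : k < 16) :
    (S.sgn i j k).Holds (e * orient (f i) (f j) (f k)) := by
  unfold PState.sgn
  split_ifs with h1 h2 h3
  · exact (h.pos i j k hi hj hk h1).2
  · have h4 : 0 < e * orient (f j) (f i) (f k) :=
      (h.pos j i k hj hi hk h2).2
    rw [orient_swap, mul_neg] at h4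
    exact neg_pos.1 h4
  · simp only [Bool.or_eq_true, beq_iff_eq] at h3
    rcases h3 with ((h3 | rfl) | rfl) | rfl
    · exact (h.zero i j k hi hj hk h3).2
    · simp [Sg.Holds, orient_self_left]
    · simp [Sg.Holds, orient_self_right]
    · simp [Sg.Holds, orient_self_outer]
  · trivial

lemma Sat.addPos (h : S.Sat R P c e f) {i j k : ℕ} (hi : i < S.size) (hj : j < S.size)
    (hk : k < S.size) (h0 : 0 < e * orient (f i) (f j) (f k)) : (S.addPos i j k).Sat R P c e f where
  __ := h
  pos := ((h.pos.insert h.le hi hj hk h0).insert h.le hj hk hi (by rwa [orient_rotate])).insert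
    h.le hk hi hj (by rwa [← orient_rotate])

lemma Sat.addZero (h : S.Sat R P c e f) {i j k : ℕ} (hi : i < S.size) (hj : j < S.size)
    (hk : k < S.size) (h0 : e * orient (f i) (f j) (f k) = 0) :
    (S.addZero i j k).Sat R P c e f where
  __ := h
  zero := by
    have h1 : e * orient (f j) (f i) (f k) = 0 := by rw [orient_swap, mul_neg, h0, neg_zero]
    exact (((((h.zero.insert h.le hi hj hk h0).insert h.le hj hk hi (by rwa [orient_rotate])).insert
      h.le hk hi hj (by rwa [← orient_rotate])).insert h.le hj hi hk h1).insert h.le hi hk hj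
      (by rwa [orient_rotate])).insert h.le hk hj hi (by rwa [← orient_rotate])

lemma Sat.addSgn (h : S.Sat R P c e f) {i j k : ℕ} (hi : i < S.size) (hj : j < S.size)
    (hk : k < S.size) {s : Sg} (h0 : s.Holds (e * orient (f i) (f j) (f k))) :
    (S.addSgn i j k s).Sat R P c e f := by
  cases s
  · exact h
  · refine h.addPos hj hi hk ?_
    rw [orient_swap, mul_neg]
    exact neg_pos.2 h0
  · exact h.addZero hi hj hk h0
  · exact h.addPos hi hj hk h0

lemma Sat.addBtw (h : S.Sat R P c e f) {x v w : ℕ} (hx : x < S.size) (hv : v < S.size)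
    (hw : w < S.size) (h0 : f x ∈ openSegment ℝ (f v) (f w)) : (S.addBtw x v w).Sat R P c e f where
  __ := h.addZero hx hv hw (by rw [orient_eq_zero_of_mem_openSegment h0, mul_zero])
  btw := (h.btw.insert h.le hx hv hw h0).insert h.le hx hw hv (by rwa [openSegment_symm])

lemma size_addPoint (S : PState) (j : ℕ) : (S.addPoint j).size = S.size + 1 := by
  simp [size, addPoint]

lemma Sat.addPoint (h : S.Sat R P c e f) (hn : S.size < 16) {x : ℝ × ℝ} (hx : x ∈ P)
    (hfresh : ∀ i < S.size, f i ≠ x) :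
    (S.addPoint (c x)).Sat R P c e (Function.update f S.size x) := by
  have hlt : ∀ i < S.size, Function.update f S.size x i = f i := fun i hi =>
    Function.update_of_ne hi.ne _ _
  have hsize := size_addPoint S (c x)
  refine ⟨by omega, fun i hi => ?_, fun i hi => ?_, fun i hi j hj hij => ?_, ?_, ?_, ?_,
    fun i hi => ?_⟩
  · rcases (Nat.lt_succ_iff_lt_or_eq.1 (hsize ▸ hi)) with hi | rfl
    · rw [hlt i hi]; exact h.mem i hi
    · simpa using hx
  · rcases (Nat.lt_succ_iff_lt_or_eq.1 (hsize ▸ hi)) with hi | rfl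
    · rw [hlt i hi, h.col i hi]
      simp only [PState.col, PState.addPoint]
      rw [List.getD_append _ _ _ _ hi]
    · simp [PState.col, PState.addPoint, PState.size]
  · rcases (Nat.lt_succ_iff_lt_or_eq.1 (hsize ▸ hi)) with hi | rfl <;>
      rcases (Nat.lt_succ_iff_lt_or_eq.1 (hsize ▸ hj)) with hj | rfl
    · rw [hlt i hi, hlt j hj] at hij
      exact h.inj i hi j hj hij
    · rw [hlt i hi, Function.update_self] at hij
      exact absurd hij (hfresh i hi)
    · rw [hlt j hj, Function.update_self] at hij
      exact absurd hij.symm (hfresh j hj)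
    · rfl
  · exact h.pos.mono (by omega) fun i j k hi hj hk => by rw [hlt i hi, hlt j hj, hlt k hk]; exact id
  · exact h.zero.mono (by omega) fun i j k hi hj hk => by
      rw [hlt i hi, hlt j hj, hlt k hk]; exact id
  · exact h.btw.mono (by omega) fun i j k hi hj hk => by rw [hlt i hi, hlt j hj, hlt k hk]; exact id
  · obtain ⟨h1, h2⟩ := h.ext i hi
    exact ⟨by omega, by rwa [hlt i h1]⟩

lemma Sat.count_lt (h : S.Sat R P c e f) (hP : P.Finite) {x : ℝ × ℝ} (hx : x ∈ P)
    (hfresh : ∀ i < S.size, f i ≠ x) : S.count (c x) < (P ∩ c ⁻¹' {c x}).ncard := by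
  classical
  set T := (List.range S.size).filter fun i => S.col i == (c x : ℕ)
  have hT : ∀ i ∈ T, i < S.size ∧ S.col i = c x := fun i hi => by
    simpa using List.mem_filter.1 hi
  have hnd : T.Nodup := List.nodup_range.filter _
  have hx' : x ∉ T.toFinset.image f := fun hm => by
    obtain ⟨i, hi, hix⟩ := Finset.mem_image.1 hm
    exact hfresh i (hT i (List.mem_toFinset.1 hi)).1 hix
  have hcard : (insert x (T.toFinset.image f)).card = S.count (c x) + 1 := by
    rw [Finset.card_insert_of_notMem hx', Finset.card_image_of_injOn, List.toFinset_card_of_nodup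
      hnd]
    · rfl
    · intro i hi j hj hij
      exact h.inj i (hT i (List.mem_toFinset.1 hi)).1 j (hT j (List.mem_toFinset.1 hj)).1 hij
  rw [← Nat.succ_le_iff, Nat.succ_eq_add_one, ← hcard, ← Set.ncard_coe_finset]
  refine Set.ncard_le_ncard ?_ (hP.subset Set.inter_subset_left)
  intro u hu
  rcases Finset.mem_insert.1 (Finset.mem_coe.1 hu) with rfl | hu
  · exact ⟨hx, rfl⟩
  · obtain ⟨i, hi, rfl⟩ := Finset.mem_image.1 hu
    obtain ⟨h1, h2⟩ := hT i (List.mem_toFinset.1 hi)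
    exact ⟨h.mem i h1, Fin.ext ((h.col i h1).trans h2)⟩

lemma Sat.exists_fresh (h : S.Sat R P c e f) {j : Fin 4}
    (hj : S.count j < (P ∩ c ⁻¹' {j}).ncard) : ∃ x ∈ P, c x = j ∧ ∀ i < S.size, f i ≠ x := by
  classical
  by_contra! hx
  set T := (List.range S.size).filter fun i => S.col i == (j : ℕ)
  have hsub : P ∩ c ⁻¹' {j} ⊆ (T.toFinset.image f : Finset (ℝ × ℝ)) := by
    rintro x ⟨hxP, hxj⟩
    obtain ⟨i, hi, rfl⟩ := hx x hxP hxj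
    refine Finset.mem_coe.2 (Finset.mem_image.2 ⟨i, List.mem_toFinset.2 (List.mem_filter.2
      ⟨List.mem_range.2 hi, ?_⟩), rfl⟩)
    rw [beq_iff_eq, ← h.col i hi]
    exact congrArg Fin.val hxj
  have h1 := Set.ncard_le_ncard hsub (Finset.finite_toSet _)
  rw [Set.ncard_coe_finset] at h1
  have h2 : (T.toFinset.image f).card ≤ S.count j :=
    Finset.card_image_le.trans (List.toFinset_card_le T)
  omega

lemma Sat.excluded (h : S.Sat R P c e f) (he : e ≠ 0) (hR : R.Ambient P c) {x v w : ℕ}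
    (hx : x < S.size) (hv : v < S.size) (hw : w < S.size) (hvw : v ≠ w)
    (h0 : f x ∈ openSegment ℝ (f v) (f w)) : S.excluded x v w = false := by
  have hle := h.le
  have hz : e * orient (f x) (f v) (f w) = 0 := by
    rw [orient_eq_zero_of_mem_openSegment h0, mul_zero]
  have hs := h.sgn (hx.trans_le hle) (hv.trans_le hle) (hw.trans_le hle)
  rw [hz] at hs
  rw [Bool.eq_false_iff]
  intro hex
  simp only [PState.excluded, Bool.or_eq_true, beq_iff_eq, List.any_eq_true, List.mem_range,
    Bool.and_eq_true, Bool.not_eq_true', Bool.or_eq_false_iff, beq_eq_false_iff_ne] at hex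
  rcases hex with (hex | hex) | ⟨y, hy, ⟨⟨hyx, hyv⟩, hyw⟩, hex⟩
  · rw [hex] at hs; exact lt_irrefl _ hs
  · rw [hex] at hs; exact lt_irrefl _ hs
  · have hne := hR.blocked.orient_ne_zero_of_between hR.finite (h.mem x hx) (h.mem v hv)
      (h.mem w hw) (h.mem y hy) (fun e => hvw (h.inj v hv w hw e)) h0
      (fun e => hyx (h.inj y hy x hx e)) (fun e => hyv (h.inj y hy v hv e))
      (fun e => hyw (h.inj y hy w hw e))
    have hz0 : ∀ {i j k}, i < S.size → j < S.size → k < S.size →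
        S.zero.testBit (tripleIdx i j k) = true → orient (f i) (f j) (f k) = 0 :=
      fun hi hj hk ht => (mul_eq_zero.1 (h.zero _ _ _ (by omega) (by omega) (by omega)
        ht).2).resolve_left he
    rcases hex with (hex | hex) | hex
    · exact hne (orient_eq_zero_of_between h0 (hz0 hx hv hy hex))
    · rw [openSegment_symm] at h0
      rw [orient_swap, orient_eq_zero_of_between h0 (hz0 hx hw hy hex), neg_zero] at hne
      exact hne rfl
    · exact hne (hz0 hv hw hy hex)

end PState

namespace PState

/-- The hexadecimal digit of `t` at position `m`. -/
def digit (t m : ℕ) : ℕ := t / 16 ^ m % 16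

/-- Uses the derived sign `s` of a triple. -/
def conclude (S : PState) (i j k : ℕ) (s : Sg) : List PState :=
  if s = .unk then [S]
  else if S.sgn i j k = .unk then [S.addSgn i j k s]
  else if S.sgn i j k = s then [S] else []

/-- The case where `x` is between `v` and `w`. -/
def between (S : PState) (x v w : ℕ) : List PState :=
  if S.col v == S.col w && !(S.col x == S.col v) && !S.excluded x v w then [S.addBtw x v w] else []

/-- The cases for the sign of a triple. -/
def split (S : PState) (i j k : ℕ) : List PState :=
  if i == j || j == k || k == i then [S]
  else S.addSgn i j k .pos :: S.addSgn i j k .neg ::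
    (S.between i j k ++ S.between j k i ++ S.between k i j)

/-- The cases for the point between `v` and `w`. -/
def block (R : Config) (S : PState) (v w : ℕ) : List PState :=
  if S.col v == S.col w && !(v == w) then
    ((List.range S.size).flatMap fun x => S.between x v w) ++
      (List.range 4).flatMap fun j =>
        if !(j == S.col v) && decide (S.count j < R.cap.getD j 0) then
          [if S.size < 16 then (S.addPoint j).addBtw S.size v w else S]
        else []
  else [S]

/-- The triangle of `x, y, z` is monochromatic but contains no point of colour `0`. -/
def missing (R : Config) (S : PState) (x y z : ℕ) : Bool :=
  let s := S.sgn x y z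
  S.col x == S.col y && S.col y == S.col z && !(S.col x == 0) && !(s == .unk) && !(s == .zero) &&
    decide (R.cap.getD 0 0 ≤ S.count 0) && (List.range S.size).all fun l =>
      !(S.col l == 0) || R.ext.contains l || S.sgn x y l == s.opp || S.sgn y z l == s.opp ||
        S.sgn z x l == s.opp

/-- The configuration `Q` occurs in `S` up to a permutation of the colours. -/
def occurs (R : Config) (S : PState) (Q : Config) (τ m : ℕ → ℕ) : Bool :=
  let k := Q.cols.length
  Q.ext.isEmpty && !Q.need && (List.range 4).all (fun j => decide (τ j < 4)) &&
    decide ((List.range 4).map τ).Nodup &&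
    ((List.range k).all fun i => decide (m i < S.size) && decide (Q.cols.getD i 0 < 4) &&
      S.col (m i) == τ (Q.cols.getD i 0)) &&
    decide ((List.range k).map m).Nodup &&
    ((Q.pos.all fun t => S.sgn (m t.1) (m t.2.1) (m t.2.2) == .pos) ||
      Q.pos.all fun t => S.sgn (m t.1) (m t.2.1) (m t.2.2) == .neg) &&
    (Q.btw.all fun t => S.btw.testBit (tripleIdx (m t.1) (m t.2.1) (m t.2.2))) &&
    (List.range 4).all fun j => decide (R.cap.getD (τ j) 0 ≤ Q.cap.getD j 0)

/-- One step of a certificate that depends only on the labels `i`, `j`, `k`, `l`, `m`: the affine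
relation, the Grassmann–Plücker relation, betweenness (twice), case distinctions for the sign of a
triple and for the blocker of a pair, and monochromatic triangles. -/
def derive (R : Config) (S : PState) (i j k l m : ℕ) : ℕ → List PState
  | 1 => S.conclude i j k (((S.sgn l j k).add (S.sgn i l k)).add (S.sgn i j l))
  | 2 => S.conclude i j k (.div (.add ((S.sgn i j l).mul (S.sgn i k m))
      ((S.sgn i j m).mul (S.sgn i k l)).opp) (S.sgn i l m))
  | 3 => if S.btw.testBit (tripleIdx k l m) then
      S.conclude i j k ((S.sgn i j l).add (S.sgn i j m)) else [S]
  | 4 => if S.btw.testBit (tripleIdx k l m) then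
      S.conclude i j l ((S.sgn i j k).add (S.sgn i j m).opp) else [S]
  | 5 => S.split i j k
  | 6 => S.block R i j
  | 7 => if S.missing R i j k then [] else [S]
  | _ => [S]

/-- One step of a certificate: `S` is replaced by a list of states, one of which is realizable if
`S` is. Apart from the steps of `derive`, there may be a third point of colour `1`, and an
occurrence of a configuration in `L`. -/
def expand (R : Config) (L : List Config) (S : PState) (t : ℕ) : List PState :=
  if t % 16 = 8 then
    if R.need && decide (S.count 1 < 3) && decide (S.size < 16) then [S.addPoint 1] else [S]
  else if t % 16 = 9 then
    if (L[digit t 1 + 16 * digit t 2]?).any fun Q =>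
      S.occurs R Q (fun a => digit t (3 + a)) (fun a => digit t (7 + a)) then [] else [S]
  else if digit t 1 < S.size ∧ digit t 2 < S.size ∧ digit t 3 < S.size ∧ digit t 4 < S.size ∧
      digit t 5 < S.size then
    S.derive R (digit t 1) (digit t 2) (digit t 3) (digit t 4) (digit t 5) (t % 16)
  else [S]

/-- Checks a certificate for a list of states. -/
def run (R : Config) (L : List Config) : List PState → List ℕ → Bool
  | [], _ => true
  | _ :: _, [] => false
  | S :: l, t :: ts => run R L (S.expand R L t ++ l) ts

variable {S : PState} {R : Config} {P : Set (ℝ × ℝ)} {c : ℝ × ℝ → Fin 4} {e : ℝ} {f : ℕ → ℝ × ℝ}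

lemma digit_lt (t m : ℕ) : digit t m < 16 := Nat.mod_lt _ (by norm_num)

lemma Sat.conclude (h : S.Sat R P c e f) {i j k : ℕ} (hi : i < S.size) (hj : j < S.size)
    (hk : k < S.size) {s : Sg} (hs : s.Holds (e * orient (f i) (f j) (f k))) :
    ∃ S' ∈ S.conclude i j k s, S'.Realizable R P c e := by
  have hle := h.le
  unfold PState.conclude
  split_ifs with h1 h2 h3
  · exact ⟨S, by simp, f, h⟩
  · exact ⟨_, List.mem_singleton_self _, f, h.addSgn hi hj hk hs⟩
  · exact ⟨S, by simp, f, h⟩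
  · exact absurd (Sg.Holds.unique (h.sgn (hi.trans_le hle) (hj.trans_le hle) (hk.trans_le hle)) hs
      h2 h1) h3

lemma Sat.between (h : S.Sat R P c e f) (he : e ≠ 0) (hR : R.Ambient P c) {x v w : ℕ}
    (hx : x < S.size) (hv : v < S.size) (hw : w < S.size) (hvw : v ≠ w)
    (h0 : f x ∈ openSegment ℝ (f v) (f w)) :
    ∃ S' ∈ S.between x v w, S'.Realizable R P c e := by
  have h1 := hR.blocked.eq_of_mem_openSegment (h.mem x hx) (h.mem v hv) (h.mem w hw) h0
  have h2 := hR.blocked.ne_of_mem_openSegment hR.finite (h.mem x hx) (h.mem v hv) (h.mem w hw)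
    (fun e => hvw (h.inj v hv w hw e)) h0
  rw [ne_eq, ← Fin.val_inj, h.col x hx, h.col v hv] at h2
  rw [← Fin.val_inj, h.col v hv, h.col w hw] at h1
  refine ⟨S.addBtw x v w, ?_, f, h.addBtw hx hv hw h0⟩
  unfold PState.between
  rw [if_pos (by simp [h1.symm, h2, h.excluded he hR hx hv hw hvw h0])]
  simp

lemma Sat.split (h : S.Sat R P c e f) (he : e ≠ 0) (hR : R.Ambient P c) {i j k : ℕ}
    (hi : i < S.size) (hj : j < S.size) (hk : k < S.size) :
    ∃ S' ∈ S.split i j k, S'.Realizable R P c e := by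
  unfold PState.split
  split_ifs with hd
  · exact ⟨S, by simp, f, h⟩
  simp only [Bool.or_eq_true, beq_iff_eq, not_or] at hd
  obtain ⟨⟨hij, hjk⟩, hki⟩ := hd
  rcases lt_trichotomy (e * orient (f i) (f j) (f k)) 0 with h0 | h0 | h0
  · exact ⟨_, by simp, f, h.addSgn hi hj hk (s := .neg) h0⟩
  · rcases between_of_orient_eq_zero ((mul_eq_zero.1 h0).resolve_left he)
      (fun e => hij (h.inj i hi j hj e)) (fun e => hjk (h.inj j hj k hk e))
      (fun e => hki (h.inj k hk i hi e)) with hb | hb | hb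
    · obtain ⟨S', hS, hS'⟩ := h.between he hR hi hj hk hjk hb
      exact ⟨S', by simp [hS], hS'⟩
    · obtain ⟨S', hS, hS'⟩ := h.between he hR hj hk hi hki hb
      exact ⟨S', by simp [hS], hS'⟩
    · obtain ⟨S', hS, hS'⟩ := h.between he hR hk hi hj hij hb
      exact ⟨S', by simp [hS], hS'⟩
  · exact ⟨_, by simp, f, h.addSgn hi hj hk (s := .pos) h0⟩

lemma Sat.block (h : S.Sat R P c e f) (he : e ≠ 0) (hR : R.Ambient P c) {v w : ℕ}
    (hv : v < S.size) (hw : w < S.size) : ∃ S' ∈ S.block R v w, S'.Realizable R P c e := by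
  unfold PState.block
  by_cases hd : (S.col v == S.col w && !(v == w)) = true
  swap
  · rw [if_neg hd]
    exact ⟨S, List.mem_singleton_self _, f, h⟩
  rw [if_pos hd]
  simp only [Bool.and_eq_true, beq_iff_eq, Bool.not_eq_true', beq_eq_false_iff_ne] at hd
  obtain ⟨hcol, hvw⟩ := hd
  have hne : f v ≠ f w := fun e => hvw (h.inj v hv w hw e)
  have hcvw : c (f v) = c (f w) := Fin.ext (by rw [h.col v hv, h.col w hw, hcol])
  obtain ⟨x, hx, hb⟩ := hR.blocked.exists_mem_openSegment (h.mem v hv) (h.mem w hw) hne hcvw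
  by_cases hex : ∃ i < S.size, f i = x
  · obtain ⟨i, hi, rfl⟩ := hex
    obtain ⟨S', hS, hS'⟩ := h.between he hR hi hv hw hvw hb
    exact ⟨S', List.mem_append_left _ (List.mem_flatMap.2 ⟨i, List.mem_range.2 hi, hS⟩), hS'⟩
  · push Not at hex
    have hcx := hR.blocked.ne_of_mem_openSegment hR.finite hx (h.mem v hv) (h.mem w hw) hne hb
    rw [ne_eq, ← Fin.val_inj, h.col v hv] at hcx
    have hcount := (h.count_lt hR.finite hx hex).trans_le (hR.cap (c x))
    have hmem : ∀ S₀ : PState, S₀ ∈ (if !((c x : ℕ) == S.col v) &&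
        decide (S.count (c x) < R.cap.getD (c x) 0) then [S₀] else []) := fun S₀ => by
      rw [if_pos (by simpa [hcx] using hcount)]
      exact List.mem_singleton_self _
    refine ⟨_, List.mem_append_right _ (List.mem_flatMap.2
      ⟨c x, List.mem_range.2 (c x).2, hmem _⟩), ?_⟩
    by_cases hn : S.size < 16
    · rw [if_pos hn]
      have hlt : ∀ i < S.size, Function.update f S.size x i = f i := fun i hi =>
        Function.update_of_ne hi.ne _ _
      refine ⟨_, (h.addPoint hn hx hex).addBtw ?_ ?_ ?_ ?_⟩
      · rw [size_addPoint]; omega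
      · rw [size_addPoint]; omega
      · rw [size_addPoint]; omega
      · rwa [hlt v hv, hlt w hw, Function.update_self]
    · rw [if_neg hn]
      exact ⟨f, h⟩

lemma Sat.missing (h : S.Sat R P c e f) (hR : R.Ambient P c) {x y z : ℕ}
    (hx : x < S.size) (hy : y < S.size) (hz : z < S.size) : S.missing R x y z = false := by
  have hle := h.le
  rw [Bool.eq_false_iff]
  intro hm
  simp only [PState.missing, Bool.and_eq_true, beq_iff_eq, Bool.not_eq_true', beq_eq_false_iff_ne,
    decide_eq_true_eq, List.all_eq_true, List.mem_range, Bool.or_eq_true, List.contains_iff_mem]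
    at hm
  obtain ⟨⟨⟨⟨⟨⟨hxy, hyz⟩, hx0⟩, hs1⟩, hs2⟩, hcap⟩, hall⟩ := hm
  have hs := h.sgn (hx.trans_le hle) (hy.trans_le hle) (hz.trans_le hle)
  set s := S.sgn x y z with hsdef
  have h0 : orient (f x) (f y) (f z) ≠ 0 := fun h0 => by
    rw [h0, mul_zero] at hs
    exact hs2 (Sg.Holds.unique hs (t := .zero) rfl hs1 (by decide))
  have hcx : c (f x) = c (f y) := Fin.ext (by rw [h.col x hx, h.col y hy, hxy])
  have hcy : c (f y) = c (f z) := Fin.ext (by rw [h.col y hy, h.col z hz, hyz])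
  obtain ⟨u, hu, huT, hcu⟩ := hR.blocked.exists_mem_convexHull_triple hR.finite (h.mem x hx)
    (h.mem y hy) (h.mem z hz) (fun e => h0 (by rw [e, orient_self_left]))
    (fun e => h0 (by rw [e, orient_self_right])) (fun e => h0 (by rw [e, orient_self_outer]))
    hcx hcy 0
  have hex : ∃ l < S.size, f l = u := by
    by_contra! hex
    have := h.count_lt hR.finite hu hex
    have h1 := hR.cap (c u)
    rw [hcu] at this h1
    exact absurd (hcap.trans_lt (this.trans_le h1)) (lt_irrefl _)
  obtain ⟨l, hl, rfl⟩ := hex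
  have hx0' : c (f x) ≠ 0 := fun e => hx0 (by rw [← h.col x hx, e]; rfl)
  have hside : ∀ v w t : ℝ × ℝ, ({v, w, t} : Set (ℝ × ℝ)) = {f x, f y, f z} →
      s.Holds (e * orient v w t) → ¬ s.opp.Holds (e * orient v w (f l)) := by
    intro v w t ht hp hn
    rw [← ht] at huT
    have key : ∀ r : ℝ, 0 ≤ r * orient v w t → 0 ≤ r * orient v w (f l) := fun r hr => by
      refine convexHull_min ?_ (convex_setOf_le_orient_mul v w r 0) huT
      rintro _ (rfl | rfl | rfl)
      · simp [orient_self_outer]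
      · simp [orient_self_right]
      · exact hr
    have k1 := key e
    have k2 := key (-e)
    rw [neg_mul, neg_mul] at k2
    cases hs' : s
    · exact hs1 hs'
    · rw [hs'] at hp hn; simp only [Sg.Holds, Sg.opp] at hp hn; linarith [k2 (by linarith)]
    · exact hs2 hs'
    · rw [hs'] at hp hn; simp only [Sg.Holds, Sg.opp] at hp hn; linarith [k1 (by linarith)]
  have hlcol : S.col l = 0 := by rw [← h.col l hl, hcu]; rfl
  have hsl : ∀ {i j : ℕ}, i < S.size → j < S.size → S.sgn i j l = s.opp →
      s.opp.Holds (e * orient (f i) (f j) (f l)) := fun hi hj hij =>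
    hij ▸ h.sgn (hi.trans_le hle) (hj.trans_le hle) (hl.trans_le hle)
  rcases hall l hl with (((h1 | h1) | h1) | h1) | h1
  · exact h1 hlcol
  · refine (h.ext l h1).2 (convexHull_mono ?_ huT)
    rintro _ (rfl | rfl | rfl)
    · exact ⟨h.mem x hx, fun e => hx0' (by rw [e, hcu])⟩
    · exact ⟨h.mem y hy, fun e => hx0' (by rw [hcx, e, hcu])⟩
    · exact ⟨h.mem z hz, fun e => hx0' (by rw [hcx, hcy, e, hcu])⟩
  · exact hside _ _ _ rfl hs (hsl hx hy h1)
  · refine hside (f y) (f z) (f x) ?_ ?_ (hsl hy hz h1)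
    · rw [Set.pair_comm, Set.insert_comm]
    · rwa [orient_rotate]
  · refine hside (f z) (f x) (f y) ?_ ?_ (hsl hz hx h1)
    · rw [Set.insert_comm, Set.pair_comm]
    · rwa [← orient_rotate]

lemma Sat.occurs (h : S.Sat R P c e f) (he : e ≠ 0) (hR : R.Ambient P c) {Q : Config}
    (hQ : Q.Closed) {τ m : ℕ → ℕ} (hm : ∀ i, m i < 16) : S.occurs R Q τ m = false := by
  rw [Bool.eq_false_iff]
  intro ho
  simp only [PState.occurs, Bool.and_eq_true, beq_iff_eq, Bool.not_eq_true', decide_eq_true_eq,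
    List.all_eq_true, List.mem_range, Bool.or_eq_true, List.isEmpty_iff] at ho
  obtain ⟨⟨⟨⟨⟨⟨⟨⟨hext, hneed⟩, hτ⟩, hτn⟩, hcols⟩, hmn⟩, hpos⟩, hbtw⟩, hcap⟩ := ho
  have hinj : Function.Injective fun j : Fin 4 => (⟨τ j, hτ j j.2⟩ : Fin 4) := fun a b hab =>
    Fin.ext (List.inj_on_of_nodup_map hτn (List.mem_range.2 a.2) (List.mem_range.2 b.2)
      (Fin.mk.inj_iff.1 hab))
  set σ : Fin 4 ≃ Fin 4 := Equiv.ofBijective _ (Finite.injective_iff_bijective.1 hinj)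
  have hσ : ∀ j : Fin 4, ((σ j : Fin 4) : ℕ) = τ j := fun j => rfl
  have hamb : Q.Ambient P (σ.symm ∘ c) := by
    refine ⟨hR.finite, hR.blocked.comp σ.symm.injective, fun j => ?_, fun hn => ?_⟩
    · have : P ∩ (σ.symm ∘ c) ⁻¹' {j} = P ∩ c ⁻¹' {σ j} := by
        ext x; simp [Equiv.symm_apply_eq]
      rw [this]
      exact (hR.cap _).trans (hcap j j.2)
    · rw [hneed] at hn; cases hn
  have hholds : ∀ e' : ℝ, (∀ t ∈ Q.pos, 0 < e' * orient (f (m t.1)) (f (m t.2.1)) (f (m t.2.2))) →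
      Q.Holds P (σ.symm ∘ c) e' (fun i => f (m i)) := fun e' hp => by
    refine ⟨fun i hi => h.mem _ (hcols i hi).1.1, fun i hi => ?_, fun i hi j hj hij => ?_, hp,
      fun t ht => (h.btw _ _ _ (hm _) (hm _) (hm _) (hbtw t ht)).2, fun i hi => ?_⟩
    · obtain ⟨⟨h1, h2⟩, h3⟩ := hcols i hi
      have : c (f (m i)) = σ ⟨_, h2⟩ := Fin.ext (by rw [h.col _ h1, h3, hσ])
      simp [this]
    · exact List.inj_on_of_nodup_map hmn (List.mem_range.2 hi) (List.mem_range.2 hj)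
        (h.inj _ (hcols i hi).1.1 _ (hcols j hj).1.1 hij)
    · rw [hext] at hi; cases hi
  rcases hpos with hpos | hpos
  · refine hQ P _ e _ he hamb (hholds e fun t ht => ?_)
    have := h.sgn (hm t.1) (hm t.2.1) (hm t.2.2)
    rwa [hpos t ht] at this
  · refine hQ P _ (-e) _ (neg_ne_zero.2 he) hamb (hholds (-e) fun t ht => ?_)
    have := h.sgn (hm t.1) (hm t.2.1) (hm t.2.2)
    rw [hpos t ht] at this
    rw [neg_mul]
    exact neg_pos.2 this

lemma Sat.derive (h : S.Sat R P c e f) (he : e ≠ 0) (hR : R.Ambient P c) {i j k l m : ℕ}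
    (hi : i < S.size) (hj : j < S.size) (hk : k < S.size) (hl : l < S.size) (hm : m < S.size)
    (o : ℕ) : ∃ S' ∈ S.derive R i j k l m o, S'.Realizable R P c e := by
  have hle := h.le
  have self : ∃ S' ∈ [S], S'.Realizable R P c e := ⟨S, List.mem_singleton_self _, f, h⟩
  have hi' := hi.trans_le hle
  have hj' := hj.trans_le hle
  have hk' := hk.trans_le hle
  have hl' := hl.trans_le hle
  have hm' := hm.trans_le hle
  unfold PState.derive
  split
  · refine h.conclude hi hj hk ?_
    rw [orient_affine _ _ _ (f l), mul_add, mul_add]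
    exact ((h.sgn hl' hj' hk').add (h.sgn hi' hl' hk')).add (h.sgn hi' hj' hl')
  · refine h.conclude hi hj hk (Sg.Holds.div ?_ (h.sgn hi' hl' hm'))
    have := ((h.sgn hi' hj' hl').mul (h.sgn hi' hk' hm')).add
      ((h.sgn hi' hj' hm').mul (h.sgn hi' hk' hl')).opp
    convert this using 1
    linear_combination e ^ 2 * orient_mul_orient (f i) (f j) (f k) (f l) (f m)
  · by_cases hb : S.btw.testBit (tripleIdx k l m) = true
    · rw [if_pos hb]
      refine h.conclude hi hj hk ?_
      obtain ⟨a, b, ha, hb', hab, hx⟩ := (h.btw _ _ _ hk' hl' hm' hb).2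
      rw [← hx, orient_smul_add_smul hab, mul_add, mul_left_comm, mul_left_comm e]
      exact ((h.sgn hi' hj' hl').of_mul_pos ha).add ((h.sgn hi' hj' hm').of_mul_pos hb')
    · rwa [if_neg hb]
  · by_cases hb : S.btw.testBit (tripleIdx k l m) = true
    · rw [if_pos hb]
      refine h.conclude hi hj hl ?_
      obtain ⟨a, b, ha, hb', hab, hx⟩ := (h.btw _ _ _ hk' hl' hm' hb).2
      have h1 := h.sgn hi' hj' hk'
      have h2 := h.sgn hi' hj' hm'
      have := (h1.add (h2.of_mul_pos hb').opp).of_mul_pos (inv_pos.2 ha)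
      rw [← hx, orient_smul_add_smul hab] at this
      convert this using 1
      field_simp
      ring
    · rwa [if_neg hb]
  · exact h.split he hR hi hj hk
  · exact h.block he hR hi hj
  · rwa [h.missing hR hi hj hk]
  · exact self

lemma Realizable.expand (h : S.Realizable R P c e) (he : e ≠ 0) (hR : R.Ambient P c)
    {L : List Config} (hL : ∀ Q ∈ L, Q.Closed) (t : ℕ) :
    ∃ S' ∈ S.expand R L t, S'.Realizable R P c e := by
  obtain ⟨f, h⟩ := h
  have self : ∃ S' ∈ [S], S'.Realizable R P c e := ⟨S, List.mem_singleton_self _, f, h⟩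
  unfold PState.expand
  by_cases h8 : t % 16 = 8
  · rw [if_pos h8]
    by_cases hneed : (R.need && decide (S.count 1 < 3) && decide (S.size < 16)) = true
    · rw [if_pos hneed]
      simp only [Bool.and_eq_true, decide_eq_true_eq] at hneed
      obtain ⟨x, hx, hcx, hex⟩ := h.exists_fresh (j := 1)
        (lt_of_lt_of_le hneed.1.2 (hR.need hneed.1.1))
      have := h.addPoint hneed.2 hx hex
      rw [hcx] at this
      exact ⟨_, List.mem_singleton_self _, _, this⟩
    · rwa [if_neg hneed]
  rw [if_neg h8]
  by_cases h9 : t % 16 = 9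
  · rw [if_pos h9]
    cases hQ : L[digit t 1 + 16 * digit t 2]? with
    | none => exact self
    | some Q =>
      rw [Option.any_some, h.occurs he hR (hL Q (List.mem_of_getElem? hQ)) fun i => digit_lt t _]
      exact self
  rw [if_neg h9]
  by_cases hlt : digit t 1 < S.size ∧ digit t 2 < S.size ∧ digit t 3 < S.size ∧
      digit t 4 < S.size ∧ digit t 5 < S.size
  · rw [if_pos hlt]
    obtain ⟨hi, hj, hk, hl, hm⟩ := hlt
    exact h.derive he hR hi hj hk hl hm _
  · rwa [if_neg hlt]

lemma not_realizable_of_run {R : Config} {L : List Config} (he : e ≠ 0) (hR : R.Ambient P c)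
    (hL : ∀ Q ∈ L, Q.Closed) (ts : List ℕ) : ∀ l : List PState, run R L l ts = true →
    ∀ S ∈ l, ¬ S.Realizable R P c e := by
  induction ts with
  | nil =>
    intro l h
    cases l with
    | nil => simp
    | cons S l => simp [run] at h
  | cons t ts ih =>
    intro l h
    cases l with
    | nil => simp
    | cons S l =>
      have key := ih _ h
      intro S' hS' hr
      rcases List.mem_cons.1 hS' with rfl | hS'
      · obtain ⟨S'', h1, h2⟩ := hr.expand he hR hL t
        exact key S'' (List.mem_append_left _ h1) h2
      · exact key S' (List.mem_append_right _ hS') hr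

end PState

namespace Config

/-- The state described by a configuration. -/
def toState (R : Config) : PState :=
  R.btw.foldl (fun S t => S.addBtw t.1 t.2.1 t.2.2)
    (R.pos.foldl (fun S t => S.addPos t.1 t.2.1 t.2.2) ⟨R.cols, 0, 0, 0⟩)

/-- Checks a certificate for the closedness of a configuration. -/
def check (R : Config) (L : List Config) (ts : List ℕ) : Bool :=
  decide (R.cols.length ≤ 16) && (R.pos ++ R.btw).all (fun t => decide (t.1 < R.cols.length) &&
    decide (t.2.1 < R.cols.length) && decide (t.2.2 < R.cols.length)) &&
    R.ext.all (fun i => decide (i < R.cols.length)) && PState.run R L [R.toState] ts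

lemma closed_of_check {R : Config} {L : List Config} {ts : List ℕ} (h : R.check L ts = true)
    (hL : ∀ Q ∈ L, Q.Closed) : R.Closed := by
  intro P c e f he hR hf
  simp only [check, Bool.and_eq_true, decide_eq_true_eq, List.all_eq_true, List.mem_append] at h
  obtain ⟨⟨⟨hlen, hlt⟩, hext⟩, hrun⟩ := h
  refine PState.not_realizable_of_run he hR hL ts _ hrun _ (List.mem_singleton_self _) ⟨f, ?_⟩
  have h0 : (⟨R.cols, 0, 0, 0⟩ : PState).Sat R P c e f :=
    ⟨hlen, hf.mem, hf.col, hf.inj, .zero _ _, .zero _ _, .zero _ _,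
      fun i hi => ⟨hext i hi, hf.ext i hi⟩⟩
  have h1 : ∀ l : List (ℕ × ℕ × ℕ), ∀ S : PState, (∀ t ∈ l, t ∈ R.pos) → S.cols = R.cols →
      S.Sat R P c e f → (l.foldl (fun S t => S.addPos t.1 t.2.1 t.2.2) S).cols = R.cols ∧
      (l.foldl (fun S t => S.addPos t.1 t.2.1 t.2.2) S).Sat R P c e f := by
    intro l
    induction l with
    | nil => exact fun S _ h1 h2 => ⟨h1, h2⟩
    | cons t l ih =>
      intro S hl hS h2
      have ht := hl t (by simp)
      obtain ⟨⟨h3, h4⟩, h5⟩ := hlt t (Or.inl ht)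
      rw [← hS] at h3 h4 h5
      exact ih _ (fun t ht => hl t (by simp [ht])) hS (h2.addPos h3 h4 h5 (hf.pos t ht))
  have h2 : ∀ l : List (ℕ × ℕ × ℕ), ∀ S : PState, (∀ t ∈ l, t ∈ R.btw) → S.cols = R.cols →
      S.Sat R P c e f → (l.foldl (fun S t => S.addBtw t.1 t.2.1 t.2.2) S).Sat R P c e f := by
    intro l
    induction l with
    | nil => exact fun S _ h1 h2 => h2
    | cons t l ih =>
      intro S hl hS h2
      have ht := hl t (by simp)
      obtain ⟨⟨h3, h4⟩, h5⟩ := hlt t (Or.inr ht)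
      rw [← hS] at h3 h4 h5
      exact ih _ (fun t ht => hl t (by simp [ht])) hS (h2.addBtw h3 h4 h5 (hf.btw t ht))
  obtain ⟨h3, h4⟩ := h1 R.pos _ (fun t ht => ht) rfl h0
  exact h2 R.btw _ (fun t ht => ht) h3 h4

end Config

namespace Config

/-- A closed configuration does not occur up to a permutation of the colours. -/
lemma Closed.elim {R : Config} (hR : R.Closed) {P : Set (ℝ × ℝ)} {c : ℝ × ℝ → Fin 4}
    (hfin : P.Finite) (hc : BlockedColouring P c) (σ : Equiv.Perm (Fin 4)) {e : ℝ} (he : e ≠ 0)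
    (l : List (ℝ × ℝ)) (hl : ∀ x ∈ l, x ∈ P) (hcol : l.map (fun x => (σ (c x) : ℕ)) = R.cols)
    (hnd : l.Nodup)
    (hcap : ∀ j, (P ∩ c ⁻¹' {j}).ncard ≤ R.cap.getD (σ j) 0)
    (hpos : ∀ t ∈ R.pos, 0 < e * orient (l.getD t.1 0) (l.getD t.2.1 0) (l.getD t.2.2 0))
    (hbtw : ∀ t ∈ R.btw, l.getD t.1 0 ∈ openSegment ℝ (l.getD t.2.1 0) (l.getD t.2.2 0))
    (hext : ∀ i ∈ R.ext, l.getD i 0 ∉ convexHull ℝ (P \ {l.getD i 0}))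
    (hneed : R.need = true → 3 ≤ (P ∩ c ⁻¹' {σ.symm 1}).ncard) : False := by
  have hlen : R.cols.length = l.length := by rw [← hcol, List.length_map]
  have hget : ∀ i (hi : i < R.cols.length), l.getD i 0 = l[i]'(hlen ▸ hi) := fun i hi =>
    List.getD_eq_getElem _ _ _
  have hpre : ∀ j, P ∩ (σ ∘ c) ⁻¹' {j} = P ∩ c ⁻¹' {σ.symm j} := fun j => by
    ext x; simp [Equiv.eq_symm_apply]
  refine hR P (σ ∘ c) e (l.getD · 0) he ⟨hfin, hc.comp σ.injective, fun j => ?_, fun h => ?_⟩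
    ⟨fun i hi => ?_, fun i hi => ?_, fun i hi j hj hij => ?_, hpos, hbtw, hext⟩
  · rw [hpre]
    simpa using hcap (σ.symm j)
  · rw [hpre]
    exact hneed h
  · rw [hget i hi]
    exact hl _ (List.getElem_mem _)
  · rw [hget i hi, List.getD_eq_getElem _ _ hi]
    simp [← hcol]
  · rw [hget i hi, hget j hj] at hij
    exact (hnd.getElem_inj_iff).1 hij

end Config

lemma le_getD_of_perm {α : Fin 4} {σ : Equiv.Perm (Fin 4)} (hσ : σ α = 0) {N : Fin 4 → ℕ} {m n : ℕ}
    (hα : N α ≤ m) (h : ∀ j ≠ α, N j ≤ n) (j : Fin 4) : N j ≤ [m, n, n, n].getD (σ j) 0 := by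
  by_cases hj : j = α
  · subst hj
    simpa [hσ] using hα
  · have h0 : σ j ≠ 0 := fun h0 => hj (σ.injective (h0.trans hσ.symm))
    have := h j hj
    generalize σ j = i at h0
    fin_cases i <;> simp_all

lemma orient_mul_nonneg_of_mem_convexHull {e : ℝ} {a b u : ℝ × ℝ} {S : Set (ℝ × ℝ)}
    (h : ∀ v ∈ S, 0 ≤ e * orient a b v) (hu : u ∈ convexHull ℝ S) : 0 ≤ e * orient a b u :=
  convexHull_min (s := S) h (convex_setOf_le_orient_mul a b e 0) hu

lemma orient_mul_pos_of_mem_openSegment {e : ℝ} {a b x v w : ℝ × ℝ} (h : x ∈ openSegment ℝ v w)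
    (hv : 0 ≤ e * orient a b v) (hw : 0 < e * orient a b w) : 0 < e * orient a b x := by
  obtain ⟨s, t, hs, ht, hst, rfl⟩ := h
  rw [orient_smul_add_smul hst]
  nlinarith [mul_nonneg hs.le hv, mul_pos ht hw]

lemma orient_mul_pos_of_mem_openSegment' {e : ℝ} {a b x v w : ℝ × ℝ} (h : x ∈ openSegment ℝ v w)
    (hv : 0 < e * orient a b v) (hw : 0 ≤ e * orient a b w) : 0 < e * orient a b x :=
  orient_mul_pos_of_mem_openSegment (openSegment_symm ℝ v w ▸ h) hw hv

/-- The points of `S` are the vertices of a convex polygon. -/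
def IsPolygon (e : ℝ) (S : Set (ℝ × ℝ)) : Prop :=
  ∀ a ∈ S, ∃ b d, (∀ v ∈ S, 0 ≤ e * orient a b v) ∧ (∀ v ∈ S, 0 ≤ e * orient d a v) ∧
    0 < e * orient d a b

lemma IsPolygon.notMem_convexHull {e : ℝ} {S P : Set (ℝ × ℝ)} (hS : IsPolygon e S) (he : e ≠ 0)
    {a : ℝ × ℝ} (ha : a ∈ S) : a ∉ convexHull ℝ ((P ∩ convexHull ℝ S) \ {a}) := by
  obtain ⟨b, d, hb, hd, hdab⟩ := hS a ha
  exact notMem_convexHull_diff_singleton_of_cone he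
    (fun u hu => orient_mul_nonneg_of_mem_convexHull hb hu.2)
    (fun u hu => orient_mul_nonneg_of_mem_convexHull hd hu.2) hdab

namespace BlockedColouring

variable {P : Set (ℝ × ℝ)} {c : ℝ × ℝ → Fin 4}

lemma eq_of_mem_openSegment_of_mem (hc : BlockedColouring P c) (hfin : P.Finite)
    {x y v w : ℝ × ℝ} (hx : x ∈ P) (hy : y ∈ P) (hv : v ∈ P) (hw : w ∈ P) (hvw : v ≠ w)
    (h : x ∈ openSegment ℝ v w) (h' : y ∈ openSegment ℝ v w) : y = x := by
  by_contra hyx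
  refine hc.orient_ne_zero_of_between hfin hx hv hw hy hvw h hyx ?_ ?_ ?_
  · rintro rfl
    exact left_notMem_openSegment hvw h'
  · rintro rfl
    rw [openSegment_symm] at h'
    exact left_notMem_openSegment hvw.symm h'
  · rw [orient_rotate, orient_eq_zero_of_mem_openSegment h']

lemma ncard_inter_convexHull_le_two (hc : BlockedColouring P c) (hfin : P.Finite) {e : ℝ}
    (he : e ≠ 0) {S : Set (ℝ × ℝ)} (hS : IsPolygon e S) {α j : Fin 4} (hj : j ≠ α)
    (hα : ∀ u ∈ P, c u = α → u ∈ convexHull ℝ S → u ∈ S) :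
    (P ∩ convexHull ℝ S ∩ c ⁻¹' {j}).ncard ≤ 2 := by
  by_contra! h
  obtain ⟨x, y, z, hx, hy, hz, hxy, hxz, hyz⟩ := (Set.two_lt_ncard_iff
    ((hfin.inter_of_left _).inter_of_left _)).1 h
  have hx' : c x = j := hx.2
  have hy' : c y = j := hy.2
  have hz' : c z = j := hz.2
  obtain ⟨u, hu, huT, hcu⟩ := (hc.inter (convex_convexHull ℝ S)).exists_mem_convexHull_triple
    (hfin.inter_of_left _) hx.1 hy.1 hz.1 hxy hyz hxz.symm (hx'.trans hy'.symm)
    (hy'.trans hz'.symm) α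
  refine hS.notMem_convexHull he (hα u hu.1 hcu hu.2) (convexHull_mono ?_ huT) (P := P)
  rintro _ (rfl | rfl | rfl)
  · exact ⟨hx.1, fun e => hj (by rw [← hx', e, hcu])⟩
  · exact ⟨hy.1, fun e => hj (by rw [← hy', e, hcu])⟩
  · exact ⟨hz.1, fun e => hj (by rw [← hz', e, hcu])⟩

end BlockedColouring

lemma exists_perm_two : ∀ α m n : Fin 4, m ≠ α → n ≠ α →
    ∃ σ : Equiv.Perm (Fin 4), σ α = 0 ∧ σ m = 1 ∧ (σ n = 1 ∨ σ n = 2) := by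
  decide +kernel

lemma exists_perm_three : ∀ α o p r : Fin 4, o ≠ α → p ≠ α → r ≠ α →
    ∃ σ : Equiv.Perm (Fin 4), σ α = 0 ∧ σ o = 1 ∧ (σ p = 1 ∧ σ r = 1 ∨ σ p = 1 ∧ σ r = 2 ∨
      σ p = 2 ∧ σ r = 1 ∨ σ p = 2 ∧ σ r = 3 ∨ σ p = 2 ∧ σ r = 2) := by
  decide +kernel

lemma eq_one_or_eq_three : ∀ x : Fin 4, x ≠ 0 → x ≠ 2 → x = 1 ∨ x = 3 := by
  decide

/-- `a`, `b`, `d`, `f` are the vertices, in counterclockwise order if `e` is positive, of a convex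
quadrilateral, and points of `P` of the same colour. -/
structure ConvexQuad (P : Set (ℝ × ℝ)) (c : ℝ × ℝ → Fin 4) (e : ℝ) (a b d f : ℝ × ℝ) : Prop where
  ne_zero : e ≠ 0
  mem : a ∈ P ∧ b ∈ P ∧ d ∈ P ∧ f ∈ P
  col : c b = c a ∧ c d = c a ∧ c f = c a
  pos₀ : 0 < e * orient a b d
  pos₁ : 0 < e * orient b d f
  pos₂ : 0 < e * orient d f a
  pos₃ : 0 < e * orient f a b

namespace ConvexQuad

variable {P : Set (ℝ × ℝ)} {c : ℝ × ℝ → Fin 4} {e : ℝ} {a b d f : ℝ × ℝ}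

lemma rotate (h : ConvexQuad P c e a b d f) : ConvexQuad P c e b d f a :=
  ⟨h.ne_zero, ⟨h.mem.2.1, h.mem.2.2.1, h.mem.2.2.2, h.mem.1⟩,
    ⟨h.col.2.1.trans h.col.1.symm, h.col.2.2.trans h.col.1.symm, h.col.1.symm⟩,
    h.pos₁, h.pos₂, h.pos₃, h.pos₀⟩

lemma ne (h : ConvexQuad P c e a b d f) : a ≠ b ∧ a ≠ d ∧ a ≠ f ∧ b ≠ d ∧ b ≠ f ∧ d ≠ f := by
  obtain ⟨-, -, -, h0, h1, -, h3⟩ := h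
  refine ⟨?_, ?_, ?_, ?_, ?_, ?_⟩ <;> rintro rfl <;>
    simp_all [orient_self_left, orient_self_right, orient_self_outer]

lemma isPolygon (h : ConvexQuad P c e a b d f) : IsPolygon e {a, b, d, f} := by
  obtain ⟨-, -, -, h0, h1, h2, h3⟩ := h
  have r0 := h0
  have r1 := h1
  have r2 := h2
  have r3 := h3
  rw [← orient_rotate] at r0 r1 r2 r3
  have s0 := r0
  have s1 := r1
  have s2 := r2
  have s3 := r3
  rw [← orient_rotate] at s0 s1 s2 s3
  rintro _ (rfl | rfl | rfl | rfl)
  · refine ⟨b, f, ?_, ?_, h3⟩ <;> rintro _ (rfl | rfl | rfl | rfl) <;>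
      first | positivity | simp [orient_self_right, orient_self_outer]
  · refine ⟨d, a, ?_, ?_, h0⟩ <;> rintro _ (rfl | rfl | rfl | rfl) <;>
      first | positivity | simp [orient_self_right, orient_self_outer]
  · refine ⟨f, b, ?_, ?_, h1⟩ <;> rintro _ (rfl | rfl | rfl | rfl) <;>
      first | positivity | simp [orient_self_right, orient_self_outer]
  · refine ⟨a, d, ?_, ?_, h2⟩ <;> rintro _ (rfl | rfl | rfl | rfl) <;>
      first | positivity | simp [orient_self_right, orient_self_outer]

lemma inter (h : ConvexQuad P c e a b d f) :
    ConvexQuad (P ∩ convexHull ℝ {a, b, d, f}) c e a b d f where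
  __ := h
  mem := ⟨⟨h.mem.1, subset_convexHull ℝ _ (by simp)⟩, ⟨h.mem.2.1, subset_convexHull ℝ _ (by simp)⟩,
    ⟨h.mem.2.2.1, subset_convexHull ℝ _ (by simp)⟩, ⟨h.mem.2.2.2, subset_convexHull ℝ _ (by simp)⟩⟩

end ConvexQuad

/-- A convex quadrilateral `0123` of colour `0`, in a set with at most two points of each other
colour, together with further points. -/
def quadConfig (cols : List ℕ) (btw : List (ℕ × ℕ × ℕ)) : Config where
  cols := [0, 0, 0, 0] ++ cols
  pos := [(0, 1, 2), (1, 2, 3), (2, 3, 0), (3, 0, 1)]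
  btw := btw
  cap := [4, 2, 2, 2]

lemma quadConfig_11_closed :
    (quadConfig [1, 1]
      [(4, 0, 2), (5, 1, 3)]).Closed :=
  Config.closed_of_check (L := []) (by decide +kernel) (by simp) (ts :=
  [2113795, 2114307, 2114067, 2114339, 3232003, 3232515, 3232275, 3232547, 262, 1073955,
  774, 3174931, 534, 806, 1350, 5529859, 5534467, 5538323, 5542691, 3174931, 534,
  806, 1350, 5529859, 5534467, 5538323, 5542691, 806, 1350, 5529859, 5534467, 5538323,
  5542691, 1073955, 774, 3174931, 534, 806, 1350, 5529859, 5534467, 5538323, 5542691,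
  806, 1350, 5529859, 5534467, 5538323, 5542691, 3174931, 534, 806, 1350, 5529859,
  5534467, 5538323, 5542691])

lemma quadConfig_12_closed :
    (quadConfig [1, 2]
      [(4, 0, 2), (5, 1, 3)]).Closed :=
  Config.closed_of_check (L := []) (by decide +kernel) (by simp) (ts :=
  [2113795, 2114307, 2114067, 2114339, 3232003, 3232515, 3232275, 3232547, 262, 1073667,
  1073923, 1074195, 1073955, 1074211, 774, 3174915, 3174931, 3175459, 3175971, 3175475,
  3175987, 534, 2197059, 806, 3314179, 3315523, 3315555, 1606, 6566403, 6575907,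
  6576499, 1878, 7701011, 6582787, 6590979, 3174915, 3174931, 3175459, 3175971, 3175475,
  3175987, 534, 2195715, 2195971, 2196771, 2196787, 2197059, 806, 3314179, 3315795,
  1606, 6566403, 6574595, 2134, 8716548, 8745475, 6582787, 6590979, 2196771, 2196787,
  2197059, 806, 3314179, 3314691, 3315203, 3315523, 3315795, 3315555, 1606, 6566403,
  6576387, 6576499, 2390, 6582787, 6590979, 1073667, 1074435, 1073683, 1073939, 1074195,
  1073955, 1074211, 1074483, 774, 3174659, 3174915, 3174931, 3175955, 3175459, 3175971,
  3175475, 534, 2195971, 2197059, 2197347, 806, 3314451, 3315523, 1862, 7606532,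
  7624227, 7624803, 1622, 6656787, 7627011, 7635459, 3174915, 3174931, 3175459, 3175475,
  3176019, 534, 2195971, 2197059, 806, 3314179, 2118, 8663555, 8671747, 1622, 6627844,
  6656515, 8679939, 8688131, 2195971, 2197027, 2197043, 2197059, 806, 3313923, 3314179,
  3315235, 3315523, 3315811, 2374, 9703684, 9721379, 9721955, 1622, 9724163, 9732611,
  1073667, 1074435, 1073683, 1073939, 1074195, 1073955, 1074211, 1074483, 774, 3174659,
  3174915, 3174931, 3175955, 3175459, 3175971, 3175475, 534, 2195971, 2196483, 2197251,
  2196771, 2196787, 2197059, 2197347, 806, 3315523, 3315795, 1862, 7606532, 7624707,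
  7624803, 2134, 7627011, 7635459, 2195971, 2196771, 2196787, 806, 3313923, 3315523,
  3315795, 1862, 7606532, 2390, 9765124, 9789699, 7627011, 7635459, 3174915, 3174931,
  3175187, 3175203, 3175459, 3175475, 3176019, 534, 2195971, 2197283, 2197299, 2197059,
  806, 3314179, 3315523, 3315827, 2118, 8663555, 8673059, 8673651, 1878, 8679939,
  8688131, 2195971, 806, 3313923, 3314179, 3315523, 2374, 9703684, 9720323, 1878,
  7676420, 7700995, 9724163, 9732611, 3174915, 3174931, 3175187, 3175203, 3175459,
  3175475, 534, 2195971, 2196227, 2197283, 2197299, 2197059, 806, 3313923, 3314179,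
  3314691, 3315715, 3315523, 3315827, 2118, 8663555, 8673539, 8673651, 2390, 9789699,
  8679939, 8688131, 2195971, 2196227, 2196483, 2197027, 2197043, 2197059, 806, 3313923,
  3314179, 3315715, 3315523, 3315811, 2374, 9703684, 9721859, 9721955, 2134, 8745731,
  9724163, 9732611])

lemma quadConfig_111_closed :
    (quadConfig [1, 1, 1]
      [(4, 0, 2), (4, 1, 3), (5, 0, 1), (6, 2, 3)]).Closed :=
  Config.closed_of_check (L := []) (by decide +kernel) (by simp) (ts :=
  [2113795, 2114307, 2114067, 1069571, 1069827, 1070083, 1069587, 1069843, 1070099,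
  1069859, 1070115, 1070131, 3302659, 3302675, 3302691, 3302707, 25925, 25927, 25927])

lemma quadConfig_112_closed :
    (quadConfig [1, 1, 2]
      [(4, 0, 2), (4, 1, 3), (5, 0, 1), (6, 2, 3)]).Closed :=
  Config.closed_of_check (L := []) (by decide +kernel) (by simp) (ts :=
  [2113795, 2114307, 2114067, 2114339, 1069571, 1069827, 1070083, 1069587, 1069843,
  1070099, 1069859, 1070115, 1070131, 3301635, 3301891, 3302403, 3302659, 3302163,
  3302419, 3302675, 3302435, 3302691, 3302451, 3302707, 774, 3174931, 3175955, 3175971,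
  3175747, 3176003, 3176019, 534, 2196803, 2197347, 1350, 5530115, 5543779, 1894,
  3174931, 3175955, 3175971, 3175747, 3176003, 3176019, 534, 2196995, 2196803, 2197059,
  2197075, 2197347, 1350, 5530115, 5544035, 2150, 2196803, 2197059, 2197075, 1350,
  5530115, 5543427, 5543443, 5543779, 5544035, 2406])

lemma quadConfig_121_closed :
    (quadConfig [1, 2, 1]
      [(4, 0, 2), (4, 1, 3), (5, 0, 1), (6, 2, 3)]).Closed :=
  Config.closed_of_check (L := []) (by decide +kernel) (by simp) (ts :=
  [2113795, 2114307, 2114067, 2114339, 1069571, 1069827, 1070083, 1069587, 1069843,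
  1070099, 1069859, 1070115, 1070131, 3301635, 3302403, 3302659, 3302419, 3302675,
  3302435, 3302691, 3302451, 3302707, 774, 3174931, 3175699, 3175715, 3175747, 3176003,
  3176019, 534, 2197059, 2197331, 1606, 6574339, 6592339, 1878, 3174931, 3175699,
  3175715, 3175747, 3176003, 3176019, 534, 2196787, 2196803, 2197059, 2197075, 2197331,
  1606, 6574339, 6592595, 2134, 2196803, 2197059, 2197075, 1606, 6574339, 6591779,
  6591795, 6592339, 6592595, 2390])

lemma quadConfig_123_closed :
    (quadConfig [1, 2, 3]
      [(4, 0, 2), (4, 1, 3), (5, 0, 1), (6, 2, 3)]).Closed :=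
  Config.closed_of_check (L := []) (by decide +kernel) (by simp) (ts :=
  [2113795, 2114307, 2114067, 2114339, 1069571, 1069827, 1070083, 1069587, 1069843,
  1070099, 1069859, 1070115, 1070131, 3301891, 3302403, 3302659, 3302163, 3302419,
  3302675, 3302435, 3302691, 3302451, 3302707, 774, 3174915, 3174931, 3175187, 3175699,
  3175715, 3175747, 3176003, 534, 2195971, 2196787, 2196803, 2197075, 2197331, 1862,
  7635459, 7641171, 2134, 2195971, 2196803, 2197331, 1862, 7635459, 7639811, 7639827,
  7640355, 7641171, 2390, 9777924, 9790227, 3174915, 3174931, 3175187, 3175699, 3175715,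
  3175747, 3176019, 534, 2195971, 2196803, 2197059, 2197331, 2118, 8679939, 8689491,
  1878, 2197331, 1878, 7705107, 7705363, 2374, 9724691, 9732627, 3174915, 3174931,
  3175699, 3175715, 3175747, 534, 2195971, 2196787, 2196803, 2197059, 2197331, 2118,
  8679939, 8688131, 8688947, 8689491, 2390, 9773572, 9789955, 2195971, 2196787, 2196803,
  2197075, 2197331, 2134, 8753667, 2374, 9724419, 9728515])

lemma quadConfig_1221_closed :
    (quadConfig [1, 2, 2, 1]
      [(4, 0, 2), (4, 1, 3), (5, 0, 1), (6, 2, 3), (7, 5, 6)]).Closed :=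
  Config.closed_of_check (L := []) (by decide +kernel) (by simp) (ts :=
  [2114307, 2114067, 1069827, 1069587, 3302147, 3301907, 6648579, 6648339, 774, 3179027,
  534, 1862, 7635715, 7639571])

lemma quadConfig_1223_closed :
    (quadConfig [1, 2, 2, 3]
      [(4, 0, 2), (4, 1, 3), (5, 0, 1), (6, 2, 3), (7, 5, 6)]).Closed :=
  Config.closed_of_check (L := []) (by decide +kernel) (by simp) (ts :=
  [2113795, 2114307, 2114067, 2114339, 1069827, 1070083, 1069587, 1070099, 1070115,
  1070131, 3302147, 3302403, 3301907, 3302419, 3302435, 3302451, 6648579, 6648339, 774,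
  3178755, 3179011, 3179027, 3179283, 3179299, 3179843, 3180099, 534, 2200067, 2200579,
  2201603, 2200627, 2201651, 2118, 8681731, 8681779, 2422, 8688131, 3179011, 3179027,
  3179539, 3179555, 534, 2200067, 2201619, 2201635, 2200899, 2201155, 2374, 9730067,
  9730083, 2166, 9732611])

namespace ConvexQuad

variable {P : Set (ℝ × ℝ)} {c : ℝ × ℝ → Fin 4} {e : ℝ} {a b d f : ℝ × ℝ}

lemma ne_of_col (h : ConvexQuad P c e a b d f) {x : ℝ × ℝ} (hx : c x ≠ c a) :
    a ≠ x ∧ b ≠ x ∧ d ≠ x ∧ f ≠ x := by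
  obtain ⟨h1, h2, h3⟩ := h.col
  refine ⟨?_, ?_, ?_, ?_⟩ <;> rintro rfl <;> simp_all

lemma false_of_quadConfig (h : ConvexQuad P c e a b d f) (hfin : P.Finite)
    (hc : BlockedColouring P c) (hcap : (P ∩ c ⁻¹' {c a}).ncard ≤ 4)
    (hcap' : ∀ j ≠ c a, (P ∩ c ⁻¹' {j}).ncard ≤ 2) {cols : List ℕ} {btw : List (ℕ × ℕ × ℕ)}
    (hQ : (quadConfig cols btw).Closed) {σ : Equiv.Perm (Fin 4)} (hσ : σ (c a) = 0)
    (l : List (ℝ × ℝ)) (hl : ∀ x ∈ l, x ∈ P ∧ c x ≠ c a)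
    (hcol : l.map (fun x => (σ (c x) : ℕ)) = cols) (hnd : l.Nodup)
    (hbtw : ∀ t ∈ btw, ([a, b, d, f] ++ l).getD t.1 0 ∈
      openSegment ℝ (([a, b, d, f] ++ l).getD t.2.1 0) (([a, b, d, f] ++ l).getD t.2.2 0)) :
    False := by
  obtain ⟨h1, h2, h3⟩ := h.col
  obtain ⟨m1, m2, m3, m4⟩ := h.mem
  obtain ⟨n1, n2, n3, n4, n5, n6⟩ := h.ne
  refine hQ.elim hfin hc σ h.ne_zero ([a, b, d, f] ++ l) ?_ ?_ ?_
    (le_getD_of_perm hσ hcap hcap') ?_ hbtw (by simp [quadConfig]) (by simp [quadConfig])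
  · intro x hx
    rcases List.mem_append.1 hx with hx | hx
    · simp only [List.mem_cons, List.not_mem_nil, or_false] at hx
      rcases hx with rfl | rfl | rfl | rfl <;> assumption
    · exact (hl x hx).1
  · simp [quadConfig, hcol, h1, h2, h3, hσ]
  · refine List.Nodup.append (by simp [*]) hnd fun x hx hx' => ?_
    obtain ⟨k1, k2, k3, k4⟩ := h.ne_of_col (hl x hx').2
    simp [k1.symm, k2.symm, k3.symm, k4.symm] at hx
  · simpa [quadConfig] using ⟨h.pos₀, h.pos₁, h.pos₂, h.pos₃⟩

/-- In a convex quadrilateral of one colour, with few points of the other colours, some point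
blocks both diagonals and the blockers of opposite sides. -/
lemma exists_mem_openSegment (h : ConvexQuad P c e a b d f) (hfin : P.Finite)
    (hc : BlockedColouring P c) (hcap : (P ∩ c ⁻¹' {c a}).ncard ≤ 4)
    (hcap' : ∀ j ≠ c a, (P ∩ c ⁻¹' {j}).ncard ≤ 2) :
    ∃ o ∈ P, ∃ p ∈ P, ∃ r ∈ P, o ∈ openSegment ℝ a d ∧ o ∈ openSegment ℝ b f ∧
      p ∈ openSegment ℝ a b ∧ r ∈ openSegment ℝ d f ∧ o ∈ openSegment ℝ p r ∧ c p = c r ∧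
      c o ≠ c p ∧ c o ≠ c a ∧ c p ≠ c a ∧ p ≠ r := by
  obtain ⟨h1, h2, h3⟩ := h.col
  obtain ⟨ma, mb, md, mf⟩ := h.mem
  obtain ⟨n1, n2, n3, n4, n5, n6⟩ := h.ne
  obtain ⟨-, -, -, p0, p1, p2, p3⟩ := id h
  obtain ⟨o, ho, hob⟩ := hc.exists_mem_openSegment ma md n2 h2.symm
  obtain ⟨o', ho', hob'⟩ := hc.exists_mem_openSegment mb mf n5 (h1.trans h3.symm)
  have hco := hc.ne_of_mem_openSegment hfin ho ma md n2 hob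
  have hco' := hc.ne_of_mem_openSegment hfin ho' mb mf n5 hob'
  rw [h1] at hco'
  obtain rfl : o = o' := by
    by_contra hne
    obtain ⟨σ, s0, s1, s2 | s2⟩ := exists_perm_two _ _ _ hco hco'
    · exact h.false_of_quadConfig hfin hc hcap hcap' quadConfig_11_closed s0 [o, o'] (by simp [*])
        (by simp [*]) (by simp [hne]) (by simp [*])
    · exact h.false_of_quadConfig hfin hc hcap hcap' quadConfig_12_closed s0 [o, o'] (by simp [*])
        (by simp [*]) (by simp [hne]) (by simp [*])
  obtain ⟨p, hp, hpb⟩ := hc.exists_mem_openSegment ma mb n1 h1.symm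
  obtain ⟨r, hr, hrb⟩ := hc.exists_mem_openSegment md mf n6 (h2.trans h3.symm)
  have hcp := hc.ne_of_mem_openSegment hfin hp ma mb n1 hpb
  have hcr := hc.ne_of_mem_openSegment hfin hr md mf n6 hrb
  rw [h2] at hcr
  have z₁ : 0 ≤ e * orient a b a := by rw [orient_self_outer, mul_zero]
  have z₂ : 0 ≤ e * orient d f d := by rw [orient_self_outer, mul_zero]
  have q0 : 0 < e * orient a b f := by rwa [orient_rotate]
  have q2 : 0 < e * orient d f b := by rwa [orient_rotate]
  have vo := orient_mul_pos_of_mem_openSegment hob z₁ p0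
  have vr := orient_mul_pos_of_mem_openSegment hrb p0.le q0
  have wo := orient_mul_pos_of_mem_openSegment' hob p2 z₂
  have wp := orient_mul_pos_of_mem_openSegment hpb p2.le q2
  have vp : orient a b p = 0 := by
    rw [orient_rotate, orient_eq_zero_of_mem_openSegment hpb]
  have wr : orient d f r = 0 := by
    rw [orient_rotate, orient_eq_zero_of_mem_openSegment hrb]
  have hop : o ≠ p := by rintro rfl; simp [vp] at vo
  have hor : o ≠ r := by rintro rfl; simp [wr] at wo
  have hpr : p ≠ r := by rintro rfl; simp [vp] at vr
  obtain ⟨σ, s0, s1, ⟨s2, s3⟩ | ⟨s2, s3⟩ | ⟨s2, s3⟩ | ⟨s2, s3⟩ | ⟨s2, s3⟩⟩ :=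
    exists_perm_three _ _ _ _ hco hcp hcr
  · exact (h.false_of_quadConfig hfin hc hcap hcap' quadConfig_111_closed s0 [o, p, r]
      (by simp [*]) (by simp [*]) (by simp [*]) (by simp [*])).elim
  · exact (h.false_of_quadConfig hfin hc hcap hcap' quadConfig_112_closed s0 [o, p, r]
      (by simp [*]) (by simp [*]) (by simp [*]) (by simp [*])).elim
  · exact (h.false_of_quadConfig hfin hc hcap hcap' quadConfig_121_closed s0 [o, p, r]
      (by simp [*]) (by simp [*]) (by simp [*]) (by simp [*])).elim
  · exact (h.false_of_quadConfig hfin hc hcap hcap' quadConfig_123_closed s0 [o, p, r]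
      (by simp [*]) (by simp [*]) (by simp [*]) (by simp [*])).elim
  have hcpr : c p = c r := σ.injective (s2.trans s3.symm)
  have hcop : c o ≠ c p := fun e => by
    rw [e, s2] at s1
    exact absurd s1 (by decide)
  obtain ⟨x, hx, hxb⟩ := hc.exists_mem_openSegment hp hr hpr hcpr
  have vx := orient_mul_pos_of_mem_openSegment hxb (by simp [vp]) vr
  have wx := orient_mul_pos_of_mem_openSegment' hxb wp (by simp [wr])
  have hcx : c x ≠ c a := fun hca => by
    have hd : (x = a ∨ x = b) ∨ x = d ∨ x = f := by
      by_contra! hne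
      obtain ⟨⟨k1, k2⟩, k3, k4⟩ := hne
      have hcard : ({a, b, d, f, x} : Finset (ℝ × ℝ)).card = 5 := by
        simp [n1, n2, n3, n4, n5, n6, k1.symm, k2.symm, k3.symm, k4.symm]
      have hsub : (({a, b, d, f, x} : Finset (ℝ × ℝ)) : Set (ℝ × ℝ)) ⊆ P ∩ c ⁻¹' {c a} := by
        simp [Set.insert_subset_iff, *]
      have := Set.ncard_le_ncard hsub (hfin.inter_of_left _)
      rw [Set.ncard_coe_finset, hcard] at this
      omega
    rcases hd with (rfl | rfl) | rfl | rfl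
    · simp [orient_self_outer] at vx
    · simp [orient_self_right] at vx
    · simp [orient_self_outer] at wx
    · simp [orient_self_right] at wx
  obtain rfl : x = o := by
    by_contra hxo
    have hcx' := hc.ne_of_mem_openSegment hfin hx hp hr hpr hxb
    have hxp : p ≠ x := by rintro rfl; exact hcx' rfl
    have hxr : r ≠ x := by rintro rfl; exact hcx' hcpr.symm
    rcases eq_one_or_eq_three (σ (c x)) (fun e => hcx (σ.injective (e.trans s0.symm)))
      (fun e => hcx' (σ.injective (e.trans s2.symm))) with s4 | s4
    · exact h.false_of_quadConfig hfin hc hcap hcap' quadConfig_1221_closed s0 [o, p, r, x]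
        (by simp [*]) (by simp [*]) (by simp [*, Ne.symm hxo]) (by simp [*])
    · exact h.false_of_quadConfig hfin hc hcap hcap' quadConfig_1223_closed s0 [o, p, r, x]
        (by simp [*]) (by simp [*]) (by simp [*, Ne.symm hxo]) (by simp [*])
  exact ⟨x, ho, p, hp, r, hr, hob, hob', hpb, hrb, hxb, hcpr, hcop, hco, hcp, hpr⟩

end ConvexQuad

/-- The points `o`, `p`, `q`, `r`, `s` block the pairs of vertices of a convex quadrilateral, and
the diagonals of the quadrilateral `p`, `q`, `r`, `s`. -/
structure QuadBlockers (P : Set (ℝ × ℝ)) (c : ℝ × ℝ → Fin 4) (a b d f o p q r s : ℝ × ℝ) :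
    Prop where
  mem : o ∈ P ∧ p ∈ P ∧ q ∈ P ∧ r ∈ P ∧ s ∈ P
  diag₁ : o ∈ openSegment ℝ a d
  diag₂ : o ∈ openSegment ℝ b f
  side₁ : p ∈ openSegment ℝ a b
  side₂ : q ∈ openSegment ℝ b d
  side₃ : r ∈ openSegment ℝ d f
  side₄ : s ∈ openSegment ℝ f a
  between₁ : o ∈ openSegment ℝ p r
  between₂ : o ∈ openSegment ℝ q s
  col₁ : c p = c r
  col₂ : c q = c s
  ne₁ : p ≠ r
  ne₂ : q ≠ s
  col_ne : c o ≠ c p ∧ c o ≠ c q ∧ c p ≠ c q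
  col_ne' : c o ≠ c a ∧ c p ≠ c a ∧ c q ≠ c a

namespace ConvexQuad

variable {P : Set (ℝ × ℝ)} {c : ℝ × ℝ → Fin 4} {e : ℝ} {a b d f : ℝ × ℝ}

/-- A convex quadrilateral of one colour without further points of this colour is blocked by five
points in a grid-like arrangement. -/
lemma exists_quadBlockers (h : ConvexQuad P c e a b d f) (hfin : P.Finite)
    (hc : BlockedColouring P c)
    (hA : ∀ u ∈ P, c u = c a → u ∈ convexHull ℝ {a, b, d, f} → u ∈ ({a, b, d, f} : Set (ℝ × ℝ))) :
    ∃ o p q r s, QuadBlockers P c a b d f o p q r s := by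
  have hfin' := hfin.inter_of_left (convexHull ℝ {a, b, d, f})
  have hc' := hc.inter (convex_convexHull ℝ {a, b, d, f})
  have hcap : (P ∩ convexHull ℝ {a, b, d, f} ∩ c ⁻¹' {c a}).ncard ≤ 4 := by
    refine (Set.ncard_le_ncard (t := {a, b, d, f}) (fun u hu => hA u hu.1.1 hu.2 hu.1.2)
      (Set.toFinite _)).trans ?_
    have := Set.ncard_insert_le a {b, d, f}
    have := Set.ncard_insert_le b {d, f}
    have := Set.ncard_insert_le d {f}
    have := Set.ncard_singleton f
    omega
  have hcap' : ∀ j ≠ c a, (P ∩ convexHull ℝ {a, b, d, f} ∩ c ⁻¹' {j}).ncard ≤ 2 := fun j hj =>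
    hc.ncard_inter_convexHull_le_two hfin h.ne_zero h.isPolygon hj hA
  obtain ⟨o, ho, p, hp, r, hr, hob, hob', hpb, hrb, hpr, hcpr, hcop, hco, hcp, hne⟩ :=
    h.inter.exists_mem_openSegment hfin' hc' hcap hcap'
  have hcb : c b = c a := h.col.1
  obtain ⟨o', ho', q, hq, s, hs, hob₁, hob₂, hqb, hsb, hqs, hcqs, hcoq, -, hcq, hne'⟩ :=
    h.inter.rotate.exists_mem_openSegment hfin' hc' (hcb ▸ hcap) (hcb ▸ hcap')
  obtain rfl : o' = o := hc'.eq_of_mem_openSegment_of_mem hfin' ho ho' h.inter.mem.2.1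
    h.inter.mem.2.2.2 h.ne.2.2.2.2.1 hob' hob₁
  rw [hcb] at hcq
  refine ⟨o', p, q, r, s, ⟨ho.1, hp.1, hq.1, hr.1, hs.1⟩, hob, hob', hpb, hqb, hrb, hsb, hpr, hqs,
    hcpr, hcqs, hne, hne', ⟨hcop, hcoq, fun hpq => ?_⟩, hco, hcp, hcq⟩
  have hsub : ({p, q, r} : Set (ℝ × ℝ)) ⊆ P ∩ convexHull ℝ {a, b, d, f} ∩ c ⁻¹' {c p} := by
    rintro _ (rfl | rfl | rfl)
    exacts [⟨hp, rfl⟩, ⟨hq, hpq.symm⟩, ⟨hr, hcpr.symm⟩]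
  have h3 : ({p, q, r} : Set (ℝ × ℝ)).ncard = 3 := by
    refine Set.ncard_eq_three.2 ⟨p, q, r, ?_, hne, ?_, rfl⟩
    · rintro rfl
      have := orient_mul_pos_of_mem_openSegment hqb (by simp [orient_self_right]) h.pos₀
      rw [orient_rotate, orient_eq_zero_of_mem_openSegment hpb] at this
      simp at this
    · rintro rfl
      have := orient_mul_pos_of_mem_openSegment hrb (by simp [orient_self_right]) h.pos₁
      rw [orient_rotate, orient_eq_zero_of_mem_openSegment hqb] at this
      simp at this
  have := (Set.ncard_le_ncard hsub (hfin'.inter_of_left _)).trans (hcap' _ hcp)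
  omega

end ConvexQuad

/-! ### Configurations with five points of one colour -/

/-- A convex pentagon `01234` of colour `0`. -/
def pentagonConfig (cap : List ℕ) : Config where
  cols := [0, 0, 0, 0, 0]
  pos := [(0, 1, 2), (0, 1, 3), (0, 1, 4), (0, 2, 3), (0, 2, 4), (0, 3, 4), (1, 2, 3), (1, 2, 4),
    (1, 3, 4), (2, 3, 4)]
  btw := []
  cap := cap

/-- A point `4` in one of the four triangles cut out by the diagonals of a convex quadrilateral
`0123`, all of colour `0`. -/
def pointInQuadConfig : Config where
  cols := [0, 0, 0, 0, 0]
  pos := [(0, 1, 2), (0, 1, 3), (0, 2, 3), (1, 2, 3), (0, 1, 4), (2, 0, 4), (1, 3, 4)]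
  btw := []
  cap := [5, 4, 4, 4]

/-- Two points `3` and `4` in a triangle `012`, all of colour `0`, together with further points. -/
def twoPointsInTriangleConfig (cols : List ℕ) (btw : List (ℕ × ℕ × ℕ)) (ext : List ℕ) :
    Config where
  cols := [0, 0, 0, 0, 0] ++ cols
  pos := [(0, 1, 2), (0, 1, 3), (1, 2, 3), (2, 0, 3), (0, 1, 4), (1, 2, 4), (2, 0, 4), (1, 4, 3),
    (2, 4, 3), (3, 4, 0)]
  btw := btw
  cap := [5, 4, 4, 4]
  ext := ext

/-- Five points of colour `0`. -/
def fivePointsConfig : Config where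
  cols := [0, 0, 0, 0, 0]
  pos := [(0, 1, 2)]
  btw := []
  cap := [5, 4, 4, 4]

set_option maxRecDepth 100000 in
lemma pentagonConfig_closed_of_le_two :
    (pentagonConfig [5, 2, 2, 2]).Closed :=
  Config.closed_of_check (L := []) (by decide +kernel) (by simp) (ts :=
    [262, 1069859, 1070115, 518, 774, 3174931, 1030, 4227603, 4227859, 4227875, 534,
     806, 3318803, 790, 1046, 1062, 4227603, 4227859, 4227875, 534, 806, 3318803,
     790, 1046, 1062, 806, 3318803, 790, 1046, 1062, 3174931, 1030, 4227603, 4227859,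
     4227875, 534, 806, 3318803, 790, 1046, 1062, 806, 3318803, 790, 1046, 1062,
     4227603, 4227859, 4227875, 534, 806, 3318803, 790, 1046, 1062, 774, 3174931,
     1030, 4227603, 4227859, 4227875, 534, 806, 3318803, 790, 1046, 1062, 4227603,
     4227859, 4227875, 534, 806, 3318803, 790, 1046, 1062, 806, 3318803, 790, 1046,
     1062, 3174931, 1030, 4227603, 4227859, 4227875, 534, 806, 3318803, 790, 1046,
     1062, 4227603, 4227859, 4227875, 534, 806, 3318803, 790, 1046, 1062, 806,
     3318803, 790, 1046, 1062, 3174931, 1030, 4227603, 4227859, 4227875, 534, 806,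
     3318803, 790, 1046, 1062, 806, 3318803, 790, 1046, 1062, 4227603, 4227859,
     4227875, 534, 806, 3318803, 790, 1046, 1062, 806, 3318803, 790, 1046, 1062,
     4227603, 4227859, 4227875, 534, 806, 3318803, 790, 1046, 1062, 806, 3318803,
     790, 1046, 1062, 774, 3174931, 1030, 4227603, 4227859, 4227875, 534, 806,
     3318803, 790, 1046, 1062, 806, 3318803, 790, 1046, 1062, 4227603, 4227859,
     4227875, 534, 806, 3318803, 790, 1046, 1062, 3174931, 1030, 4227603, 4227859,
     4227875, 534, 806, 3318803, 790, 1046, 1062, 806, 3318803, 790, 1046, 1062,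
     4227603, 4227859, 4227875, 534, 806, 3318803, 790, 1046, 1062, 806, 3318803,
     790, 1046, 1062, 4227603, 4227859, 4227875, 534, 806, 3318803, 790, 1046, 1062,
     806, 3318803, 790, 1046, 1062, 3174931, 1030, 4227603, 4227859, 4227875, 534,
     806, 3318803, 790, 1046, 1062, 4227603, 4227859, 4227875, 534, 806, 3318803,
     790, 1046, 1062, 806, 3318803, 790, 1046, 1062, 1069859, 1070115, 518, 774,
     3174931, 1030, 4227603, 4227859, 4227875, 534, 806, 3318803, 790, 1046, 1062,
     4227603, 4227859, 4227875, 534, 806, 3318803, 790, 1046, 1062, 806, 3318803,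
     790, 1046, 1062, 3174931, 1030, 4227603, 4227859, 4227875, 534, 806, 3318803,
     790, 1046, 1062, 4227603, 4227859, 4227875, 534, 806, 3318803, 790, 1046, 1062,
     806, 3318803, 790, 1046, 1062, 3174931, 1030, 4227603, 4227859, 4227875, 534,
     806, 3318803, 790, 1046, 1062, 806, 3318803, 790, 1046, 1062, 4227603, 4227859,
     4227875, 534, 806, 3318803, 790, 1046, 1062, 806, 3318803, 790, 1046, 1062,
     4227603, 4227859, 4227875, 534, 806, 3318803, 790, 1046, 1062, 806, 3318803,
     790, 1046, 1062, 774, 3174931, 1030, 4227603, 4227859, 4227875, 534, 806,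
     3318803, 790, 1046, 1062, 4227603, 4227859, 4227875, 534, 806, 3318803, 790,
     1046, 1062, 806, 3318803, 790, 1046, 1062, 3174931, 1030, 4227603, 4227859,
     4227875, 534, 806, 3318803, 790, 1046, 1062, 806, 3318803, 790, 1046, 1062,
     4227603, 4227859, 4227875, 534, 806, 3318803, 790, 1046, 1062, 774, 3174931,
     1030, 4227603, 4227859, 4227875, 534, 806, 3318803, 790, 1046, 1062, 806,
     3318803, 790, 1046, 1062, 4227603, 4227859, 4227875, 534, 806, 3318803, 790,
     1046, 1062, 806, 3318803, 790, 1046, 1062, 4227603, 4227859, 4227875, 534, 806,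
     3318803, 790, 1046, 1062, 806, 3318803, 790, 1046, 1062, 3174931, 1030, 4227603,
     4227859, 4227875, 534, 806, 3318803, 790, 1046, 1062, 806, 3318803, 790, 1046,
     1062, 4227603, 4227859, 4227875, 534, 806, 3318803, 790, 1046, 1062, 3174931,
     1030, 4227603, 4227859, 4227875, 534, 806, 3318803, 790, 1046, 1062, 806,
     3318803, 790, 1046, 1062, 4227603, 4227859, 4227875, 534, 806, 3318803, 790,
     1046, 1062, 1069859, 1070115, 518, 774, 3174931, 1030, 4227603, 4227859, 4227875,
     534, 806, 3318803, 790, 1046, 1062, 806, 3318803, 790, 1046, 1062, 4227603,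
     4227859, 4227875, 534, 806, 3318803, 790, 1046, 1062, 3174931, 1030, 4227603,
     4227859, 4227875, 534, 806, 3318803, 790, 1046, 1062, 806, 3318803, 790, 1046,
     1062, 4227603, 4227859, 4227875, 534, 806, 3318803, 790, 1046, 1062, 806,
     3318803, 790, 1046, 1062, 4227603, 4227859, 4227875, 534, 806, 3318803, 790,
     1046, 1062, 806, 3318803, 790, 1046, 1062, 3174931, 1030, 4227603, 4227859,
     4227875, 534, 806, 3318803, 790, 1046, 1062, 4227603, 4227859, 4227875, 534,
     806, 3318803, 790, 1046, 1062, 806, 3318803, 790, 1046, 1062, 774, 3174931,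
     1030, 4227603, 4227859, 4227875, 534, 806, 3318803, 790, 1046, 1062, 806,
     3318803, 790, 1046, 1062, 4227603, 4227859, 4227875, 534, 806, 3318803, 790,
     1046, 1062, 806, 3318803, 790, 1046, 1062, 4227603, 4227859, 4227875, 534, 806,
     3318803, 790, 1046, 1062, 806, 3318803, 790, 1046, 1062, 3174931, 1030, 4227603,
     4227859, 4227875, 534, 806, 3318803, 790, 1046, 1062, 806, 3318803, 790, 1046,
     1062, 4227603, 4227859, 4227875, 534, 806, 3318803, 790, 1046, 1062, 3174931,
     1030, 4227603, 4227859, 4227875, 534, 806, 3318803, 790, 1046, 1062, 806,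
     3318803, 790, 1046, 1062, 4227603, 4227859, 4227875, 534, 806, 3318803, 790,
     1046, 1062, 774, 3174931, 1030, 4227603, 4227859, 4227875, 534, 806, 3318803,
     790, 1046, 1062, 4227603, 4227859, 4227875, 534, 806, 3318803, 790, 1046, 1062,
     806, 3318803, 790, 1046, 1062, 3174931, 1030, 4227603, 4227859, 4227875, 534,
     806, 3318803, 790, 1046, 1062, 806, 3318803, 790, 1046, 1062, 4227603, 4227859,
     4227875, 534, 806, 3318803, 790, 1046, 1062])

set_option maxRecDepth 100000 in
lemma twoPointsInTriangleConfig_quadBlockers_closed :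
    (twoPointsInTriangleConfig [3, 1, 1, 2, 2] [(5, 1, 4), (5, 2, 3), (6, 1, 3), (7, 2, 4),
      (8, 1, 2), (9, 3, 4), (5, 6, 7), (5, 8, 9)] [0, 1, 2]).Closed :=
  Config.closed_of_check (L := []) (by decide +kernel) (by simp) (ts :=
    [4280579, 4280835, 4281347, 4280851, 4281107, 4281379, 4281395, 3298051, 3236099,
     3236355, 3236611, 3236867, 3237123, 3236371, 3236883, 3237139, 3236643, 3236899,
     3237155, 3236915, 3237171, 3237187, 4354307, 4354563, 4354819, 4355075, 4355331,
     4355587, 4354579, 4354835, 4355091, 4355347, 4355603, 4354851, 4355363, 4355619,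
     4355123, 4355379, 4355635, 4355395, 4355651, 2195715, 2195971, 2196243, 2196499,
     2196755, 2197011, 2197267, 2196259, 2196515, 2196771, 2197027, 2197283, 2196531,
     2196787, 2197043, 2197299, 2196803, 2197059, 2197315, 2197075, 2197331, 2197347,
     4428035, 4428291, 4428547, 4428803, 4429315, 4429571, 4428307, 4428563, 4428819,
     4429075, 4429331, 4429587, 4429843, 4428579, 4428835, 4429091, 4429347, 4429603,
     4429859, 4429107, 4429363, 4429619, 4429875, 4429123, 4429379, 4429635, 4429891,
     4429395, 4429667, 4429923, 4429939, 262, 1090051, 1090307, 1090563, 1090819,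
     1091075, 1091331, 1091587, 1091843, 1090067, 1090323, 1090835, 1091091, 1091859,
     1091619, 1091123, 1090883, 42565, 293474, 42855, 301666, 42581, 359010, 42855,
     359010, 42037, 236098, 774, 3179027, 3192371, 3192387, 3193443, 47719, 3191043,
     3191299, 3191811, 3192067, 3192323, 3192579, 3193091, 3193347, 3191315, 3191571,
     3191827, 3192083, 3192339, 3192851, 3193107, 3193363, 3192099, 3192355, 3192867,
     3191859, 3192115, 3192627, 3193139, 3192131, 3193155, 3192403, 3192659, 3192675,
     3193187, 3193443, 1030, 4227603, 4245299, 4245827, 4246339, 4246419, 2966, 12132868,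
     12153859, 12165379, 12177667, 12177923, 12178179, 12178435, 12179203, 12177939, 12179251,
     12178755, 12180547, 3414, 13959428, 14000387, 14009347, 14017027, 518, 2158851, 2159363,
     2160387, 2159123, 2161491, 3926, 16097539, 6276916, 6278468, 253810, 4054, 16584964,
     16593668, 16605955, 16613907, 16621827, 4245827, 4246419, 52119, 4243715, 4243971,
     4244227, 4244739, 4244995, 4245251, 4245763, 4246019, 4246275, 4243987, 4244499,
     4244755, 4245523, 4244259, 4244515, 4244771, 4245027, 4245539, 4245795, 4244787,
     4245299, 4245811, 4246067, 4246323, 4244803, 4245315, 4246083, 4246339, 4245075,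
     4245331, 4246099, 4246355, 4245347, 4246115, 4246163, 4246419, 3158, 12964355,
     12964611, 12964867, 12965123, 12965379, 12966403, 12964371, 12964883, 12965139, 12965907,
     12964643, 12965411, 12965171, 12966707, 12966963, 12966483, 12966739, 12965731, 12966499,
     12967027, 12967075, 54037, 224530, 85298, 93490, 3237074, 55911, 252689, 224530,
     93490, 2198834, 3245778, 3258066, 54309, 163138, 55143, 302370, 146754, 159042,
     163138, 171330, 4341138, 306482, 55877, 883266, 294306, 55927, 302498, 51829,
     842353, 55927, 55925, 55927, 42021, 306209, 306465, 167074, 51285, 841810,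
     1612882, 13162834, 3520978, 2966, 12132868, 12153859, 12165379, 12182835, 12184659, 60503,
     378945, 378993, 1837138, 841810, 1612882, 1878098, 1882194, 13150546, 13154642,
     13162834, 1416322, 6072706, 6076802, 1378498, 788545, 1882178, 1609810, 1423570,
     355474, 374897, 5951890, 5953170, 33541, 1095730, 47495, 1292290, 1091634, 1095730,
     3193474, 47701, 347042, 367522, 383906, 711490, 10803634, 2966, 12132868, 12153859,
     12181763, 12184371, 3670, 15008004, 15048963, 15072051, 15072147, 64407, 47653, 711458,
     1219538, 2966, 12132868, 12153859, 12165379, 12181763, 12184371, 12184147, 3670, 15008004,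
     15072051, 15072147, 64407, 52085, 830322, 486578, 494770, 502962, 51301, 49941,
     93234, 43109, 1706082, 535138, 1751138, 2662, 10939267, 60295, 10936579, 10937603,
     10939427, 10939443, 10939219, 10939507, 10939523, 10939539, 10939571, 3670, 3782, 15470852,
     42533, 47205, 2662, 10939267, 60295, 10936579, 10937603, 10939427, 10939443, 10939219,
     10939507, 10939523, 10939539, 10939571, 3670, 3782, 15470852, 2950, 12116227, 12116483,
     12116995, 12117251, 12118355, 12118403, 12119187, 3670, 15048963, 15072771, 15071619,
     15072403, 15072915, 3782, 15470852, 15475204, 15482771, 63879, 13525796, 13526308, 13527332,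
     13527348, 15069987, 389858, 4127010, 3077010, 63879, 15496195, 15507715, 2662, 10939267,
     60295, 10936579, 10937603, 10939427, 10939443, 10939219, 10939507, 10939523, 10939539,
     10939571, 3670, 3782, 15470852, 47205, 2662, 10939267, 60295, 10936579, 10937603,
     10939427, 10939443, 10939219, 10939507, 10939523, 10939539, 10939571, 3670, 3782, 15470852,
     2950, 12116227, 12116483, 12116995, 12117251, 12118355, 12118403, 12119187, 3670, 15048963,
     15072771, 15071619, 15072403, 15072915, 3782, 15470852, 15475204, 15482771, 63879, 13525796,
     13526308, 13527332, 13527348, 15069987, 389858, 4127010, 3077010, 63879, 15496195,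
     15507715, 2662, 10939267, 60295, 10936579, 10937603, 10939427, 10939443, 10939219, 10939507,
     10939523, 10939539, 10939571, 3670, 3782, 15470852, 10887684, 6980115, 93234, 3430,
     14082563, 14085203, 518, 2158851, 2159923, 2161491, 3926, 16097539, 6286420, 64599,
     14085171, 14085203, 60503, 2885730, 833634, 408706, 2950, 12116227, 12116483, 12116995,
     12117251, 12119091, 12119139, 12119187, 3670, 15048963, 3782, 15470852, 15475204, 15496195,
     15507715, 46117, 318242, 1219538, 2966, 12132868, 12153859, 12165379, 12181763, 12184371,
     12184147, 3670, 15008004, 15072051, 15072147, 64407, 309537, 174514, 49941, 224274,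
     93234, 52005, 158898, 167090, 175282, 43109, 1706082, 535138, 1751138, 1755234,
     2662, 10939267, 60295, 10936579, 10937603, 10939427, 10939443, 10939219, 10939507, 10939523,
     10939539, 10939571, 3670, 3782, 15470852, 51301, 42533, 47205, 2662, 10939267, 60295,
     10936579, 10937603, 10939427, 10939443, 10939219, 10939507, 10939523, 10939539, 10939571,
     3670, 3782, 15470852, 2950, 12116227, 12116483, 12117251, 12118355, 12119155, 12118403,
     12119187, 3670, 15048963, 15072771, 15071619, 15072403, 15072915, 3782, 15470852, 15475204,
     15482771, 63879, 13525796, 13526308, 13527332, 13527348, 15069987, 389858, 4127010,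
     3077010, 63879, 15507715, 2662, 10939267, 60295, 10936579, 10937603, 10939427, 10939443,
     10939219, 10939507, 10939523, 10939539, 10939571, 3670, 3782, 15470852, 47205, 2662,
     10939267, 60295, 10936579, 10937603, 10939427, 10939443, 10939219, 10939507, 10939523,
     10939539, 10939571, 3670, 3782, 15470852, 2950, 12116227, 12116483, 12117251, 12118355,
     12119155, 12118403, 12119187, 3670, 15048963, 15072771, 15071619, 15072403, 15072915, 3782,
     15470852, 15475204, 15482771, 63879, 13525796, 13526308, 13527332, 13527348, 15069987,
     389858, 4127010, 3077010, 63879, 15507715, 2662, 10939267, 60295, 10936579, 10937603,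
     10939427, 10939443, 10939219, 10939507, 10939523, 10939539, 10939571, 3670, 3782, 15470852,
     10887684, 444465, 1837154, 833634, 2950, 12116227, 12116483, 12117251, 12119091, 12119139,
     12119155, 12119187, 3670, 15048963, 3782, 15470852, 15475204, 15507715, 6980115, 43109,
     1706082, 535138, 1751138, 2662, 10939267, 60295, 10937603, 10939219, 10938755, 10939283,
     3670, 15071619, 15072147, 62517, 302898, 64407, 302898, 63879, 51989, 109746,
     34309, 1095778, 2662, 10887684, 10939267, 60295, 10937603, 10939219, 10938755, 10939283,
     3670, 15071619, 15072147, 62517, 302898, 64407, 302898, 63879, 51253, 247985, 42533,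
     47205, 2662, 10939267, 60295, 10937603, 10939219, 10938755, 10939283, 3670, 15071619,
     15072147, 62517, 302898, 64407, 302898, 63879, 2950, 12116227, 12117251, 12119059,
     12119075, 12118355, 12119155, 12118403, 12119187, 12119203, 3670, 15048963, 15072771,
     15071619, 15072403, 15072915, 3782, 15482771, 63879, 13525796, 13526308, 13527332, 13527348,
     15069987, 389858, 4127010, 3077010, 63879, 2662, 10939267, 60295, 10937603, 10939219,
     10938755, 10939283, 3670, 15071619, 15072147, 62517, 302898, 64407, 302898, 63879,
     47205, 2662, 10939267, 60295, 10937603, 10939219, 10938755, 10939283, 3670, 15071619,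
     15072147, 62517, 302898, 64407, 302898, 63879, 2950, 12116227, 12117251, 12119059,
     12119075, 12118355, 12119155, 12118403, 12119187, 12119203, 3670, 15048963, 15072771,
     15071619, 15072403, 15072915, 3782, 15482771, 63879, 13525796, 13526308, 13527332, 13527348,
     15069987, 389858, 4127010, 3077010, 63879, 2662, 10939267, 60295, 10937603, 10939219,
     10938755, 10939283, 3670, 15071619, 15072147, 62517, 302898, 64407, 302898, 63879,
     10887684, 42533, 51301, 52069, 822114, 2662, 10939267, 60295, 10936579, 10937603,
     10939427, 10939443, 10939219, 10939507, 10939523, 10939539, 10939571, 3670, 3782, 15470852,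
     428994, 47205, 2662, 10939267, 60295, 10937603, 10939219, 10938755, 10939283, 3670,
     15071619, 15072147, 62517, 302898, 64407, 302898, 63879, 2950, 12116227, 12117251,
     12119059, 12119075, 12119091, 12118355, 12119155, 12118403, 12119187, 12119203, 3670,
     15048963, 15072771, 15071619, 15072915, 3782, 13525796, 13526308, 13527332, 13527348,
     15069987, 389858, 4127010, 3077010, 63879, 2662, 10939267, 60295, 10937603, 10939219,
     10938755, 10939283, 3670, 15071619, 15072147, 62517, 302898, 64407, 302898, 63879,
     52069, 428994, 47205, 2662, 10939267, 60295, 10936579, 10937603, 10936851, 10939427,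
     10939443, 10939219, 10939507, 10939539, 10939571, 3670, 3782, 15470852, 15499795, 2950,
     12116227, 12117251, 12119059, 12119075, 12119091, 12118115, 12119155, 12119187, 12119203,
     3670, 15048963, 3782, 15493220, 2662, 10939267, 60295, 10936579, 10937603, 10936851,
     10939427, 10939443, 10939219, 10939507, 10939539, 10939571, 3670, 3782, 15470852, 15499795,
     822114, 2950, 12108547, 12116227, 12117251, 12119059, 12119075, 12119091, 12119139,
     12119155, 12119187, 12119203, 3670, 15048963, 3782, 51301, 52069, 822114, 2662,
     10939267, 60295, 10936579, 10937603, 10939427, 10939443, 10939219, 10939507, 10939523,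
     10939539, 10939571, 3670, 3782, 15470852, 428994, 47205, 2662, 10939267, 60295,
     10937603, 10939219, 10938755, 10939283, 3670, 15071619, 15072147, 62517, 302898, 64407,
     302898, 63879, 2950, 12116227, 12117251, 12119059, 12119075, 12119091, 12118355, 12119155,
     12118403, 12119187, 12119203, 3670, 15048963, 15072771, 15071619, 15072915, 3782, 13525796,
     13526308, 13527332, 13527348, 15069987, 389858, 4127010, 3077010, 63879, 2662, 10939267,
     60295, 10937603, 10939219, 10938755, 10939283, 3670, 15071619, 15072147, 62517, 302898,
     64407, 302898, 63879, 52069, 428994, 47205, 2662, 10939267, 60295, 10936579,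
     10937603, 10936851, 10939427, 10939443, 10939219, 10939507, 10939539, 10939571, 3670, 3782,
     15470852, 15499795, 2950, 12116227, 12117251, 12119059, 12119075, 12119091, 12118115,
     12119155, 12119187, 12119203, 3670, 15048963, 3782, 15493220, 2662, 10939267, 60295,
     10936579, 10937603, 10936851, 10939427, 10939443, 10939219, 10939507, 10939539, 10939571,
     3670, 3782, 15470852, 15499795, 822114, 2950, 12108547, 12116227, 12117251, 12119059,
     12119075, 12119091, 12119139, 12119155, 12119187, 12119203, 3670, 15048963, 3782, 10887684,
     93362, 101554, 51301, 42533, 52133, 47205, 2662, 10939267, 60295, 10937603,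
     10939219, 10938755, 10939283, 3670, 15071619, 15072147, 62517, 302898, 64407, 302898,
     63879, 2950, 12116227, 12117251, 12119075, 12118355, 12119155, 12118403, 12119187, 12119203,
     3670, 15048963, 15072771, 15071619, 15072403, 15072915, 3782, 15470852, 15482771, 63879,
     13525796, 13526308, 13527332, 13527348, 15069987, 389858, 4127010, 3077010, 63879, 2662,
     10939267, 60295, 10937603, 10939219, 10938755, 10939283, 3670, 15071619, 15072147, 62517,
     302898, 64407, 302898, 63879, 47205, 2662, 10939267, 60295, 10936579, 10937603,
     10939427, 10939443, 10939219, 10939507, 10939523, 10939539, 10939571, 3670, 3782, 15470852,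
     2950, 12116227, 12117251, 12119075, 12118355, 12119155, 12118403, 12119187, 3670, 15048963,
     15072771, 15071619, 15072403, 15072915, 3782, 15470852, 15482771, 63879, 13525796, 13526308,
     13527332, 13527348, 15069987, 389858, 4127010, 3077010, 63879, 15507715, 2662, 10939267,
     60295, 10936579, 10937603, 10939427, 10939443, 10939219, 10939507, 10939523, 10939539,
     10939571, 3670, 3782, 15470852, 52133, 47205, 2662, 10939267, 60295, 10937603, 10939219,
     10938755, 10939283, 3670, 15071619, 15072147, 62517, 302898, 64407, 302898, 63879,
     2950, 12116227, 12117251, 12119075, 12118355, 12119155, 12118403, 12119187, 12119203, 3670,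
     15048963, 15072771, 15071619, 15072403, 15072915, 3782, 15470852, 15482771, 63879, 13525796,
     13526308, 13527332, 13527348, 15069987, 389858, 4127010, 3077010, 63879, 2662, 10939267,
     60295, 10937603, 10939219, 10938755, 10939283, 3670, 15071619, 15072147, 62517, 302898,
     64407, 302898, 63879, 47205, 2662, 10939267, 60295, 10936579, 10937603, 10939427,
     10939443, 10939219, 10939507, 10939523, 10939539, 10939571, 3670, 3782, 15470852, 2950,
     12116227, 12117251, 12119075, 12118355, 12119155, 12118403, 12119187, 3670, 15048963,
     15072771, 15071619, 15072403, 15072915, 3782, 15470852, 15482771, 63879, 13525796, 13526308,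
     13527332, 13527348, 15069987, 389858, 4127010, 3077010, 63879, 15507715, 2662, 10939267,
     60295, 10936579, 10937603, 10939427, 10939443, 10939219, 10939507, 10939523, 10939539,
     10939571, 3670, 3782, 15470852, 10887684, 444465, 1837154, 833634, 2950, 12116227,
     12117251, 12119075, 12119091, 12119139, 12119155, 12119187, 3670, 15048963, 3782, 15470852,
     15507715, 6980115, 93234, 3430, 14082563, 14085203, 518, 2158851, 2159923, 2161491,
     3926, 16097539, 6286420, 64599, 14085171, 14085203, 60503, 303905, 293410, 162370,
     4354978, 55927, 8047988, 55927, 14304260, 12966499, 2662, 10887684, 10912275, 10936579,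
     10936835, 10937347, 10937603, 10936851, 10938947, 10939475, 10938211, 3670, 6206772, 60503,
     15070211, 15071811, 15072339, 15071075, 15071843, 15072963, 3782, 15470852, 15475204,
     13513508, 13513764, 13514020, 13514036, 13514548, 13514564, 15482707, 15482851, 6222386,
     3077938, 5501666, 4125730, 3077954, 63335, 15496195, 15499795, 13540404, 60503, 13548372,
     15515619, 62229, 94002, 64103, 62213, 58149, 216610, 220706, 15069987, 6025954,
     4125730, 163394, 3077954, 163634, 63335, 155186, 60503, 1068850, 1081138, 229186,
     63335, 3191043, 3191299, 3191811, 3192067, 3192579, 3193091, 3191315, 3191827,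
     3192083, 3192851, 3193107, 3191587, 3192099, 3192867, 3191859, 3192115, 3192131,
     3193155, 3192403, 3192675, 3193187, 3193443, 1030, 4227603, 4246355, 4246419, 2902,
     11903235, 11915523, 11915779, 11916035, 11916291, 11915795, 11918099, 11918147, 11918179,
     11918515, 3478, 14221572, 14225668, 14230020, 14246659, 14251011, 14262531, 14271491,
     14278915, 14279171, 14279683, 14279187, 14281491, 14281539, 14281571, 14281907, 3670,
     15008004, 15048963, 15057923, 3766, 15409668, 15430659, 15434259, 15442179, 4243715,
     4244227, 4244499, 4244755, 4244259, 4245539, 4245795, 4245811, 4246323, 4244803,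
     4246339, 4245075, 4246099, 4246355, 4246115, 4245875, 4246163, 4246419, 2902,
     11903235, 11915779, 11916035, 11916291, 11916547, 11916307, 11918115, 11916611, 11918403,
     11918419, 11917155, 11917923, 54037, 224530, 85298, 93490, 3237074, 55911, 93490,
     46117, 775202, 162626, 2873154, 55143, 309537, 293666, 54309, 163138, 55143,
     171330, 47189, 374833, 1771602, 1612626, 1820754, 1416066, 6015362, 1378482, 722993,
     2869298, 3903618, 1609810, 33797, 1361922, 1099842, 518, 2157699, 60551, 2154755,
     2155267, 2157379, 2156883, 2157395, 2157427, 2156931, 2157443, 2157459, 3670,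
     15048963, 6210884, 60247, 15071619, 15072147, 15072915, 3766, 15405316, 15426307, 15442179,
     15454099, 62517, 237378, 64663, 237378, 63879, 1099842, 51591, 776274, 1612626,
     12114258, 4573650, 3222, 13177092, 13198083, 13231427, 13232979, 60247, 11917923, 2662,
     10887684, 10912275, 10936579, 10936835, 10937091, 10937603, 10936851, 10939475, 3670, 3766,
     15405316, 15409668, 15418115, 15430403, 15434259, 15438595, 15450883, 4244803, 4246355,
     52055, 293426, 227906, 42855, 10896131, 1090307, 1090563, 1090819, 1091075, 1091587,
     1091843, 1090323, 1090579, 1091123, 1090883, 42037, 301618, 236098, 1030, 4227603,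
     4239619, 4239875, 4240131, 4240643, 4241155, 4239891, 4240403, 4241171, 4241187,
     4241699, 4240691, 4241203, 4241219, 4241235, 4241251, 4241779, 518, 2149235, 52087,
     2147587, 2147635, 2149235, 2934, 12026387, 12034307, 12046595, 12046851, 12047107,
     12047619, 3414, 14000387, 14008835, 14017283, 774, 3179027, 3207427, 3210067, 3210323,
     3926, 16097539, 2146563, 2147075, 2147331, 2146835, 2147635, 2149235, 2934, 12026387,
     12034307, 12046595, 12047107, 12047363, 12048675, 54293, 81218, 105794, 109890,
     302386, 306482, 4434386, 55959, 302354, 2198930, 54325, 302386, 306482, 236866,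
     240962, 4434386, 55959, 236866, 55687, 12046595, 12047107, 12047363, 12047619, 12046867,
     12047667, 12049203, 12049235, 12048227, 3526, 14422276, 14430980, 14435332, 14443267,
     14451219, 14455811, 14459139, 14478195, 60279, 3414, 14000387, 14021379, 14023475, 14023987,
     14022499, 14023539, 3158, 12951811, 6077780, 62469, 1097538, 64375, 54037, 251153,
     85330, 56407, 93490, 913714, 1963570, 54293, 89410, 56407, 14021651, 98114,
     63335, 4241731, 4242067, 47767, 4239619, 4239875, 4240131, 4240643, 4241155, 4239891,
     4240659, 4241171, 4240163, 4240419, 4240675, 4241187, 4240691, 4241203, 4241715,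
     4240707, 4241219, 4241731, 4240979, 4241235, 4242003, 4241251, 774, 3179027,
     3195139, 3195395, 3195907, 3196163, 3195411, 3196195, 3196451, 3195955, 3196211,
     3196467, 3196483, 3197779, 3196771, 3197283, 3197539, 2902, 11915523, 11915779,
     11916291, 11915795, 11916595, 11917155, 3526, 14422276, 14426628, 14435332, 14451219,
     13472820, 13473332, 228674, 55143, 14459139, 14475779, 14478163, 518, 2158851, 2159923,
     2161747, 3926, 16097539, 6286164, 64343, 14476595, 14478163, 60247, 11916035, 3174,
     13009427, 13021955, 13030147, 13033731, 13033987, 13034499, 13034755, 13034003, 13036371,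
     13035363, 3670, 15048963, 15072083, 15071075, 15072947, 3766, 15405316, 15409668, 12464932,
     12465188, 12465444, 12465460, 12465972, 12465988, 15417171, 15417315, 6222386, 3077938,
     5501666, 4125730, 3077954, 63335, 15430659, 15434259, 12491572, 60247, 15442179, 3195139,
     3195667, 3196755, 3197779, 2902, 11915523, 11916035, 11916547, 11917059, 11915795,
     11917075, 11918099, 11918115, 11918131, 11918419, 11918179, 33541, 1099826, 3446, 14103300,
     14123539, 14128387, 14130259, 1409170, 5294226, 51591, 14131459, 14140163, 14147843,
     14148355, 14148867, 14148115, 14150419, 14150435, 14150451, 14150483, 14150739, 14150499,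
     3670, 15048963, 3766, 15434259, 12491588, 60247, 15442179, 15450883, 230401, 1296386,
     1091634, 1099826, 3196034, 3197570, 51847, 3196211, 3197779, 52055, 301618, 1346098,
     236098, 1280578, 4429986, 43399, 1090051, 1090307, 1090563, 1090819, 1091075,
     1091331, 1091587, 1091843, 1090067, 1090323, 1090579, 1090835, 1091091, 1091603,
     1091859, 1091619, 1091123, 1090883, 2646, 10858755, 10859011, 10859523, 10859779,
     10860291, 10861059, 10859027, 10859539, 10859795, 10860563, 10860579, 10859843, 10861123,
     42565, 285282, 293474, 308898, 10770098, 5945186, 46951, 42581, 702034, 359010,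
     5945186, 46951, 424530, 702034, 10925906, 359010, 5945186, 374434, 6666146, 42037,
     301618, 236098, 42805, 46661, 424770, 5520226, 46951, 518, 2147075, 2147331,
     2147587, 2148099, 2148611, 2148867, 2149123, 2147107, 2147363, 2147619, 2149155,
     2147635, 46117, 162626, 45845, 224018, 236306, 92978, 46133, 301874, 236354,
     50997, 502834, 219842, 703570, 50773, 359522, 51047, 359522, 50229, 52021,
     4983602, 203954, 1273010, 52071, 1030, 4227603, 4247811, 4248067, 4248323, 4248835,
     4249859, 4250115, 4250627, 4248851, 4248355, 4248867, 4249891, 4250403, 4248883,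
     4249907, 4250163, 4248899, 4249923, 4250435, 4250195, 4250451, 4249971, 4250259,
     43093, 370785, 1706066, 535122, 702546, 1612370, 1759314, 11055698, 2803794,
     11057490, 11061586, 11065682, 1391234, 1706082, 535138, 6959234, 8794786, 10859298,
     1413810, 56405, 56117, 2951986, 774, 3205427, 3206547, 60823, 3203587, 3206227,
     3206483, 3205731, 3670, 3750, 15344132, 15352579, 15364867, 15368963, 15373059, 15385091,
     15389443, 2334130, 3478, 14225668, 14246659, 14270979, 14278915, 14282051, 14281811, 3670,
     15008004, 15072579, 15072659, 64919, 343490, 368066, 376258, 2932018, 12827090, 3478,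
     14225668, 14246659, 14278915, 14279171, 14282051, 3670, 15008004, 15057411, 15072579,
     15072659, 64919, 702546, 1612370, 11057490, 4577714, 3478, 14225668, 14246659, 14270979,
     14278915, 14279171, 14279427, 14279683, 14281219, 14279955, 14279459, 14279971, 14281267,
     14280003, 14281299, 774, 3179027, 244308, 59991, 3209523, 3210643, 64919, 3207683,
     3208451, 3210755, 3208467, 3208499, 58629, 1113682, 65111, 41765, 238625, 241185,
     65061, 155618, 65111, 176098, 58405, 193762, 65191, 175682, 65191, 16654852,
     154162, 59991, 15008004, 4248067, 4248323, 4248835, 4248883, 4248899, 4250195, 774,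
     3179027, 244308, 55895, 3204099, 3204355, 3205379, 3206403, 3204403, 3205427,
     3206451, 3205443, 3206483, 3414, 14008835, 14021635, 14024195, 14024243, 65093, 65173,
     65175, 65175, 958274, 303074, 65175, 16663556, 3204403, 3206483, 60759, 13317172,
     289842, 224322, 51047, 224370, 51047, 13054724, 1313586, 293682, 46951, 92978,
     46951, 277282, 293666, 146242, 162626, 183106, 4354994, 4376498, 52087, 2146563,
     2147075, 2147331, 2147587, 2147843, 2148355, 2148611, 2148867, 2149123, 2147107,
     2147363, 2147619, 2147875, 2147635, 2148163, 2148995, 50229, 313137, 302130,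
     306226, 236610, 240706, 224418, 219842, 310434, 703570, 1030, 4227603,
     4248067, 4248323, 4248835, 4249347, 4250371, 4250627, 4248595, 4248611, 4248627,
     4248883, 4249395, 4248899, 4249155, 4250435, 4249171, 4250195, 4250451, 56181,
     474066, 56183, 46117, 310561, 162626, 45845, 224018, 92978, 4299618, 46133,
     301874, 236354, 56117, 5049138, 204210, 1273266, 56167, 4431282, 56165, 56167,
     54037, 93490, 56167, 252689, 2198962, 50773, 378417, 378545, 412754, 449618,
     2526290, 334946, 347234, 359522, 2460770, 442673, 2526258, 6504898, 6522050,
     6522818, 428994, 363970, 3206, 13164803, 13165587, 13167667, 13167683, 3670, 15008004,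
     15062035, 15072307, 15072323, 15072387, 64647, 41765, 1215026, 10859299, 1182514, 774,
     3179027, 3205427, 3206291, 60567, 3203587, 3205667, 3206227, 3206483, 3205731,
     3205763, 3670, 3750, 15352579, 15364867, 15373059, 15385091, 15389443, 239137, 154162,
     1749602, 3510, 14402051, 14411347, 14412627, 2918, 11927812, 11960851, 11977219, 11990275,
     11992147, 11992403, 11992659, 3926, 14411075, 14412371, 59991, 14365748, 1313586, 293682,
     46951, 92978, 46951, 277282, 293666, 146242, 162626, 4354994, 56183, 4247811,
     4248595, 4249171, 4250451, 4250211, 4250531, 33797, 295681, 1366018, 1103938,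
     2148418, 4248450, 4250754, 56455, 1103938, 2918, 11927812, 11936260, 11960851, 11965699,
     11967827, 1409170, 5298322, 55687, 11977219, 11981827, 11985411, 11985923, 11986179,
     11985427, 11986243, 11987523, 11986771, 11987539, 11988307, 11986787, 11987571, 11988131,
     11988387, 3670, 15057411, 15070211, 15071811, 15072835, 15071075, 15071859, 15072883, 3750,
     15344132, 15351619, 15351667, 229186, 63335, 15368723, 11442740, 59991, 4248835, 4248883,
     4248899, 4250195, 774, 3179027, 244308, 55895, 3204659, 3204675, 41765, 238625,
     10859299, 162370, 700994, 2799426, 45829, 2128690, 46951, 45845, 92978, 60261,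
     60263, 60263, 97074, 46951, 154162, 55895, 3205427, 3206291, 60567, 3204403,
     3206483, 60759, 302130, 2395186, 236610, 2329666, 4430018, 51591, 2146563, 2147075,
     2147331, 2147587, 2148099, 2148867, 2146835, 2147107, 2147619, 2147635, 2148163,
     2148995, 51797, 801362, 51799, 703570, 355490, 375970, 3158, 12964099, 12964611,
     12965123, 12966915, 12964371, 12965155, 12965171, 12966963, 12966483, 12966499, 12966819,
     12967091, 50997, 502834, 240754, 50773, 841298, 359522, 6084450, 55143, 425042,
     841298, 13031250, 359522, 6084450, 382658, 375922, 3238, 11289364, 11290164,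
     13258083, 839986, 1889842, 55143, 11309844, 11310612, 11310132, 11310644, 839986,
     1889842, 213442, 3237058, 3986962, 1889378, 55143, 13295875, 13296131, 13298691,
     13297459, 13298227, 13298739, 13298259, 13298515, 13298771, 13299027, 13299043, 13298547,
     13299123, 50229, 302130, 8184882, 12904754, 236610, 240706, 3991874, 255170,
     4434370, 55093, 3734, 15270148, 15274244, 15278596, 15295539, 15299635, 15316019, 15317299,
     15317555, 15317315, 15317588, 15317844, 15318644, 15318740, 9720754, 743985, 1706322,
     600658, 2808146, 1411730, 5953682, 50197, 89154, 51799, 89154, 3446, 14090500,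
     14094596, 14123539, 14128387, 14131459, 14150707, 14154115, 14155411, 62517, 237378, 65175,
     237378, 63879, 14154835, 64599, 15324211, 15325491, 15325507, 15326275, 15326292, 15326548,
     15326820, 15326900, 9655506, 875585, 2885970, 2694226, 1882450, 1412242, 6076562,
     41765, 219682, 154162, 5550754, 5419938, 2918, 11927812, 11936260, 11960851, 11965699,
     11977219, 11987507, 11991427, 11992723, 62517, 302898, 65175, 302898, 63879, 11991635,
     64087, 154162, 51799, 15333939, 15334467, 15334563, 64679, 5459314, 55143, 14103300,
     269362, 289842, 224322, 839986, 1889842, 3986530, 55143, 220274, 224370,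
     251842, 12802002, 6084210, 55143, 12964099, 12964355, 12964611, 12965123, 12966915,
     12964643, 12965171, 12966963, 12966483, 12967075, 50229, 313137, 302130, 306226,
     236610, 240706, 4434370, 240754, 52085, 801650, 805746, 46951, 51285, 841810,
     1612882, 13162834, 1416322, 6084994, 383170, 8772034, 55557, 55589, 150930, 55687,
     54325, 302386, 306482, 236866, 228754, 241042, 3238, 13298547, 13299091, 46117,
     162626, 45845, 3478, 14225668, 14246659, 14267139, 14267652, 14269491, 14269012, 770354,
     631634, 246801, 1793090, 51799, 14283827, 14285363, 14285987, 62469, 3190594, 64679,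
     3198786, 64679, 4258883, 64679, 92978, 46951, 277282, 293666, 146242, 162626,
     4354994, 60279, 13297971, 13299091, 60823, 236866, 55687, 14230020, 1923330, 5262738,
     55687, 14221572, 2885714, 543826, 841810, 2628690, 1612882, 13161554, 1416322,
     6084994, 383170, 8770754, 1609810, 377153, 12964162, 3478, 14221572, 14225668, 14230020,
     14246659, 14251027, 14262531, 14267651, 14279427, 774, 3179027, 244308, 51799, 3209523,
     3209539, 33541, 2152498, 55687, 54037, 105778, 3231122, 64917, 64919, 64919,
     101682, 55687, 3208499, 3210323, 64599, 14281795, 14281811, 60503, 12042755, 302130,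
     840754, 12900658, 236610, 3987778, 251074, 12801234, 4413906, 5541266, 55687,
     11944964, 239425, 701298, 702274, 46951, 272946, 285234, 293426, 207426,
     227906, 308130, 219682, 5485218, 10859299, 2798898, 10860338, 3847202, 2799426,
     46951, 10858755, 10859011, 10859523, 10859779, 10860291, 10861059, 10859027, 10859539,
     10859795, 10860563, 10861075, 10860579, 10859843, 10861123, 42037, 238689, 301618,
     236098, 4429474, 2966, 12124420, 12128516, 12132868, 10185012, 10185092, 47495, 12153859,
     12173571, 12173827, 12174339, 12175107, 12175875, 12173843, 12174355, 12174611, 12175379,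
     12175891, 12175395, 12174659, 12175939, 50773, 359522, 51047, 425042, 359522, 50757,
     425026, 5520482, 51047, 51813, 4852834, 809570, 10209892, 11560354, 3174, 12976388,
     12984836, 13009427, 13029635, 13029891, 13030403, 13031939, 13030419, 13030675, 13031443,
     13031459, 13030723, 13030979, 13032003, 13032515, 13032531, 50725, 443425, 408610,
     433186, 4332642, 1215586, 4340834, 4365410, 5034594, 2938978, 4641474, 6478018,
     1215554, 6429746, 1215538, 6429842, 1215634, 10207940, 7132034, 7132290, 10209380,
     2733762, 9877698, 13024642, 56199, 5034594, 4641474, 51301, 2545858, 55365, 1326466,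
     1351042, 10209492, 56199, 55381, 1416578, 55687, 1613138, 1416578, 55557, 1654018,
     1666306, 7133444, 7131908, 2998370, 10207428, 1880834, 11754498, 13014274, 5297042,
     55687, 54309, 55589, 46133, 301874, 236354, 12174387, 4966706, 54325, 302386,
     236866, 2410962, 3980690, 56215, 302386, 55687, 301874, 12174387, 4966706, 840514,
     5036338, 55687, 644385, 903458, 146834, 150930, 159122, 5425618, 10207956,
     898338, 14006562, 2939794, 13789634, 7193490, 13480850, 4043922, 56215, 14230020,
     316705, 277794, 294178, 302370, 902178, 13944610, 163138, 893506, 2991938,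
     3000130, 303826, 894242, 902434, 14001954, 14002466, 14010658, 146770, 5411794,
     5425618, 171074, 4364226, 10208292, 5027618, 2929778, 2799938, 307874, 4364194,
     4372386, 4897138, 13090194, 56215, 14221572, 14173188, 9259012, 9257764, 9258276,
     9258788, 14175267, 9258292, 9259332, 14174788, 14175300, 9259092, 9259348, 9259652,
     296193, 297217, 1357826, 1361922, 574274, 575298, 575810, 4245890, 8430290,
     893730, 901922, 13870370, 13878562, 13879074, 2991410, 3000658, 4355010, 10208468,
     14334018, 4905858, 898434, 10208724, 569938, 12111954, 10208452, 4831426, 10008002,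
     11717202, 10619986, 518, 2157683, 60535, 2157139, 2157651, 2157907, 1030, 4257091,
     3670, 6223172, 59991, 4257091, 4258387, 64087, 444481, 444497, 2628706, 1588322,
     2661474, 2938978, 13161314, 13162850, 1457282, 1481858, 2545858, 8836034, 8837570,
     1890370, 1890386, 6084994, 13031474, 10208964, 10209636, 13155682, 13024658, 9877714,
     56199, 13029635, 13029891, 13030403, 13031939, 13029907, 13030419, 13030675, 13031443,
     13031955, 13030723, 13030979, 13032003, 13032515, 13030995, 13031251, 13032531, 13031267,
     13032035, 13032563, 13032611, 55365, 317521, 317537, 1902658, 1351042, 1312978, 305362,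
     6605010, 1588562, 1613138, 1901954, 894338, 1357826, 10209492, 898434, 10208724,
     12114514, 55895, 1342850, 55381, 1588562, 1613138, 10208724, 765266, 55895, 1613138,
     1416578, 55957, 50725, 443425, 443681, 408610, 433186, 4328546, 4332642, 1215586,
     4340834, 4365410, 5034594, 2938978, 2939234, 434882, 4641474, 6478018, 6478274,
     828449, 12887330, 1215554, 2926658, 4346050, 7132450, 146514, 5428162, 10208548,
     6083362, 6425650, 6425746, 6429842, 1215634, 10207940, 2936930, 840546, 10209380,
     13029426, 7131282, 2733762, 9877698, 9886658, 13024642, 9851090, 10334402, 4359586,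
     2799698, 12956418, 3414, 14019635, 14019651, 14019683, 60519, 14017315, 14018627, 14018947,
     14019459, 774, 3179027, 3203875, 3208755, 3208771, 3210339, 64615, 58117, 2137650,
     59783, 33541, 2156594, 60295, 58133, 101938, 60295, 106034, 59783, 5034594,
     4641474, 50997, 46133, 301874, 224066, 236354, 12174259, 3785906, 842562, 43093,
     1706066, 535122, 539218, 551506, 555602, 702546, 1628754, 1415810, 1432194,
     5945730, 1626194, 369441, 381602, 370289, 6674338, 33797, 54053, 216354, 163138,
     49941, 93234, 13030163, 2207026, 3494, 14347363, 60519, 14345219, 1030, 4259155,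
     3414, 4257091, 4258387, 64087, 13030163, 2194738, 2202930, 3414, 14018355, 14018371,
     14018403, 59239, 14018867, 14018947, 59783, 154930, 55895, 1095746, 47495, 4227603,
     370753, 702546, 1612370, 11057490, 1407618, 1415810, 5945730, 374946, 1751106,
     4896642, 12175443, 9095506, 12174755, 11127634, 3480466, 3500946, 6014610, 1378738,
     9815730, 2939234, 13228898, 45845, 224018, 4641202, 42581, 435025, 437585, 702034,
     10924882, 10935122, 359010, 5945186, 1411938, 1411890, 1412530, 2950, 12058884,
     12117859, 59239, 12118611, 59991, 374434, 54309, 163138, 46117, 162626, 770626,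
     2869058, 49941, 93234, 13030163, 3494, 14295556, 14299924, 14316547, 14320147, 14347363,
     60519, 3414, 13959428, 14022467, 14023747, 14022499, 14023779, 62229, 94002, 64615,
     94002, 63335, 93234, 51047, 308001, 308769, 310561, 293666, 162626, 762434,
     2860866, 303794, 762658, 11773730, 154418, 2860338, 763425, 11983394, 4380578, 1030,
     4227603, 4255139, 3414, 13959428, 14017539, 14023043, 14023315, 14024083, 3494, 14303123,
     63879, 14320147, 4254019, 4254611, 60311, 4252995, 4254291, 59991, 316705, 277794,
     294178, 163138, 303826, 4368338, 894242, 14000930, 146770, 2990930, 1030,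
     4227603, 4255139, 3414, 13959428, 14017539, 3494, 14299940, 14320147, 4254019, 4254611,
     60311, 4252995, 4254291, 59991, 4270898, 2198322, 47495, 207682, 228162, 12174387,
     12174371, 2869058, 7629874, 51047, 216178, 51047, 8139524, 8140036, 8141060, 8139540,
     8140308, 8141076, 8139556, 8139812, 8141092, 8140340, 8141108, 8140612, 8141124,
     13057363, 8141156, 13057379, 13057395, 13057475, 10209076, 7131186, 7388210, 9679042,
     1888338, 9482690, 9482946, 9483458, 9483970, 832274, 12826130, 6541762, 840482,
     832545, 840738, 2938690, 2939714, 3414, 14018355, 14018371, 14018403, 59239, 14016771,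
     14018579, 14019603, 14019859, 14017315, 14018627, 14019395, 14019683, 14018675, 3718,
     15204612, 15217444, 9332244, 9332788, 12697186, 6404322, 60295, 15245571, 15256596,
     15269139, 3494, 14295556, 14299908, 14316291, 14320147, 14351635, 15269203, 64855, 605602,
     903586, 10861011, 10210724, 897954, 4045218, 12246162, 10860996, 13458322, 11099570,
     12166610, 55895, 11377204, 14326100, 11377236, 55895, 7119107, 12993540, 12173571, 12173827,
     12174339, 12175875, 12175939, 49957, 220194, 236578, 154674, 10208036, 3978530,
     10207940, 10209572, 5944100, 3908898, 1219410, 2861394, 9618866, 12168274, 51799,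
     220194, 154674, 51765, 236706, 10209844, 10210468, 742306, 3917218, 51799, 224418,
     43093, 1612370, 12174755, 51799, 702546, 1612370, 11057490, 1415810, 5945730, 374946,
     8763810, 12175443, 9095506, 5949586, 12174755, 11127634, 9816242, 12176002, 47365,
     1792258, 5258130, 47495, 41765, 240673, 10859299, 45829, 2136882, 47495, 45845,
     46133, 301874, 236354, 12174387, 4966706, 3916946, 1030, 4227603, 4250787, 3238,
     13267971, 3158, 12910852, 12964867, 12972835, 12974467, 12974995, 62213, 33541, 2160690,
     63879, 62229, 114482, 64407, 102194, 63879, 3179027, 2146098, 64407, 3210035,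
     64407, 13297987, 13298579, 60311, 4249923, 4250515, 56215, 4250691, 4250787, 56487,
     301874, 47495, 105266, 47495, 3191587, 154162, 51799, 13251364, 13251876, 13251892,
     11286836, 11286852, 10859459, 239905, 3315106, 10859299, 3847458, 2799954, 833841,
     3978386, 11754642, 5541010, 5027986, 47495, 272946, 285234, 301618, 236098,
     308130, 4429218, 10859299, 2798898, 10860850, 3848530, 5540754, 47495])

lemma fivePointsConfig_closed_of (hP : (pentagonConfig [5, 4, 4, 4]).Closed)
    (hQ : pointInQuadConfig.Closed) (hT : (twoPointsInTriangleConfig [] [] []).Closed) :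
    fivePointsConfig.Closed :=
  Config.closed_of_check (L := [pentagonConfig [5, 4, 4, 4], pointInQuadConfig,
    twoPointsInTriangleConfig [] [] []]) (by decide +kernel) (by simp [*]) (ts :=
    [12549, 16645, 12805, 16901, 17157, 12821, 17173, 205842, 17189, 73809065476105,
     53893838995481, 74802, 16917, 54030741078041, 38552752685097, 17173, 16917,
     35472455827481, 39792924491801, 205842, 17189, 55250780225577, 55254806757417, 12821,
     17189, 17173, 71618632155161, 71481730072601, 136242, 16917, 57316391059465,
     35408031318041, 17189, 136242, 16917, 39651995877417, 72778273325097, 201762, 17173,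
     72774246793257, 38762132340761, 1192962, 12821, 16917, 17173, 73809065476121,
     70583813472281, 144402, 17189, 55254806757385, 35271129235481, 16917, 144402, 17189,
     39788897959977, 39792924491817, 78882, 17173, 72637344710697, 36571699019801, 16901,
     1192962, 12821, 16917, 17173, 53060346904601, 57316391059481, 144402, 17189,
     38762132340777, 38758105808937, 16917, 144402, 17189, 36301921386521, 72778273325065,
     78882, 17173, 36507274510361, 55045427101737, 17157, 12821, 17189, 136242, 16917,
     73805038944297, 55254806757401, 201762, 17173, 57243913486377, 73809065476137, 17189,
     201762, 17173, 39792924491785, 52931497885721, 16917, 71683056664601, 70450937921561,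
     12821, 17173, 205842, 17189, 57316391059497, 57312364527657, 74802, 16917,
     73736587903017, 54159590096921, 17173, 16917, 72778273325081, 70519388962841, 205842,
     17189, 52863046844441, 38762132340745, 16901, 16913, 17173, 17157, 12805, 12821,
     17189, 2422682484761, 52919418290217, 82722, 2487106994217, 12821, 82722,
     3582323654697, 17189, 35395951722537, 3453474635801, 1319682, 1057602, 12821,
     3578297122857, 3385023594521, 82689, 271122, 1319682, 78401, 17808060645417, 17157,
     17169, 1319682, 12865, 12821, 16917, 2285780402201, 1315386228777, 213522,
     2479053930537, 12805, 12821, 17173, 74802, 16917, 71618632155145, 20908490162201,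
     205842, 17189, 21045392244761, 36491168383017, 17173, 17189, 39595624431641,
     39664075472921, 74802, 16917, 20066945007657, 20079024603177, 12821, 16917, 17189,
     57251966550041, 57183515508761, 78882, 17173, 21166188199977, 21174241263657, 16917,
     78882, 17173, 71683056664585, 19809246969881, 144402, 17189, 54014634950697,
     20014600093721, 12805, 12817, 16645, 17173, 82689, 205842, 1254402, 82481,
     17876511686697, 17157, 1254402, 1057842, 16917, 4609089273897, 4480240255001, 16901,
     16917, 17189, 70511335899177, 2487106994201, 78882, 35472455827497, 16917, 78882,
     4613115805737, 17189, 4548691296281, 35464402763817, 16917, 16901, 17157, 17173, 17189,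
     4613115805721, 53056320372777, 74802, 70583813472297, 17173, 74802, 53060346904617,
     17189, 70579786940457, 3582323654681, 1192962, 1061922, 17173, 1387863801881,
     4540638232617, 82433, 144402, 1192962, 82721, 17880538218537, 16645, 17157, 16901,
     12821, 17189, 201762, 17173, 19998493966377, 38568858812441, 136242, 16917,
     72649424306185, 38500407771161, 17189, 136242, 16917, 36559619424297, 36571699019817,
     17173, 22140608905241, 22003706822681, 12821, 16917, 17189, 73676189925401, 73744640966681,
     78882, 17173, 17747662667801, 54159590096905, 16917, 78882, 17173, 22205033414697,
     22196980351017, 144402, 17189, 20079024603161, 71606552559657, 17169, 1254402, 16945,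
     12821, 16917, 1254988251161, 2410602889257, 213522, 1383837270057, 16901, 16913,
     1192962, 17185, 12821, 17173, 3441395040297, 1323439292441, 148242, 1387863801897,
     17157, 12821, 17173, 74802, 16917, 57251966550025, 17816113709081, 17189,
     72580973264921, 72649424306201, 17173, 205842, 17189, 21174241263641, 71675003600937,
     74802, 16917, 22128529309737, 71683056664617, 12821, 17189, 136242, 16917,
     55061533229081, 21029286117417, 201762, 17173, 54993082187801, 73744640966665, 17189,
     201762, 17173, 54159590096937, 54151537033257, 16917, 17880538218521, 22205033414681])

/-! ### Configurations with a triangle and a point in it -/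

/-- A triangle `012` and a point `3` in it, all of colour `0`, together with further points. -/
def pointInTriangleConfig (cols : List ℕ) (btw : List (ℕ × ℕ × ℕ)) (cap : List ℕ) (need : Bool) :
    Config where
  cols := [0, 0, 0, 0] ++ cols
  pos := [(0, 1, 2), (0, 1, 3), (1, 2, 3), (2, 0, 3)]
  btw := btw
  cap := cap
  need := need

set_option maxRecDepth 100000 in
/-- Colours of the blockers of the six pairs of a triangle and a point in it, in some cases followed
by the colour of a further point, each with a certificate that this does not occur. -/
def blockerCertificates : List (List ℕ × List ℕ) :=
  [([1, 1, 1, 2, 2, 2],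
    [2179859, 2179875, 152323, 152355, 1073923, 1073939, 3174659, 3174915, 3174931,
     3175187, 3175955, 3175203, 3175715, 3175731, 3175987, 3244291, 3244547, 3244803,
     3245827, 3244563, 3245843, 3245091, 3245859, 3245107, 3245923, 3313923, 3314179,
     3315459, 3315715, 3314195, 3315475, 3315731, 3315779, 3315539, 2166, 8864275,
     8868355, 8888579, 8888835, 8890115, 8890627, 8888851, 8890387, 8890643, 2422,
     9912851, 9920771, 9941251, 9941507, 9943555, 9941523, 2438, 9982467, 9986307,
     10010883, 10011139, 10011155, 10013203, 2982, 12194052, 12198404, 3238, 13238532, 13246980,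
     13255187, 13259267, 13263107, 12206611, 12210691, 12214531]),
   ([1, 1, 1, 2, 2, 3],
    [1073923, 1073939, 3174659, 3174915, 3174931, 3175187, 3175955, 3175203, 3175987,
     3244291, 3244547, 3244803, 3245827, 3244563, 3245843, 3244835, 3245859, 3245875,
     3245923, 3313923, 3314179, 3315459, 3315715, 3314195, 3315475, 3315731, 3315491,
     3315747, 3315827, 2166, 8864275, 8868355, 8888579, 8888835, 8890371, 8890627,
     8888851, 8890131, 8890643, 8890147, 8890403, 2710, 11092499, 11096579, 11100419,
     11120899, 11121155, 11122691, 11121171, 11122451, 11122467, 11122723, 2934, 12010003,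
     12014083, 12017923, 2950, 12075539, 12079619, 12083459]),
   ([1, 1, 2, 1, 2, 2],
    [2179859, 2179875, 151811, 152323, 152083, 152355, 1073667, 1073923, 1074435,
     1073683, 1073939, 3174659, 3174915, 3175939, 3174931, 3175187, 3175955, 3175203,
     3175715, 3175731, 3175987, 3244291, 3244547, 3244803, 3245315, 3245827, 3244563,
     3244835, 3245091, 3245347, 3245859, 3245107, 3245875, 3245923, 3313923, 3314179,
     3315715, 3314195, 3314451, 3314979, 3315491, 3315779, 3315539, 3315827, 1878,
     7672068, 7692547, 7701251, 7708931, 7709187, 7709443, 7710211, 7710723, 7709203,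
     7709475, 7710755, 7711011, 2150, 8790532, 8798739, 8802819, 8823555, 8827139,
     8827395, 8829443, 8827411, 8827667, 2438, 9982467, 10003235, 10010883, 10011155,
     10011411, 10013219, 3238, 13238532, 13242628, 13251348, 2982, 12194052, 12198404, 12206611,
     12227347, 13255187, 13263107]),
   ([1, 1, 2, 1, 2, 3],
    [2179331, 2179587, 2179859, 2179875, 151811, 152323, 152579, 152083, 152595,
     152355, 152611, 1073667, 1073923, 1074179, 1074435, 1073683, 1073939, 1074451,
     1074499, 3174659, 3174915, 3175683, 3175939, 3174931, 3175187, 3175443, 3175955,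
     3175203, 3175715, 3175731, 3175987, 3244291, 3244547, 3244803, 3245315, 3245571,
     3245827, 3244563, 3245075, 3245587, 3244835, 3245347, 3245859, 3245107, 3245619,
     3245875, 3245923, 3313923, 3314179, 3314435, 3315203, 3315459, 3315715, 3314195,
     3314707, 3315219, 3315731, 3314979, 3315491, 3315747, 3314739, 3314995, 3315507,
     3315539, 2150, 8790532, 8798739, 8802819, 8819459, 8823043, 8823299, 8823555,
     8824067, 8824323, 8824579, 8825091, 8823315, 8824851, 8825107, 8824371, 8824675,
     17157, 1274882, 1078322, 2118706, 3175746, 30023, 215297, 1274882, 1074226, 1078322,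
     3176002, 1090706, 30021, 34117, 8824131, 1878, 7672068, 7692547, 7701251, 7709443,
     7713283, 7713539, 7714051, 7714307, 7714819, 7713811, 7714323, 7713571, 7714851,
     7714099, 7715123, 7714115, 7714371, 7715187, 21269, 230674, 91442, 99634,
     373042, 1423410, 3520530, 374322, 3245746, 47207, 230674, 83250, 99634,
     242002, 3258450, 45845, 232210, 92978, 101170, 3245746, 47207, 232210, 84786,
     101170, 3245234, 47205, 2918, 11936260, 11940644, 11942260, 434738, 436594, 2710,
     11096579, 11121443, 11967284, 47207, 11978051, 1350, 5544835, 2950, 534194, 47207,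
     7713539, 7714819, 7715331, 7714851, 7715107, 7715123, 7715187, 2710, 11096579,
     10123572, 10124180, 47767, 11124995, 11125251, 11126275, 11127043, 11125267, 11127059,
     11127315, 3206, 13107460, 13115908, 13124115, 13128195, 9205796, 9205812, 9205860, 51303,
     9222148, 13154563, 9222916, 13154579, 13154835, 9222180, 9222436, 2136258, 8436162,
     12626834, 9479090, 1811090, 47767, 1378370, 537922, 30023, 4555828, 30023, 30023]),
   ([1, 1, 2, 1, 3, 2],
    [2179331, 2179587, 2179859, 2179875, 151811, 152323, 152579, 152083, 152595,
     152355, 152611, 1073667, 1073923, 1074179, 1074435, 1073683, 1073939, 1074195,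
     1074451, 1074499, 3174659, 3174915, 3175683, 3175939, 3174931, 3175187, 3175443,
     3175955, 3175203, 3175715, 3175731, 3175987, 3244291, 3244547, 3244803, 3245315,
     3245571, 3245827, 3244563, 3245075, 3245587, 3245843, 3244835, 3245091, 3245347,
     3245859, 3245107, 3245619, 3245875, 3313923, 3314179, 3314435, 3314947, 3315715,
     3314195, 3314451, 3314707, 3315475, 3315731, 3314979, 3315491, 3315747, 3314739,
     3314995, 3315507, 3315763, 3315779, 3315539, 3315827, 17157, 1274882, 1078322,
     2118706, 3175746, 30023, 215297, 1274882, 1074226, 1078322, 3176002, 3184450,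
     1075522, 30021, 34117, 1878, 7672068, 7692547, 7701251, 7708931, 7709187, 7709443,
     7710723, 7709203, 7710755, 7710515, 7711027, 7710275, 7711091, 2710, 11075844,
     11079940, 11092739, 11109123, 11120899, 11121155, 11121411, 11122691, 11121171, 11122723,
     11123251, 11123315, 2950, 12075539, 12079619, 12083459, 9139764, 12089908, 12089972,
     763442, 223874, 8615586, 1862, 7653987, 2662, 10887684, 7708931, 7709187, 7709443,
     7709955, 7710211, 7710723, 7709203, 7709475, 7710499, 7710755, 7711011, 7710003,
     7710515, 7711027, 7710019, 7711059, 7711091, 2694, 11026963, 11034883, 9083140,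
     9081620, 9082900, 9083156, 9081908, 9082932, 11048259, 9082948, 11049300, 11049556,
     676242, 9458082, 676626, 10716434, 676914, 1350, 5550339, 5550595, 5550611,
     5550867, 5551635, 5552147, 5552403, 5551939, 5552515, 5552771, 2966, 12124420,
     12153619, 12173827, 12175379, 12176147, 12175171, 12176003, 12176259, 1862, 2406, 9851395,
     9859876, 9860900, 6911540, 223265, 2918, 11936260, 7025412, 7025444, 7026468, 12174899,
     6343474, 240418, 1295026, 12174115, 3917602, 12044834, 51847, 7045924, 7046692,
     7046948, 11963572, 240418, 12174115, 1491634, 3917602, 12044834, 51847, 7055364,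
     11971716, 1818754, 3206, 13115908, 13128195, 5550339, 5550595, 5550611, 5550867,
     5551379, 5552467, 2406, 9851395, 2950, 12058884, 12067332, 12083459, 12088083, 12108035,
     12108307, 12110163, 3222, 13172996, 13177092, 13189651, 9876755, 11055363, 11055619,
     11057155, 11057667, 11055635, 11057187, 11057699, 11056451, 2966, 12124420, 12128516,
     12141075, 12145155, 10187524, 10187540, 10188564, 10188820, 10187828, 10188084, 10188852,
     10189364, 10188628, 10189396, 10188916, 10189428, 8626610, 10965426, 743442, 12079890,
     93058, 10574002, 8496818, 5473458, 3907922, 3896450, 746402, 3892642, 1731410,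
     1862, 7653139, 2918, 11936260, 11940612, 11944467, 11978515, 12173571, 12173827, 12175363,
     12173843, 12175395, 12175907, 3206, 13124115, 13128195, 13132035, 9205508, 9204500,
     9205780, 9205812, 9206068, 9206132, 10209396, 8436850, 7387330, 248081, 9941442,
     833554, 763778, 8102274, 8112770, 51847, 1378370, 537922, 30023, 4555828, 30023,
     30023]),
   ([1, 1, 2, 1, 3, 3],
    [2179331, 2179587, 2179859, 2179875, 151811, 152323, 152579, 152083, 152595,
     152355, 152611, 1073667, 1073923, 1074179, 1074435, 1073683, 1073939, 1074499,
     3174659, 3174915, 3175683, 3175939, 3174931, 3175187, 3175443, 3175203, 3175715,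
     3175731, 3175987, 3244291, 3244547, 3244803, 3245315, 3245571, 3245827, 3244563,
     3245587, 3245843, 3244835, 3245091, 3245347, 3245859, 3245107, 3245619, 3245875,
     3313923, 3314179, 3314435, 3314947, 3315203, 3315715, 3314195, 3314451, 3315219,
     3315475, 3315731, 3314979, 3315491, 3315747, 3314739, 3314995, 3315507, 3315779,
     3315539, 3315827, 2438, 9982467, 9986307, 10002691, 10002947, 10003715, 10003971,
     10004483, 10004739, 10002963, 10003219, 10003987, 10004243, 10004499, 10003235, 10003747,
     10004259, 10004515, 10004771, 17157, 1274882, 1078322, 2118706, 3175746, 30023, 215297,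
     1274882, 1074226, 1078322, 3176002, 3184450, 1878, 7672068, 7692547, 7701251,
     7709475, 7713027, 7713283, 7713539, 7714307, 7714563, 7714819, 7713299, 7713571,
     7714851, 7715107, 7715363, 7714099, 7715123, 7714371, 42293, 2427442, 375346,
     1292802, 1075762, 3192482, 47719, 227922, 375410, 2662, 10887684, 6959876, 10892068,
     6960964, 6961252, 2144818, 3192482, 223265, 702562, 2918, 11936260, 11965219, 11976963,
     11977219, 11977235, 11978787, 3206, 13107460, 13124115, 13128195, 1862, 10895891, 10899971,
     6977076, 10910628, 47719, 10928387, 10928643, 10930435, 10930691, 10928659, 10930707, 3206,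
     13107460, 13115908, 13124115, 13128195, 13138435, 1067634, 1862, 9222148, 13154563,
     13154819, 9222916, 13154835, 9222180, 9222692, 2140354, 8436418, 2141074, 9479090,
     12610466, 1794722, 47719, 7713027, 7713539, 7714819, 7713299, 7714851, 2950, 12075539,
     12083459, 2966, 12124420, 12128516, 12141315, 12148995]),
   ([1, 1, 2, 2, 2, 1],
    [1073923, 1073939, 3175939, 3174931, 3175187, 3175955, 3175203, 3175987, 3245587,
     3245859, 3245875, 3245923, 34663]),
   ([1, 1, 2, 2, 2, 3],
    [1073923, 1073939, 3175939, 3174931, 3175187, 3175955, 3175203, 3175987, 3245587,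
     3245859, 3245875, 3245923, 34663]),
   ([1, 1, 2, 2, 3, 1],
    [2179331, 2179859, 2179875, 151811, 152323, 152355, 1073667, 1073923, 1073683,
     1073939, 3174659, 3174915, 3174931, 3175187, 3175955, 3175715, 3175731, 3175987,
     3244291, 3244547, 3244803, 3244563, 3245091, 3245107, 3245923, 3313923, 3314435,
     3314451, 3315779, 3315539, 1894, 7741956, 7750163, 7754243, 7770883, 7774467,
     7774723, 7774979, 7774739, 7774995, 2694, 11010308, 11018756, 11026963, 11031043,
     11047683, 11055875, 11055891, 2374, 9699588, 9724163, 9728787, 9741075, 9745171, 2390,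
     9769220, 9789699, 9798403, 9806595, 9810691]),
   ([1, 1, 2, 2, 3, 2],
    [2179331, 2179587, 2179859, 2179875, 151811, 152323, 152579, 152595, 152355,
     152611, 1073667, 1073923, 1074179, 1074435, 1073683, 1073939, 1074195, 1074211,
     3174659, 3174915, 3175683, 3175939, 3174931, 3175187, 3175443, 3175955, 3175203,
     3175459, 3175715, 3175731, 3175987, 3244291, 3244547, 3244803, 3245315, 3245827,
     3244563, 3245075, 3245843, 3244835, 3245859, 3245107, 3245875, 3245923, 3313923,
     3314179, 3314435, 3315203, 3315459, 3315715, 3314195, 3314707, 3315219, 3315475,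
     3315491, 3315747, 3314739, 3315507, 3315539, 3315827, 38757, 468626, 38759, 25381,
     223009, 235042, 169522, 1197618, 3314786, 149346, 1894, 7754243, 7776019, 2422,
     9912851, 9941251, 9941507, 9943043, 9941523, 9942803, 9943075, 2950, 12075539,
     12079619, 12083459, 12101395, 7774467, 7774723, 7774979, 7775491, 7776003, 7776515,
     7774739, 7775251, 7776035, 7776051, 7776627, 2694, 11010308, 11018756, 11026963,
     11031043, 11047683, 11055363, 11055875, 11056387, 11056899, 11057411, 11056147, 11056931,
     11056947, 11057523, 2422, 9912851, 9945603, 9945859, 9946883, 9947139, 9947907,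
     9946131, 9945891, 9947171, 9946931, 9948051, 2886, 11796740, 11809540, 4928516,
     4929604, 4929892, 2147378, 3197762, 1820738, 2406, 9851395, 3206, 13128195, 11821315,
     11826980, 11834116, 11836164, 4953140, 2118706, 3192130, 46407, 11846404, 11847428,
     11848452, 11847476, 11848052, 11848596, 7573570, 9483074, 1071938, 46407, 169522, 38759]),
   ([1, 1, 2, 2, 3, 3, 1],
    [2179331, 2179587, 2179859, 2179875, 151811, 152323, 152579, 152083, 152595,
     152355, 152611, 1073667, 1073923, 1073683, 1073939, 1074195, 1074467, 1074499,
     3174659, 3174915, 3175683, 3175939, 3174931, 3175187, 3175443, 3175955, 3175203,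
     3175459, 3175715, 3175731, 3175987, 3244291, 3244547, 3244803, 3245315, 3245571,
     3245827, 3244563, 3245075, 3245587, 3245843, 3244835, 3245091, 3245859, 3245107,
     3245619, 3245875, 3245923, 3313923, 3314179, 3314435, 3314947, 3315203, 3315715,
     3314195, 3314451, 3314707, 3315219, 3315475, 3315731, 3314723, 3314979, 3315491,
     3315747, 3314995, 3315763, 3315779, 3315539, 3315827, 2438, 9982467, 9986307,
     10002691, 10002947, 10003219, 10003475, 10003987, 10004243, 10004499, 10004259, 10004771,
     10004803, 2630, 10748164, 10760980, 10772739, 10777363, 10793475, 10794515, 10794771,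
     10794787, 10795331, 1894, 7741956, 7750163, 7754243, 7770883, 7774995, 2934, 12014083,
     8095540, 8095588, 46951, 8099124, 12032324, 12032580, 12032836, 8099668, 624449,
     2708594, 2577554, 1530434, 10990914, 12010322, 1529922, 7783747, 1350, 10795027,
     10795299, 10795395, 47495, 10006787, 10007043, 10007811, 10008067, 10008579, 10007059,
     10007315, 10007571, 10008083, 10008339, 10008851, 10007331, 10008355, 10008611, 10008867,
     10008883, 45829, 1276674, 1080114, 2120498, 3175858, 46949, 468658, 46951, 2934,
     12010003, 12034307, 12034819, 12035331, 12035091, 12036371, 2646, 10817796, 10826500,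
     10838275, 10846979, 10852628, 10852884, 5936436, 84306, 1680466, 42311, 10863363, 1894,
     7741956, 7750163, 7754243, 7770883, 7783171, 12043779, 12044291, 12042771, 12044323,
     12045107, 1894, 7741956, 7750163, 7754243, 7770883, 7774467, 7774979, 7777027,
     7775523, 7775795, 7777123, 2918, 11936260, 11940644, 7026212, 11942180, 11941172,
     11942196, 7027252, 11942964, 434738, 2533682, 434866, 3582242, 435506, 2317218,
     232546, 3315106, 2646, 10817796, 10847011, 3206, 13124115, 11944467, 11948547, 1276674,
     1076018, 1080114, 3176114, 46951]),
   ([1, 1, 2, 2, 3, 3, 2],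
    [2179331, 2179587, 2179859, 2179875, 151811, 152323, 152579, 152083, 152595,
     152355, 152611, 1073667, 1073923, 1074435, 1073683, 1073939, 1074195, 1074467,
     1074499, 3174659, 3174915, 3175683, 3175939, 3174931, 3175187, 3175443, 3175955,
     3175203, 3175459, 3175715, 3175731, 3175987, 3244291, 3244547, 3244803, 3245315,
     3245571, 3245827, 3244563, 3245075, 3245587, 3245843, 3244835, 3245091, 3245859,
     3245107, 3245619, 3245875, 3245923, 3313923, 3314179, 3314435, 3314947, 3315203,
     3315459, 3315715, 3314195, 3314451, 3314707, 3315219, 3315475, 3315731, 3314723,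
     3314979, 3315491, 3315747, 3314995, 3315763, 3315779, 3315539, 3315827, 1894,
     7741956, 7750163, 7754243, 7770883, 7778563, 7779075, 7779843, 7779091, 7779619,
     7779891, 2438, 9982467, 9986307, 10002947, 10003715, 10003971, 10004483, 10002963,
     10004243, 10003235, 10004259, 10004515, 10004771, 10004787, 2678, 10961427, 10965507,
     10995715, 10994195, 10995747, 2662, 10887684, 6959876, 6960900, 6961924, 10892068,
     10893604, 6961972, 6960996, 6961252, 10995251, 2120242, 700978, 701746, 6343218,
     702770, 3192226, 3196578, 10994435, 3852034, 706162, 6535458, 10995810, 3315122,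
     2902, 11866372, 11895587, 3206, 13124115, 10895891, 10899971, 10007315, 7779075, 7779587,
     7780099, 7780611, 7779091, 7780627, 7780147, 47493, 45861, 170802, 47495, 154418,
     2438, 9982467, 9986307, 10002691, 10002947, 10003715, 10004483, 10002963, 10003475,
     10003987, 10004243, 10004755, 10004259, 2678, 10961427, 10965507, 10993923, 10994947,
     10995715, 10994707, 10995475, 10995987, 3158, 12914948, 6042372, 6043396, 6043444,
     8045876, 5286962, 7577794, 829185, 1076338, 828274, 829042, 42855, 12935427,
     12945412, 12949780, 12950548, 6067508, 84306, 1688658, 50503, 6075140, 6076164,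
     6076212, 8045316, 3974914, 1076338, 828274, 829042, 42855, 10010883, 10011139,
     10011907, 10011411, 10011667, 10012179, 10012435, 10012451, 10012995, 3142, 12845316,
     12858132, 12869891, 12874515, 12886531, 12887299, 12887059, 12887571, 12887827, 12887843,
     12888387, 2678, 10965507, 8030004, 8030052, 42855, 8033588, 10983748, 10984004, 8034132,
     244306, 624449, 2708594, 2577554, 1530434, 10961746, 674642, 1529922, 1350, 12890899,
     535442, 47495]),
   ([1, 1, 2, 2, 3, 3, 3],
    [2179331, 2179587, 2179859, 2179875, 151811, 152323, 152579, 152083, 152595,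
     152355, 152611, 1073667, 1073923, 1073683, 1073939, 1074195, 1074467, 1074499,
     3174659, 3174915, 3175683, 3175939, 3174931, 3175187, 3175443, 3175955, 3175203,
     3175459, 3175715, 3175731, 3175987, 3244291, 3244547, 3244803, 3245315, 3245571,
     3245827, 3244563, 3245075, 3245587, 3245843, 3244835, 3245091, 3245859, 3245107,
     3245619, 3245875, 3245923, 3313923, 3314179, 3314435, 3314947, 3315203, 3315715,
     3314195, 3314451, 3314707, 3315219, 3315475, 3315731, 3314723, 3314979, 3315491,
     3315747, 3314995, 3315763, 3315779, 3315539, 3315827, 2438, 9982467, 9986307,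
     10006787, 10007043, 10007315, 10007571, 10008083, 10008339, 10008595, 10008355, 10008867,
     10008899, 2886, 11796740, 11809556, 11821315, 11825939, 11839507, 11839779, 11839875, 43399,
     11846147, 11847187, 11847443, 11847459, 11848003, 1894, 7741956, 7750163, 7754243,
     7770883, 3190, 13062659, 8161076, 8161124, 51047, 8164660, 13080900, 13081412, 13081668,
     8165204, 624449, 2708594, 2577554, 1530690, 12043586, 13058898, 1529922, 7775555, 1350,
     7779091, 10006787, 10007043, 10007811, 10008067, 10008579, 10007059, 10007315, 10007571,
     10008083, 10008339, 10008851, 10007331, 10008355, 10008611, 10008867, 10008883, 45829,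
     1276674, 1080114, 2120498, 3175858, 2934, 12010003, 12035587, 12036099, 12034579,
     12036131, 12035891, 8104500, 1894, 7741956, 7750163, 7754243, 7770883, 7782659,
     7783171, 7785219, 7783715, 7783987, 2918, 11936260, 11940644, 11942180, 11941172,
     11942196, 11942452, 7027764, 442930, 2541874, 3590434, 443698, 232034, 220338,
     3315138, 3158, 12914948, 12944163, 2694, 11026963, 11944467, 11948547, 12042499, 12043011,
     12043523, 12043283, 12044563, 3158, 12914948, 12923652, 12935427, 12944131, 12949780,
     12950548, 6067508, 84306, 1688658, 50503, 12952323, 1894, 7741956, 7750163, 7754243,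
     7770883, 7774979, 1276674, 1076018, 1080114, 3176114, 46951]),
   ([1, 1, 2, 3, 3, 1],
    [1073667, 1073923, 1073683, 1073939, 3174659, 3174915, 3175939, 3174931, 3175187,
     3175955, 3175203, 3175987, 3244547, 3244803, 3245827, 3244563, 3245587, 3245843,
     3245859, 3245875, 3245923, 3314435, 3315827, 2166, 8864275, 8868355, 8888835,
     8889091, 8890115, 8888851, 8890387, 2662, 10887684, 10892036, 10895891, 10899971,
     10916611, 10925827, 10926099, 10926195, 47223]),
   ([1, 1, 2, 3, 3, 2, 1],
    [2179331, 2179587, 2179859, 2179875, 151811, 152323, 152579, 152083, 152595,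
     152355, 152611, 1073667, 1073923, 1073683, 1073939, 1074499, 3174659, 3174915,
     3175683, 3175939, 3174931, 3175187, 3175443, 3175955, 3175203, 3175459, 3175715,
     3175731, 3175987, 3244291, 3244547, 3244803, 3245315, 3245571, 3245827, 3244563,
     3245075, 3245587, 3245843, 3244835, 3245091, 3245347, 3245859, 3245107, 3245875,
     3245923, 3313923, 3314179, 3314435, 3314947, 3315203, 3315459, 3315715, 3314195,
     3314707, 3315475, 3315731, 3314723, 3314979, 3315491, 3315747, 3314739, 3314995,
     3315779, 3315827, 2166, 8864275, 8868355, 8888579, 8888835, 8889091, 8889603,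
     8890371, 8888851, 8889107, 8889363, 8890131, 8889379, 8889635, 8890147, 8890403,
     42309, 30021, 34117, 43333, 43349, 604754, 42311, 2630, 10748164, 10760964, 4862756,
     4864292, 4864068, 2646, 10817796, 10838275, 10858755, 10859011, 10860547, 10859027, 2966,
     12124420, 12128516, 12141075, 10187524, 10188548, 10188820, 10188916, 93058, 2918,
     11936260, 11940612, 11944707, 11978499, 11978771, 11978867, 51319, 12158980, 12173571,
     12173827, 12173843, 3190, 13046020, 13050372, 13058579, 13062659, 13066499, 10858755,
     10859011, 10860547, 10859027, 10859299, 10860579, 10860835, 10859843, 10860611, 2934,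
     11997444, 12001796, 12010003, 12017923, 12030755, 12043587, 1350, 5544771, 2395026, 2950,
     12083459, 10772739, 10793219, 10793475, 10794243, 10793491, 10794771, 10794787, 10795603,
     2966, 12124420, 12128516, 12145155, 12154644, 10191620, 10192644, 10192916, 10193012,
     1076082, 2918, 11936260, 11940612, 11948547, 11978499, 11978771, 11978867, 51319, 12173571,
     12174595, 12173843, 12175123, 12175139, 12175955, 2646, 10817796, 5912404, 706386, 3190,
     13058579, 13066499, 10838275, 10793219, 10793475, 10794771, 10794275, 10794787, 10795555,
     10794307, 10795331, 10795603, 2950, 12058884, 12067332, 12079619, 12083459, 12097860,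
     12110371, 12109123, 2646, 10817796, 5911332, 5912868, 10828579, 10827075, 10828627,
     10729762, 4437842, 1350, 5543747, 2406290, 2934, 12017923, 10838275, 10865187, 5936436,
     42311, 1653314, 42311, 4887604, 42311, 1586498, 42311, 4555828, 42311, 1419074,
     472146, 304978, 7623074, 42311, 4553236, 5535028, 42311, 1378882, 1062050, 4215714,
     42311, 8892675, 8892931, 8893187, 8893955, 8894211, 8894723, 8892947, 8894227,
     8894483, 8894739, 8894243, 2918, 11936260, 11940612, 11944467, 11948547, 11970051,
     11970307, 11970819, 7055876, 2966, 12141075, 12145155, 12173571, 12173827, 12175875,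
     12173843, 12175123, 12175139, 3190, 13058579, 13062659, 13066499, 13085188, 11978499,
     11978771, 11978867, 51319]),
   ([1, 1, 2, 3, 3, 2, 2],
    [2179331, 2179587, 2179859, 2179875, 151811, 152323, 152579, 152083, 152595,
     152355, 152611, 1073667, 1073923, 1073683, 1073939, 1074499, 3174659, 3174915,
     3175683, 3175939, 3174931, 3175187, 3175443, 3175955, 3175203, 3175459, 3175715,
     3175731, 3175987, 3244291, 3244547, 3244803, 3245315, 3245571, 3245827, 3244563,
     3245075, 3245587, 3245843, 3244835, 3245091, 3245347, 3245859, 3245107, 3245875,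
     3245923, 3313923, 3314179, 3314435, 3314947, 3315459, 3315715, 3314195, 3314707,
     3315475, 3315731, 3314723, 3314979, 3315491, 3315747, 3314739, 3314995, 3315779,
     3315827, 2166, 8864275, 8868355, 8888579, 8888835, 8889091, 8889859, 8890115,
     8890627, 8888851, 8890131, 8890387, 8890643, 8890147, 2662, 10887684, 10892036,
     10895891, 10899971, 10926595, 2710, 11092499, 11096579, 11124995, 11125251, 11127299,
     11125267, 11126547, 11126563, 3190, 13058579, 13062659, 13066499, 13089283, 10925827,
     10926099, 10926195, 47223, 8892675, 8892931, 8893187, 8893699, 8894467, 8892947,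
     8893203, 8893459, 8894227, 8893475, 8893731, 8894243, 8894499, 46405, 30021, 34117,
     47429, 47445, 605010, 46407, 2886, 11796740, 11809540, 4928292, 4929828, 4929604,
     2902, 11866372, 11886851, 11903235, 11903491, 11905027, 11903507, 2710, 11075844, 11079940,
     11092499, 10121988, 10123012, 10123284, 10123380, 92802, 2662, 10887684, 10892036,
     10896131, 10929923, 10930195, 10930291, 51319, 11110404, 11124995, 11125251, 11125267, 3190,
     13046020, 13050372, 13058579, 13062659, 13066499, 11911427, 11911683, 11913219, 11911699,
     11911971, 11913251, 11913507, 11912515, 11913283, 3190, 13046020, 13050372, 13058579,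
     13066499, 13079331, 13083971, 1350, 5545027, 2395282, 3206, 13132035, 11821315, 11837699,
     11837955, 11838723, 11837971, 11839251, 11839267, 11838787, 4958804, 2710, 11075844,
     11079940, 11096579, 11106068, 10126084, 10127108, 10127380, 10127476, 1075826, 2662,
     10887684, 10892036, 10899971, 10929923, 10930195, 10930291, 51319, 11124995, 11126019,
     11125267, 11126547, 11126563, 11127635, 2902, 11866372, 5977940, 771922, 3190, 13058579,
     13066499, 11886851, 11845891, 11846147, 11847443, 11846947, 11847459, 11848483, 11846979,
     11848003, 11848531, 3206, 13107460, 13115908, 13128195, 13132035, 13146436, 13149475,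
     13151011, 13149507, 2902, 11866372, 5976868, 5978404, 11877411, 11875651, 11877459,
     11782434, 4441938, 1350, 5543747, 2410386, 3190, 13066499, 11886851, 11905572, 6001972,
     46407, 1653570, 46407, 4953140, 46407, 1586498, 46407, 4555828, 46407, 1423170,
     472146, 309074, 7623090, 46407, 4553492, 5535028, 46407, 1379138, 1062066, 4215730,
     46407]),
   ([1, 1, 2, 3, 3, 2, 3],
    [2179331, 2179587, 2179859, 2179875, 151811, 152323, 152579, 152083, 152595,
     152355, 152611, 1073667, 1073923, 1073683, 1073939, 1074499, 3174659, 3174915,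
     3175683, 3175939, 3174931, 3175187, 3175443, 3175955, 3175203, 3175459, 3175715,
     3175731, 3175987, 3244291, 3244547, 3244803, 3245315, 3245571, 3245827, 3244563,
     3245075, 3245587, 3245843, 3244835, 3245091, 3245347, 3245859, 3245107, 3245875,
     3245923, 3313923, 3314179, 3314435, 3314947, 3315203, 3315459, 3315715, 3314195,
     3314707, 3315475, 3315731, 3314723, 3314979, 3315491, 3315747, 3314739, 3314995,
     3315779, 3315827, 2166, 8864275, 8868355, 8892675, 8892931, 8893187, 8893699,
     8894467, 8892947, 8893203, 8893459, 8894227, 8893475, 8893731, 8894243, 8894499,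
     46405, 30021, 34117, 47429, 47445, 605010, 46407, 2886, 11796740, 11809540, 4928292,
     4929828, 4929604, 2902, 11866372, 11886851, 11903235, 11903491, 11905027, 11903507,
     11903779, 11905059, 11905315, 11904323, 11905091, 2678, 10948868, 10953220, 10961427,
     10969347, 10982179, 10995011, 1350, 5544515, 2394770, 2694, 11034883, 11911427, 11911683,
     11913219, 11911699, 3222, 13172996, 13177092, 13189651, 10253060, 10254084, 10254356,
     10254452, 93314, 3174, 12984836, 12989188, 12993283, 13018883, 13019155, 13019251, 43127,
     13207556, 13213955, 13214211, 13214227, 2678, 10948868, 10953220, 10961427, 10965507,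
     10969347, 11821315, 11837699, 11837955, 11839251, 11838499, 11838755, 11839267, 4958756,
     11838787, 11839811, 4958804, 2694, 11010308, 11018756, 11031043, 11034883, 11049284,
     11062051, 11060547, 2902, 11866372, 5976868, 5978404, 11876899, 11875651, 11876947,
     11774242, 4433746, 1350, 5543747, 2402194, 2678, 10969347, 11886851, 11914019, 11845891,
     11846147, 11846915, 11846163, 11847443, 11847459, 11848531, 3222, 13172996, 13177092,
     13193731, 13203220, 10257156, 10258180, 10258452, 10258548, 1076338, 3174, 12984836,
     12989188, 12997123, 13018883, 13019155, 13019251, 43127, 13213955, 13214979, 13214227,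
     13215507, 13215523, 13216595, 2902, 11866372, 5977940, 763730, 2678, 10961427, 10969347,
     11886851, 6001972, 46407, 1653570, 46407, 4953140, 46407, 1586498, 46407, 4555828,
     46407, 1423170, 472146, 309074, 7623090, 46407, 4553492, 5535028, 46407, 1379138,
     1062066, 4215730, 46407, 8892675, 8892931, 8893187, 8893955, 8894211, 8894723,
     8892947, 8894227, 8894483, 8894739, 8894243, 2918, 11936260, 11940612, 11944467,
     11948547, 11970307, 11970579, 11970675, 43127, 11978499, 11979011, 11979523, 2966, 12141075,
     12145155, 12165379, 12165635, 12168195, 12165651, 12166931, 12166947, 2678, 10961427,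
     10965507, 10969347, 8046340, 10996227]),
   ([1, 1, 2, 3, 3, 3],
    [2179331, 2179587, 2179859, 2179875, 151811, 152323, 152595, 152355, 152611,
     1073667, 1073923, 1073683, 1073939, 3174659, 3174915, 3175683, 3174931, 3175187,
     3175443, 3175955, 3175203, 3175459, 3175715, 3175731, 3175987, 3244291, 3244547,
     3244803, 3245315, 3245571, 3244563, 3245075, 3245843, 3244835, 3245091, 3245859,
     3245107, 3245875, 3245923, 3313923, 3314179, 3314435, 3315203, 3315459, 3315715,
     3314195, 3314451, 3315219, 3315475, 3315731, 3314979, 3315491, 3315747, 3314995,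
     3315507, 3315763, 3315779, 3315539, 3315827, 2166, 8864275, 8868355, 8888579,
     8889603, 8889107, 8889363, 8890387, 8890643, 8889379, 8890739, 8890755, 2422,
     9912851, 9920771, 9941251, 9941507, 9941763, 9942787, 9941523, 9942547, 9943075,
     9943331, 9942835, 9943683, 9943699, 2438, 9982467, 9986307, 10010883, 10011139,
     10012163, 10011155, 10011411, 10012691, 10013203, 10013475, 10012723, 10013603, 3254,
     13304068, 13308164, 12333828, 12334852, 13316884, 13318164, 12334900, 13318196, 13319331,
     1076274, 833074, 3176130, 3245746, 2918, 11936260, 11944467, 11948547, 2646, 10817796,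
     10826516, 5911332, 5912868, 5912884, 2180402, 1418290, 3314850, 2630, 10748164, 3174,
     12984836, 12997123, 10851092, 10852884, 5936436, 2180402, 3253330, 42311, 10863380,
     10865172, 10865204, 2180402, 3253330, 42311, 13320723, 13324803, 8888835, 8889091,
     8888851, 8889107, 2662, 10887684, 10892036, 10895891, 10899971, 10916611, 10924803,
     10924819, 2422, 9912851, 9920771, 9941763, 2438, 9982467, 9986307, 10007315]),
   ([1, 2, 3, 1, 1, 2],
    [2179331, 2179587, 2179859, 2179875, 151811, 152323, 152579, 152083, 152595,
     152355, 1073667, 1073923, 1073939, 3174659, 3174915, 3174931, 3175187, 3175443,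
     3175955, 3175203, 3175459, 3175715, 3175731, 3175987, 3244291, 3244547, 3244803,
     3245315, 3245827, 3244563, 3245075, 3245843, 3244835, 3245091, 3245347, 3245859,
     3245107, 3245875, 3245923, 3313923, 3314435, 3315459, 3315715, 3314195, 3315475,
     3315731, 3314979, 3315747, 3314995, 3315779, 3315539, 3315827, 2390, 9769220,
     9781779, 9789699, 9798403, 9806595, 9807875, 9807907, 34629, 17157, 215041, 1274882,
     1078322, 2118706, 3175746, 1071170, 2139266, 2118, 8675587, 8696595, 2166, 8868355,
     8889091, 8897027, 8897283, 8897299, 3174, 12984836, 12989188, 12993283, 12997123,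
     13013763, 13021971, 8696595, 8696611, 8697635, 8697891, 2166, 8868355, 8889091,
     8896771, 8898819, 8897299, 8898835, 8897571, 8898595, 8899363, 8897859, 3158,
     12914948, 12923668, 6042404, 6043940, 6042676, 6043956, 2209074, 1428274, 3314882,
     3324354, 3222, 13197571, 12935427, 12957731, 1078322, 34631, 1574002, 34631]),
   ([1, 2, 3, 1, 1, 3],
    [2179331, 2179587, 2179859, 2179875, 151811, 152323, 152579, 152083, 152595,
     152355, 152611, 1073667, 1073923, 1073939, 1074195, 3174659, 3174915, 3175683,
     3174931, 3175187, 3175443, 3175955, 3175203, 3175459, 3175715, 3175731, 3175987,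
     3244291, 3244547, 3244803, 3245315, 3245827, 3244563, 3245075, 3245587, 3245843,
     3244835, 3245091, 3245347, 3245859, 3245107, 3245875, 3245923, 3313923, 3314179,
     3314947, 3315203, 3315459, 3315715, 3314195, 3314451, 3315475, 3315731, 3314723,
     3314979, 3315747, 3314739, 3314995, 3315763, 3315779, 3315539, 3315827, 34629, 17157,
     215041, 1274882, 1078322, 2118706, 3175746, 1071170, 2118, 8675587, 8691971, 8692227,
     8692995, 8692243, 8692499, 8693267, 8693523, 8693779, 8692515, 8693027, 8693539,
     8693795, 8694051, 8694067, 8693571, 8694083, 8693843, 8693875, 8694147, 2166,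
     8868355, 8892675, 8892931, 8893187, 8893699, 8894467, 8892947, 8893971, 8894739,
     8894995, 8893475, 8893731, 8894243, 8894499, 8895011, 8894515, 8893763, 8894275,
     8894531, 8894835, 8895091, 8894851, 8895107, 47445, 636753, 605010, 2598322, 47703,
     47701, 691026, 2823586, 538034, 8758194, 47703, 42837, 47765, 9116306, 1653666,
     47703, 2902, 11866372, 5976868, 5978404, 5977140, 5978420, 3314866, 2982, 12189956,
     12214531, 12239363, 12240403, 12239651, 12241187, 12240707, 12240963, 12241219, 12241011,
     12241811, 1862, 7627011, 7642227, 2646, 10817796, 10838275, 2406, 9863972, 9866308,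
     9866356, 3174, 12984836, 12989220, 12997123, 9877812, 9878676, 51559, 11886851, 11911427,
     11913219, 11911699, 11913251, 3222, 13172996, 13177092, 13189651, 1862, 7627011, 13207556,
     13215779, 11246132, 47703, 473682, 47703, 5928244, 47703, 11901716, 6001972, 2205106,
     47703, 8892931, 8893187, 8894723, 8893203, 8894739, 8895043, 8895091, 2918, 11936260,
     11940612, 11944707, 11948547, 11969299, 11977475, 1862, 7627011, 7642019, 2966, 12145155,
     7652099, 8691971, 8692227, 8692995, 8693763, 8692243, 8692499, 8693523, 8693779,
     8692515, 8693027, 8693795, 8694051, 8694147, 2166, 8868355, 8892675, 8893699,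
     8893203, 8894739, 8894995, 8893731, 8894499, 8893763, 8894851, 2710, 11075844,
     11079940, 11096579, 11105043, 11121427, 11124995, 11126019, 11126787, 11125267, 11125523,
     11127571, 11125539, 11126051, 11127075, 11127171, 2902, 11866372, 11875092, 5977364,
     5977940, 2213170, 3263314, 771922, 3158, 12914948, 12927507, 12935427, 12945412,
     11886851, 6002980, 6001972, 8571794, 9618866, 52055, 11905059, 1078322, 34631, 1574002,
     34631]),
   ([1, 2, 3, 1, 2, 3, 1],
    [2179331, 2179587, 2179859, 2179875, 151811, 152323, 152579, 152083, 152595,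
     152355, 152611, 1073667, 1073923, 1074179, 1074435, 1073683, 1073939, 1074195,
     1074451, 1074211, 1074467, 1074499, 3174659, 3174915, 3175683, 3175939, 3174931,
     3175187, 3175443, 3175955, 3175203, 3175459, 3175715, 3175731, 3175987, 3244291,
     3244547, 3244803, 3245315, 3245571, 3245827, 3244563, 3245075, 3245587, 3245843,
     3244835, 3245091, 3245347, 3245859, 3245107, 3245619, 3245875, 3245923, 3313923,
     3314179, 3314435, 3314947, 3315203, 3315459, 3315715, 3314195, 3314451, 3314707,
     3315219, 3315475, 3315731, 3314723, 3314979, 3315491, 3315747, 3314739, 3314995,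
     3315507, 3315763, 3315779, 3315539, 3315827, 1862, 7623171, 7627011, 7635716,
     7636740, 7636996, 4686900, 7636532, 4688196, 7636836, 7637092, 215297, 1283650, 2134,
     8741123, 8753940, 8755220, 8755476, 8754228, 5805364, 8755012, 8755268, 8755524,
     5805908, 218897, 2406, 9859876, 9860900, 9861412, 9860404, 6911540, 9860948, 9861204,
     6912100, 223265, 2678, 7999748, 8000260, 8000516, 8001028, 8001540, 8000020, 8000788,
     8001044, 8001556, 8001076, 8001092, 8001620, 8001636, 107009, 107777, 1073826,
     1074594, 88610, 2630, 10760964, 10768899, 10785539, 10795027, 10794275, 10795091, 47191,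
     10793475, 10795011, 10795523, 10794531, 10794547, 10794579, 10795107, 2918, 11977219,
     11978755, 11979267, 3206, 13115908, 13150724, 8004100, 8004116, 8004884, 8005908,
     8004644, 8005156, 8005668, 8004660, 8004916, 8004932, 8005956, 8005460, 8005972,
     172289, 173057, 1206786, 2122914, 2630, 10793219, 10794259, 10795043, 10794291, 10794835,
     2902, 11886851, 2950, 12058884, 12083459, 10793219, 10793987, 10795283, 10794291, 10794835,
     10795603, 2966, 12124420, 12173571, 12174339, 12174643, 12175187, 12175955, 3158, 12914948,
     12928004, 12935427, 8016644, 8017156, 8016660, 8017172, 8018196, 8016948, 8017204,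
     8017220, 8018244, 8017492, 8018004, 8018260, 8018308, 237825, 238593, 1272322,
     5268642, 2630, 10793219, 10794499, 10794259, 10794291, 10795091, 10795347, 10795395, 2902,
     11886851, 11912707, 11913299, 11913603, 11914115, 11914131, 2950, 12058884, 9118212,
     9118980, 9120004, 9119012, 12069971, 9120100, 12070035, 12070067, 6012962, 5423282,
     2868482, 11913474, 771730, 51559, 12083459, 10793219, 10793987, 10795283, 10794291, 2966,
     12124420, 12173571, 12174339, 12174643, 3158, 12914948, 12928004, 12935427, 2950, 9109764,
     9110020, 9110276, 9110532, 9110788, 9111300, 9111812, 9110292, 9111316, 9111076,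
     9111332, 9110836, 9111092, 9111124, 9111652, 8042500, 45345, 45393, 45457,
     8497922, 2116370, 1065906, 1070258, 1086642, 7381426, 8040708, 7381682, 1811458,
     1090738, 762385, 11707410, 1811266, 1811778, 1812802, 2902, 11912739, 11912755, 11913795,
     11913315, 2630, 3174, 9118212, 9118468, 9119492, 9120004, 9118228, 9118996, 9118756,
     9119268, 9119524, 9118772, 9119540, 9120052, 9119044, 9119556, 9120068, 9119588,
     8042532, 176385, 177153, 1207042, 8432418, 2126258, 2122930, 7512242, 7381938,
     3189170, 8041220, 763649, 12036354, 7381426, 7382194, 7382706, 763026, 762930,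
     3908930, 762113, 11641858, 11642370, 762978, 2630, 10799139, 2902, 11874819, 11886851,
     11913251, 9134340, 9135108, 9135620, 9136132, 9134868, 9135636, 9135892, 9134884,
     9135652, 9135908, 9136164, 9136420, 9135412, 9135668, 9135684, 9135940, 9135700,
     9135972, 9136484, 9136500, 8042596, 8040708, 8041476, 1811970, 762210, 8432482,
     6334642, 242193, 242961, 2312978, 6374322, 1811554, 6378674, 7774642, 7447218,
     7447730, 7449010, 763425, 2860386, 763937, 12101922, 2860690, 434705, 435473, 436497,
     2509330, 6378658, 6395042, 1811266, 2630, 2902, 11913795, 2902, 5968132, 5968388,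
     5968644, 5968900, 5969156, 5969668, 5969924, 5968404, 5968660, 5968916, 5969684,
     5969940, 5969188, 5969444, 5969476, 5969732, 5969988, 5969764, 8041748, 12109075,
     5286674, 5294866, 1090994, 7446706, 8503474, 1090226, 8041220, 3908610, 1090738,
     1098930, 763137, 11903490, 11904770, 762450, 7382706, 762994, 12108563, 3917842,
     1819778, 11904546, 2860130, 9160514, 12044866, 2630, 10760964, 10768899, 10785539,
     5976580, 5976836, 5977348, 5977860, 5976852, 5976868, 5977380, 5977636, 5977140,
     5977652, 5977908, 5977684, 8041780, 12109107, 12108291, 5286706, 5294898, 3188146,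
     3196338, 7577778, 8041220, 763137, 11903490, 2868482, 771666, 5284530, 12108563,
     762658, 12109347, 1819698, 11847218, 2630, 10748420, 10760964, 10768899, 10773283,
     10785539, 3174, 5980676, 5980932, 5981188, 5981444, 5981956, 5982212, 5981476,
     5981732, 5982244, 5981764, 5982020, 5982276, 5982052, 8041796, 12109123, 8041220,
     5286722, 5294914, 4236722, 7643314, 8041476, 763137, 11904770, 762450, 5284530,
     762994, 7382706, 12109827, 11904546, 2860130, 770690, 2868354, 9160514, 12044866,
     2630, 10760964, 10785539, 5989380, 5989636, 5990148, 5990404, 5989140, 5989652,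
     5990164, 5990676, 5989428, 5990196, 5990452, 5989700, 5989956, 5990212, 5990468,
     5990724, 5990228, 5990484, 5990772, 8042068, 12109395, 8041476, 6335314, 6343506,
     7708850, 8765618, 7381426, 7381938, 7382194, 7383474, 8438706, 8438962, 12108563,
     763153, 11903762, 11905298, 1811602, 1811506, 1819698, 3909186, 3918402, 763201, 2630,
     2966, 10158340, 10158596, 10159876, 10159892, 10159940, 8042756, 45345, 9546498, 2116370,
     7381426, 1090226, 763649, 762994, 762385, 11707410, 42823, 10162436, 10162948, 10163204,
     10163716, 10163972, 10162708, 10162964, 10163220, 10163476, 10163732, 10163988, 10162980,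
     10163236, 10163764, 10164020, 10163780, 10164068, 8042772, 111105, 111873, 9480978,
     1077938, 1070002, 1074610, 1078706, 7446706, 8040708, 7381938, 8041220, 3908610,
     1090738, 4235954, 7382706, 763649, 762482, 763250, 7382450, 762386, 11707666,
     8102690, 2860338, 763441, 3908706, 762369, 11707650, 763474, 2630, 10760964, 10768899,
     10785539, 10798355, 10799379, 10798387, 10798675, 10798931, 3158, 12957971, 10175236,
     10175492, 10176260, 10174996, 10175508, 10175764, 10175268, 10175540, 10176052, 10176308,
     10175812, 10176068, 10176324, 10176356, 8042820, 242177, 2317058, 3175090, 4215730,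
     3175858, 8041220, 9481026, 7643314, 8041476, 763649, 762482, 763250, 7381682,
     7381938, 7382450, 7382706, 8102178, 2860050, 1811778, 93010, 8102226, 8102690,
     2860338, 763441, 3908706, 762369, 11707650, 763474, 2630, 10760964, 10798355, 10798387,
     10799923, 10798675, 10798931, 3158, 12958516, 3206, 9175300, 9175556, 9176068, 9176324,
     9177348, 9176372, 9176660, 9176916, 9177428, 10209284, 49441, 49489, 8502274,
     2116626, 1070274, 9483714, 8041924, 3158, 9183748, 9185284, 9185540, 9183764,
     9185300, 9185572, 9185636, 10209316, 180481, 1207298, 8436770, 2144450, 9613506,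
     833537, 13154562, 8434114, 832146, 833170, 831745, 12695042, 47463, 9200644, 9201156,
     9201668, 9200404, 9201172, 9201428, 9201684, 9200420, 9201444, 9201956, 9200948,
     9201204, 9201972, 9201220, 9201476, 9201732, 9201236, 9202020, 10209380, 10208260,
     8436834, 6338754, 246289, 247057, 248081, 2313234, 6374338, 3249346, 6378690,
     9875906, 8040900, 8500418, 9876162, 8041156, 8041668, 8041476, 827921, 12755986,
     1876802, 1877314, 1877570, 1878338, 2630, 2630, 4849924, 4851972, 10990595, 9217028,
     4307458, 4311554, 12173475, 4862724, 4863748, 4864004, 4862484, 4864020, 4864276,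
     4862756, 4864036, 4864292, 4863796, 4864052, 4864308, 4863812, 4864388, 10990643,
     9217076, 4241970, 4246066, 8634530, 10990339, 3847938, 701554, 8438178, 8438434,
     8440226, 705041, 1755426, 10991891, 700978, 2799922, 3848482, 12761746, 11769762,
     7563922, 9730658, 4896370, 7641954, 47463, 4871172, 4871940, 4872196, 4872452,
     4872004, 4872260, 10990915, 9217348, 5290562, 5294658, 7647394, 8700066, 12173475,
     4875268, 4875028, 4876052, 4876308, 4876564, 4876100, 4876356, 4876404, 4876660,
     10991171, 9217604, 6339138, 6343234, 10990355, 7647650, 8700322, 8505250, 7453090,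
     7457186, 3848210, 11057426, 706833, 1756050, 4887556, 4888324, 4888580, 4888836,
     4888388, 4888644, 10991939, 9218372, 9484866, 9488962, 7647394, 8700066, 12173475,
     9871619, 9871875, 9873667, 9872403, 9872659, 9872915, 9873683, 9872419, 9872675,
     9872707, 9872963, 9873731, 41989, 42821, 42823, 494146, 297586, 41733, 1276418,
     1280514, 1079858, 2678, 10948868, 10953220, 10965507, 10989827, 10990339, 10991619,
     10992131, 10990867, 10990627, 10990883, 10992179, 10990915, 10991427, 10992195, 10992259,
     2902, 11875076, 11886851, 11914019, 2630, 4864036, 4864100, 701058, 702082, 2950,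
     10799651, 4901668, 4901716, 10799459, 10799715, 10799731, 10799987, 10799747, 10799763,
     10800035, 12350114, 12354210, 12219074, 733858, 2848162, 3316643, 6002594, 11302546,
     10254946, 8160930, 2792562, 8002706, 498210, 10994466, 9921186, 682017, 11048482,
     170546, 2804018, 51559, 10989827, 10990339, 10990595, 10991363, 10991619, 10991875,
     10990867, 10991123, 10991891, 10990883, 10991411, 10992179, 10990915, 10991427, 10991683,
     10991939, 10992259, 2966, 12173571, 12174083, 12175619, 12176131, 12174611, 12176147,
     12174659, 12176195, 2630, 4862756, 4864036, 4864292, 4863284, 4863540, 4864308,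
     10763060, 4864084, 4864340, 4864100, 10762595, 700978, 2798898, 10117682, 2799922,
     9659042, 682017, 11048482, 701058, 2798978, 8545698, 3848482, 2778514, 312242,
     11057490, 9683634, 12174115, 2344370, 6539554, 3158, 12923652, 12935427, 12940035,
     12954387, 6071892, 12954451, 6072676, 12954515, 9530274, 10577330, 9615042, 6076770,
     47463, 10799459, 10799731, 10799987, 10799747, 10800003, 10799763, 833170, 636610,
     11958722, 11962818, 825969, 13285746, 8165538, 474290, 8164274, 13272722, 470162,
     9200274, 47463, 1276418, 1079858, 4205170, 42823, 1341954, 1079874, 42823, 10748164,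
     9875715, 9875971, 9876739, 9876995, 9877763, 9876755, 9877779, 9876771, 9876803,
     9877059, 9877827, 34389, 562770, 366210, 9876867, 636258, 5879906, 45845, 232210,
     101170, 2950, 12058884, 12067332, 12099843, 12100099, 12100867, 12101891, 12100371,
     12101651, 9153044, 12101683, 9153076, 12100931, 12101187, 12101955, 12101715, 9153108,
     2678, 10948868, 10953220, 10965507, 10969347, 10983684, 2630, 10748164, 4862724, 4863748,
     4863796, 10763091, 10994739, 1749042, 4246066, 1290402, 7585954, 2902, 11891459,
     11913731, 12108035, 12108291, 12108563, 12110099, 12109123, 12109379, 12110147, 12109395,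
     12109923, 12110179, 3174, 12984836, 12989204, 7107332, 13007203, 1088562, 468626, 51559,
     13017347, 13017875, 13018435, 13018691, 13019459, 7121476, 13019235, 13019491, 2630,
     10748164, 4862756, 4864036, 4864292, 4863540, 4864308, 10763427, 1753650, 2804018,
     9659042, 682017, 11048482, 51559, 10795363, 232210, 101170, 5311362, 47191, 9876867,
     47191, 8757507, 8757763, 8758275, 8758531, 8758787, 8759299, 8758291, 8758803,
     8758563, 8759331, 8758851, 30021, 492866, 296306, 8758387, 566354, 4761426, 41733,
     1079858, 2678, 10948868, 10953220, 10969347, 8033044, 8034068, 8034324, 8034580,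
     8034596, 8033332, 8033588, 8034356, 8034612, 10982723, 8034644, 8034692, 8606114,
     8758036, 677649, 10978578, 10982674, 1725314, 2630, 10795027, 10794275, 10795091, 47191,
     10793747, 10794515, 10795299, 10795315, 10795091, 10795347, 10795395, 2406, 9851395,
     6915636, 9866132, 47463, 9879811, 9880067, 9881091, 9880851, 9880867, 9880899, 3158,
     6042372, 6043396, 6043428, 6043940, 6043444, 6043956, 6044564, 9880884, 5270578,
     3176130, 9659074, 812833, 13080098, 2909074, 2930322, 47463, 6058772, 3206, 13107460,
     13115908, 13153043, 6076500, 51287, 10989827, 10990339, 10991107, 10991619, 10991651,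
     10992179, 10990915, 10991427, 10991699, 10992211, 2902, 11866372, 11875076, 11886851,
     6002948, 6002996, 11901011, 6003076, 9470898, 595330, 47191, 11912707, 11912515,
     11913027, 11914051, 11913299, 11913811, 11913843, 11914147, 2630, 4862740, 4864020,
     10762323, 700722, 3848210, 47191, 4887332, 4888868, 4888884, 10787667, 10787923,
     10787955, 10788019, 700978, 2799922, 3848482, 6013586, 2406, 9851395, 6911540,
     9862292, 51559, 2950, 9877812, 9878676, 51559, 10799187, 10989827, 10990083, 10990339,
     10991443, 2966, 12124420, 12128516, 12141315, 12145155, 12157699, 12173571, 12174083,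
     12175187, 3158, 12914948, 12923652, 12927747, 12935427, 1276418, 1079858, 4205170, 42823,
     8758387, 42823, 8761603, 8761859, 8762371, 8762627, 8763395, 8762387, 8762659,
     8763427, 8762947, 2966, 12124420, 12128516, 12141572, 10187524, 10188548, 10188820,
     10188084, 10188852, 10188612, 8606130, 743441, 93058, 1790850, 1795458, 2918, 11936260,
     11940612, 11970307, 11969555, 11970371, 42823, 11977987, 11978771, 11978835, 51287, 12165379,
     12165635, 12166147, 12166403, 12167171, 12166723, 2678, 10948868, 10953220, 10965507,
     10969347, 10993923, 2630, 4862724, 4863748, 4862740, 4864020, 4864276, 4863796,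
     4864052, 4864308, 4864116, 4864388, 10200116, 10994739, 4241970, 4246066, 7585954,
     10994435, 3852034, 705394, 7391394, 9679266, 702482, 1749890, 3258530, 8761764,
     678162, 11096850, 1726514, 11754114, 546722, 8897954, 8764052, 10712514, 10996050,
     3158, 12914948, 12923652, 12927747, 12935427, 10768899, 12173571, 12173827, 12174339,
     12174595, 12175363, 12174627, 12175395, 3206, 13132035, 13148419, 13148675, 13149443,
     13150211, 9218564, 13149475, 13150243, 9218596, 3158, 12914948, 6042372, 6043396,
     6043908, 12925443, 12925475, 6043444, 6043956, 6043476, 6043988, 6044020, 10208564,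
     12822274, 5291058, 829234, 9679042, 3192770, 3175074, 5815412, 5815444, 9943234,
     8432578, 9152450, 12748706, 8997490, 42823, 12928004, 12935427, 6058756, 6059780,
     6060292, 12941859, 6059828, 6060372, 6060404, 10209108, 1876738, 829234, 5291122,
     7386562, 9941186, 5815444, 9943234, 755538, 6015090, 362418, 8407922, 9129074,
     12014786, 13333586, 8432578, 11577794, 12618146, 13215618, 5809266, 42823, 7639812,
     7640836, 7641348, 4690996, 7640372, 4692036, 7640916, 7641428, 215041, 1279298, 2406,
     9851395, 9863972, 9865252, 9865508, 9864244, 6915636, 9865028, 9865284, 9865540,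
     6915940, 223009, 2134, 8745748, 8746772, 8747028, 5797172, 8746548, 5798228, 8746852,
     8747364, 219409, 2678, 7999748, 8001028, 8001540, 8000020, 8000532, 8000788, 8001060,
     8001572, 8000564, 8001076, 8001092, 8001604, 8001380, 8001636, 107009, 107521,
     2185730, 1070242, 2630, 10793475, 10793987, 10795043, 10794547, 10794851, 10795619, 2950,
     12059140, 12108291, 12108803, 12109363, 12109667, 12110435, 3174, 12984836, 12993540,
     12997123, 10793475, 10795523, 10794531, 10795043, 10794547, 10795075, 10794851, 2918,
     11948547, 11977219, 11979267, 11978787, 11978819, 3206, 13107716, 13150724, 8004100,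
     8004356, 8004612, 8004868, 8004116, 8004900, 8005156, 8005668, 8005924, 8004916,
     8004932, 8005972, 8005988, 172289, 173569, 174081, 2118050, 2123170, 158226, 2630,
     10760964, 10772739, 10781443, 10795011, 10794259, 10795043, 10794291, 10794579, 10795347,
     2902, 2950, 10794515, 10795299, 10795363, 47463, 8020740, 8021508, 8022020, 8020772,
     8021540, 8022052, 8021044, 8021556, 8021572, 8022084, 8021588, 238081, 238593,
     2316802, 6313122, 2630, 10793475, 10793987, 10795043, 10794547, 2950, 12059140, 12108291,
     12108803, 12109363, 3174, 12984836, 12993540, 12997123, 10793475, 10795523, 10794531,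
     10795043, 10794547, 10795075, 2918, 11948547, 11977219, 11979267, 11978787, 11978819, 3206,
     13107716, 13150724, 2950, 9109764, 9110020, 9111300, 9111316, 9111332, 9111364,
     8042500, 45345, 8497922, 7381426, 1067810, 7381682, 763649, 762994, 762385,
     1811490, 42823, 9118212, 9118468, 9118724, 9118980, 9119492, 9118228, 9119012,
     9119268, 9119524, 9119028, 9119540, 9119044, 9119572, 9120084, 8042532, 176385,
     177665, 8432418, 2118066, 2126258, 2123186, 7512242, 7381938, 8041220, 3908610,
     7382450, 7381426, 763185, 3908690, 762113, 2630, 10760964, 10772739, 10781443, 10799139,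
     2902, 11913251, 9126660, 9126916, 9127684, 9126420, 9126676, 9126932, 9126964,
     9127220, 9127732, 9127236, 9127492, 9127748, 9127764, 9128276, 8042564, 241921,
     1272578, 3174834, 4219826, 8041220, 8432450, 7643314, 8041476, 763649, 762226,
     7381426, 7381938, 7382450, 154386, 158482, 8102418, 3237298, 2860050, 1812034,
     763185, 3908690, 2630, 10760964, 10799923, 2902, 11914035, 3222, 10223876, 10224132,
     10224388, 10224644, 10224900, 10225156, 10225412, 10225668, 10224404, 10224916, 10225172,
     10225428, 10225684, 10225940, 10224420, 10224932, 10225956, 10225460, 10225716, 10225988,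
     10225236, 10225492, 10225748, 10225780, 10226036, 10226052, 9160964, 49441, 49473,
     9550850, 1065922, 1074370, 1082562, 8434114, 1096130, 9158916, 1880578, 12760322,
     1094338, 2143682, 8434626, 3192770, 8040644, 833537, 832898, 8432066, 832273,
     12825874, 12826386, 1881682, 1882482, 8040900, 829713, 833809, 1876626, 1877138,
     1881234, 9544386, 9544898, 10265378, 3974434, 2924626, 13213762, 9221970, 8043652,
     10009282, 827921, 12755986, 1876802, 1877570, 1878082, 8169906, 8168882, 2630, 4871476,
     10771347, 701266, 2902, 10227972, 10229764, 10228244, 10229780, 10229796, 10229844,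
     9160980, 115201, 2186242, 9485330, 8499394, 833537, 831874, 832898, 8434370,
     832001, 12760322, 47191, 10245124, 10245380, 10244884, 10245396, 10245908, 10246164,
     10244900, 10245924, 10245428, 10245684, 10246196, 10245444, 10245956, 10246228, 9161044,
     9159684, 9485394, 246289, 2313234, 3244738, 5325762, 3245250, 8761794, 8040900,
     8499906, 8500418, 247329, 1264674, 3302594, 8041156, 8041668, 8041476, 827921,
     12755986, 1876802, 1877314, 1877570, 1878082, 2630, 2630, 4849924, 4851716, 10990595,
     10265604, 4307458, 4311554, 12107939, 4862724, 4862980, 4863748, 4864260, 4862484,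
     4862740, 4864020, 4864276, 4862756, 4863012, 4864036, 4864292, 4863796, 4864052,
     4864308, 4864372, 4864388, 10990643, 10265652, 4241970, 4246066, 3191970, 7581858,
     9683106, 10990339, 3847170, 700994, 3847938, 701298, 7387554, 9486754, 9487010,
     9488546, 705041, 10668050, 700722, 1751090, 3848210, 12696194, 3715490, 9548450,
     12153250, 1274530, 10795042, 11696290, 8608370, 3847538, 7637842, 47191, 4871172,
     4870932, 4871956, 4872212, 4872468, 4872004, 4872516, 4872308, 4872564, 10990915,
     10265924, 5290562, 5294658, 10990355, 10265364, 7647650, 9748898, 7452834, 9553826,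
     3848210, 3852306, 11651714, 13074850, 4875268, 4876036, 4876292, 4876548, 4876100,
     4876612, 10991171, 10266180, 6339138, 6343234, 7647394, 9748642, 12107939, 4883460,
     4884228, 4884484, 4884740, 4884292, 4884804, 10991683, 10266692, 8436290, 8440386,
     7647394, 9748642, 12107939, 2966, 10158340, 10158596, 10158852, 10159108, 10159620,
     10159876, 10160132, 10158868, 10159380, 10159636, 10159892, 10160148, 10159412, 10159668,
     10159700, 10160468, 8042756, 45345, 45377, 9546498, 1073842, 1065906, 1074354,
     1082546, 7381426, 8040708, 1810946, 11707394, 1067810, 1090226, 2139314, 762385,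
     11707410, 1811266, 1812034, 1812546, 2918, 11978003, 11978035, 11979331, 11979091, 2630,
     3158, 10162436, 10162948, 10163972, 10164228, 10162708, 10163220, 10163476, 10163988,
     10163748, 10163252, 10164020, 10164276, 10163780, 10164036, 10164292, 10164052, 8042772,
     111105, 111617, 2185986, 9480978, 1077938, 1070258, 7446706, 7381938, 3188914,
     8041220, 763649, 12036098, 7381682, 7382194, 7382450, 763010, 762930, 3909186,
     762369, 11707394, 11707650, 762962, 2630, 10799379, 2918, 11940099, 11948291, 11979027,
     10179076, 10179588, 10179844, 10180868, 10179348, 10179860, 10180372, 10180884, 10179364,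
     10179876, 10179892, 10180660, 10179908, 10180420, 10180180, 10180436, 10180692, 10180452,
     10180724, 8042836, 8040964, 8041476, 2860290, 762450, 9481042, 5286322, 242193,
     2312978, 5325746, 7709106, 8041748, 7447730, 7448242, 7448754, 764177, 12165906,
     2860114, 1812530, 3908994, 763473, 368929, 370209, 370721, 1395234, 5390754, 5399714,
     5407906, 1811266, 2630, 10798083, 3158, 12915715, 12923907, 12936195, 2918, 7020804,
     7021060, 7021316, 7021572, 7022084, 7022340, 7022852, 7021844, 7022100, 7022868,
     7021604, 7022372, 7022884, 7021892, 7022404, 7022916, 7022420, 8042020, 12174883,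
     6335266, 6343458, 2139826, 7512242, 9617586, 8041220, 3908610, 2139314, 2147506,
     7382450, 763393, 11968770, 11970306, 6332850, 762994, 12175619, 763153, 1811538,
     770450, 1819794, 10209090, 12044866, 2630, 10760964, 10772739, 10781443, 7024900,
     7025412, 7026180, 7026436, 7025428, 7025940, 7026196, 7025444, 7025716, 7025972,
     7026484, 7026260, 8042036, 12174899, 12173571, 6335282, 6343474, 3188402, 3196594,
     7577778, 8041220, 763393, 11968770, 1820162, 771426, 6332850, 762642, 12174611,
     12174115, 2868274, 11846962, 2630, 10748164, 10760964, 10769171, 10772739, 10781443, 3158,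
     7028996, 7029508, 7029764, 7030276, 7030532, 7031044, 7030036, 7030292, 7031060,
     7030084, 7030596, 7031108, 7030612, 8042052, 12174915, 8041220, 6335298, 6343490,
     4236978, 7643314, 8041476, 763393, 11970306, 6332850, 762994, 7382450, 12175619,
     763153, 1811538, 770450, 1819794, 10209090, 12044866, 2630, 10760964, 10781443, 7033860,
     7034116, 7034372, 7034628, 7035140, 7033636, 7034404, 7034660, 7034916, 7033908,
     7034676, 7035188, 7034180, 7034436, 7034692, 7034948, 7035204, 7034708, 7035220,
     7034996, 8042068, 12174931, 8041476, 6335314, 6343506, 5285554, 7708850, 9814194,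
     7381682, 7381938, 7382194, 7383218, 9487282, 9487538, 12174115, 763425, 11969314,
     11970594, 2860162, 2860082, 2868274, 3908930, 3918402, 763457, 2630, 8757507, 8757763,
     8758787, 8759299, 8758291, 8758803, 8758307, 8758819, 8759331, 8758595, 8758851,
     8759363, 41989, 1341954, 1079874, 42823, 42821, 498242, 301682, 41733, 1276418,
     1079858, 4201074, 42823, 1276418, 1284610, 1079858, 2678, 10948868, 10953220, 10969347,
     10989827, 10990339, 10991363, 10991619, 10991875, 10991651, 10991411, 10992179, 10990915,
     10991427, 10991683, 10991939, 10992275, 2950, 12109827, 12110595, 2630, 4863284, 4864340,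
     701746, 701842, 2902, 11866372, 11886851, 10799187, 10799731, 10799987, 10799747,
     10799763, 10800019, 832898, 570818, 11892930, 11901122, 821873, 13285490, 8165538,
     474290, 8160178, 13276546, 466050, 13193602, 47191, 10989827, 10990083, 10990339,
     10990595, 10991107, 10991875, 10992131, 10990611, 10991123, 10991139, 10992179, 10990915,
     10991171, 10991427, 10992195, 10992275, 2918, 11940612, 11948547, 11976963, 11977219,
     11977475, 11978243, 11979011, 11979523, 11979539, 11978051, 11979587, 2630, 4862740,
     4864020, 4864276, 4863284, 4863540, 4864052, 10763060, 10762323, 4864100, 4864356,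
     4864388, 700722, 9064754, 1750578, 8606114, 677905, 1729922, 1742210, 700818,
     1750674, 701746, 312242, 10139746, 770834, 1819954, 770914, 3917922, 6670722,
     574866, 3158, 12914948, 3206, 13107460, 13115908, 13124355, 10799635, 4901652, 10799187,
     10799699, 4901732, 10799731, 10799987, 10799747, 10799763, 10800035, 12349858, 12358050,
     12218818, 733602, 1799842, 3247011, 11318658, 9222738, 12350882, 12359074, 7047074,
     1739890, 8006786, 494098, 10994450, 8868258, 678161, 11109650, 100914, 1755186,
     51287, 42823, 10748164, 8761603, 8761859, 8762627, 8763395, 8762899, 8762915, 8763427,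
     8762691, 8762947, 8763459, 34389, 570962, 562530, 431490, 374402, 8821586,
     8756066, 45861, 236322, 170802, 5376914, 47463, 2966, 12124420, 12128516, 12165379,
     12165635, 12167171, 12166467, 12166723, 12167235, 12167507, 2678, 10948868, 10953220,
     10965507, 10969347, 10979332, 10993923, 10995011, 10996051, 2630, 10748164, 4862724,
     4863284, 10994739, 4246066, 10994435, 705842, 3158, 12914948, 12935427, 12173571,
     12174115, 12175395, 12174659, 12174915, 12175427, 12174931, 12175443, 3158, 12914948,
     12923684, 6058756, 12941395, 2104370, 1084466, 464258, 51287, 12951811, 12952355,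
     12952899, 12953155, 12953667, 6072900, 12953683, 2630, 10748164, 4862740, 4864020,
     4863284, 4864052, 10763427, 2801970, 1755186, 8606114, 677906, 51287, 10795091,
     562530, 374402, 8756066, 47463, 9871619, 9871875, 9872387, 9872643, 9872899,
     9873667, 9872915, 9872419, 9872675, 9872707, 30277, 9872499, 42823, 497218, 300658,
     9872499, 631906, 4826978, 41733, 1276418, 1079858, 4201074, 42823, 1079858, 2678,
     10948868, 10953220, 10965507, 8030228, 8029988, 8030244, 8030500, 8029236, 8029748,
     8030516, 10978883, 8030308, 8030596, 9659042, 681761, 10982946, 2778002, 2630, 10793219,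
     10795027, 10794275, 10795043, 10795107, 10795395, 2134, 8741123, 5805364, 8756100, 47191,
     2950, 12058884, 10794515, 10795299, 10795363, 47463, 10989827, 10990083, 10990339, 10991459,
     2950, 12058884, 12067332, 12075779, 12083459, 12096259, 12108291, 12108547, 12109667, 3174,
     12984836, 12989188, 12993283, 12997123, 10989827, 10990083, 10990339, 10990851, 10991875,
     10992179, 10991171, 10991427, 10991971, 10992227, 2918, 11936260, 11940612, 11948547,
     7047172, 7047220, 11962723, 7047556, 8426418, 534162, 47463, 11976963, 11977219,
     11977987, 11978307, 11978563, 11979587, 11979107, 11979363, 11979379, 11979683, 2630,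
     4862740, 4862756, 4864292, 10762595, 700722, 1749554, 10729762, 47463, 4883220,
     4884500, 4884532, 10783587, 10783843, 10783859, 10783923, 700722, 1751090, 3848210,
     7061890, 2134, 8741123, 5797172, 8748164, 51287, 3206, 13107460, 13115908, 8763444,
     8764548, 51287, 10799459, 9875715, 9875971, 9876483, 9876995, 9877763, 9877011,
     9877779, 9876515, 9876803, 2950, 12058884, 12067332, 12076036, 9138948, 9139972,
     9140260, 9140516, 9139764, 9140532, 9140036, 9140324, 9659058, 747553, 12097058,
     154514, 2843538, 2844050, 2902, 11866372, 11875076, 11904771, 11904035, 11904835, 42823,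
     11912707, 11913507, 11913571, 51559, 12099843, 12100099, 12100611, 12101123, 12101891,
     12101907, 12100931, 2678, 10948868, 10953220, 10965507, 10969347, 10994179, 10995203,
     10995971, 2630, 4862724, 4863748, 4862740, 4864020, 4862756, 4864036, 4864292,
     4864052, 4864308, 4864340, 4864372, 4864388, 9151540, 10994739, 4241970, 4246066,
     10994435, 3852034, 704818, 1753650, 8630690, 3258786, 8499874, 701218, 10733858,
     2799922, 701842, 9877668, 8612770, 748177, 12215186, 12215698, 11101618, 10995811,
     620194, 706162, 2902, 11866372, 11875108, 11892307, 509282, 3174, 12984836, 12989188,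
     12993283, 11913571, 51559, 10772739, 12108035, 12108291, 12108803, 12109315, 12110083,
     12109331, 12110099, 3222, 13193731, 13213955, 13215235, 13216003, 10267140, 13215251,
     13216019, 10267156, 3174, 12984836, 7090948, 7091972, 7092228, 12990979, 12990995,
     7092020, 7092276, 7092068, 7092324, 7092340, 9160244, 12822274, 6339634, 829234,
     8630466, 3192770, 3174818, 6929524, 6929540, 8894914, 9481154, 10201026, 12687266,
     9980530, 42823, 12993540, 12997123, 7107332, 7108356, 7108612, 13007379, 7108404,
     7108708, 7108724, 9160548, 1876738, 829234, 6339698, 7386818, 8892610, 833537,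
     6929540, 8894914, 759650, 7063922, 432050, 9456498, 10177650, 12018882, 13333602,
     9481154, 12626098, 11586178, 12621986, 9217938, 6923378, 42823, 7647491, 7647747,
     7648771, 7647763, 7648275, 7649043, 7648291, 7648547, 7649059, 2950, 12058884,
     12067332, 12083459, 9147140, 9148164, 9148676, 9148708, 9147444, 9148212, 9148724,
     9148740, 9148788, 7553202, 7648004, 739073, 12030978, 2120562, 738162, 742514,
     7361714, 1790786, 3904834, 2902, 11866372, 11875076, 11886851, 11904771, 11904035,
     11904835, 42823, 11911939, 11912707, 11913507, 11913523, 11913027, 11913539, 11913587, 2406,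
     9847812, 9851395, 6911540, 9862292, 51559, 9871619, 9871875, 9872387, 9872915,
     9872419, 9872707, 2630, 4862724, 4862740, 4864020, 4864036, 4864292, 4864052,
     4864308, 4865172, 9872436, 4221490, 3245730, 9659042, 682017, 11048482, 2778002,
     2803346, 51559, 4883204, 2134, 8741123, 2678, 10948868, 10953220, 10994435, 4900676,
     42823, 12099843, 12100099, 12100627, 12101395, 12101411, 2678, 10965507, 10969347, 8033028,
     8034052, 8034100, 8034356, 8034420, 9152884, 239617, 9484914, 8892578, 7647396,
     7649924, 1788274, 12166258, 673793, 11039746, 42823, 10994707, 10996243, 10995491,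
     10996259, 2630, 10748164, 4862740, 4864020, 4864276, 10763283, 4864036, 4864052,
     4864308, 4864068, 4864388, 9151540, 10733586, 4307506, 3257506, 8630690, 3258786,
     9151252, 702481, 1749634, 1749890, 1750146, 702737, 1749906, 4700804, 7932546,
     10006690, 10008482, 1798978, 3901250, 3909442, 1340338, 3177284, 4946482, 723521,
     12202050, 12218434, 7457698, 1820834, 10602674, 7408434, 10647746, 11060082, 7651378,
     2577458, 218946, 4437362, 1529922, 2134, 8741123, 8747028, 5798740, 47191, 8753940,
     8756020, 219921, 2902, 11886851, 11911939, 8767508, 8768388, 47191, 10768899, 10772739,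
     4888852, 4887604, 4888644, 9152836, 4307602, 9548962, 1749826, 702529, 1800514,
     12158786, 12166978, 3177284, 12087362, 42823, 12108035, 12108291, 12108307, 12108819,
     12109587, 12109091, 12109603, 3222, 13172996, 13177092, 13189651, 13193731, 13203220,
     13213955, 13214211, 13214739, 13215011, 13215523, 2630, 10748164, 4862740, 4864276,
     4862756, 4864036, 4864292, 4864308, 10265652, 4311602, 9683362, 9552546, 9159332,
     702754, 11121442, 2902, 11866372, 11875108, 11886851, 11899683, 11905572, 10768899,
     10772739, 4883220, 4884500, 4884756, 4883508, 4884532, 4884804, 4884868, 10266692,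
     10265364, 3852306, 1753986, 4311682, 10011042, 9159076, 702738, 11121426, 1751090,
     12827266, 8631458, 1751362, 11121474, 11122754, 4291250, 752193, 12224322, 3177284,
     12087362, 42823, 7647491, 7647747, 7648515, 7647763, 7648275, 7649043, 7648291,
     7649059, 2966, 12124420, 12128516, 12145155, 10191620, 10192644, 10192900, 10192916,
     10191924, 10192692, 10192948, 10192964, 10193012, 7553202, 7648004, 739073, 12026882,
     1076082, 738162, 746610, 7365810, 1794882, 3900994, 2918, 11936260, 11940612,
     11948547, 11970307, 11969555, 11970371, 42823, 11977475, 11977987, 11978771, 11978803,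
     11978563, 11978819, 11978867, 2134, 8733700, 8741123, 5797172, 8748164, 51287, 8757507,
     8757763, 8758275, 8758291, 8758851, 2630, 4862724, 4864020, 4864052, 4865156,
     8758324, 4217394, 8606114, 677905, 1725314, 1754498, 51287, 4887300, 2406, 9851395,
     2678, 10948868, 10953220, 10994435, 4900676, 42823, 12165379, 12165635, 12166163, 12166931,
     12166179, 12166947, 2678, 10965507, 10969347, 8028932, 8029956, 8030004, 8030516,
     8030580, 10201204, 239873, 8436338, 9941154, 7647396, 7649940, 1788018, 12100722,
     674049, 11105282, 42823, 10993923, 10995475, 10996243, 10994723, 10995491, 10996259, 2630,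
     10748164, 4862740, 4864020, 4864276, 10763299, 4864052, 4864308, 4864068, 4864324,
     4864388, 10200116, 4307506, 3257506, 9679266, 3258530, 2202674, 4700804, 4700820,
     7867026, 10006690, 10008482, 1798978, 1340338, 3177284, 4946482, 723521, 12202050,
     7457698, 1821090, 7408434, 8112290, 10582466, 7560338, 10647746, 11060082, 7651378,
     3158, 12914948, 12923652, 12927747, 12935427, 12956419, 10768899, 10772739, 4884500,
     4884756, 4883508, 4884804, 4884868, 10201156, 4307586, 8500386, 10006946, 702737,
     1750162, 1751186, 1749826, 4700820, 7867026, 9089170, 1800258, 12101442, 1341618,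
     8680370, 7408434, 3177284, 739585, 3767042, 12153858, 42823, 12173571, 12173827,
     12174595, 12173843, 12174355, 12175123, 12175139, 3206, 13107460, 13115908, 13124115,
     13132035, 13137684, 13148419, 13148675, 13149203, 13149971, 2630, 10748164, 4862740,
     4864020, 4864276, 4864036, 4864052, 4864308, 4864388, 9217076, 4311602, 8634786,
     3262882, 9216788, 706577, 1753730, 1753986, 706833, 1754002, 10209444, 8633506,
     10729666, 10138562, 10138050, 832274, 12826642, 4699076, 2317426, 2134, 8733203,
     8741123, 8747028, 5798996, 51287, 8753940, 8754228, 8756276, 220177, 246866, 3158,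
     12935427, 8763412, 8764548, 51287, 10768899, 10772739, 4888852, 4887604, 4888964,
     9218372, 4311698, 9553058, 10209444, 4701332, 10208452, 10209604, 5028498, 13285266,
     10269858, 9026722, 11122626, 771905, 13342530, 13346626, 1641330, 12140658, 42823]),
   ([1, 2, 3, 1, 3, 2, 1],
    [2179331, 2179587, 2179859, 2179875, 151811, 152323, 152579, 152083, 152595,
     152355, 1073667, 1073923, 1074179, 1074435, 1073683, 1073939, 1074195, 1074451,
     1074211, 1074467, 3174659, 3174915, 3175683, 3175939, 3174931, 3175187, 3175443,
     3175955, 3175203, 3175459, 3175715, 3175731, 3175987, 3244291, 3244547, 3244803,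
     3245315, 3245571, 3245827, 3244563, 3245075, 3245587, 3245843, 3244835, 3245091,
     3245347, 3245859, 3245107, 3245619, 3245875, 3245923, 3313923, 3314179, 3314435,
     3314947, 3315203, 3315459, 3315715, 3314195, 3314707, 3315219, 3315475, 3315731,
     3314723, 3314979, 3315747, 3314739, 3314995, 3315507, 3315539, 2390, 9769220,
     9781779, 9789699, 9798403, 9806083, 9806339, 9806595, 9807363, 9807619, 9807875,
     9806867, 9807379, 9807907, 9807667, 2150, 8790532, 8798739, 8802819, 8819459,
     8823555, 8827651, 8828675, 8828931, 8829443, 8827667, 8828723, 8828979, 2678,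
     10948868, 10953220, 10969347, 10978051, 10990339, 10993923, 10994435, 10995203, 10995715,
     10996227, 10996483, 10994707, 10995219, 10995747, 10995507, 10996275, 2630, 10748164,
     10760964, 4862740, 4864020, 10763316, 1074226, 311602, 312882, 313394, 10733586,
     3245762, 51303, 10772739, 10781444, 10782724, 10783748, 4883220, 4883508, 4884532,
     1074226, 10535986, 3180098, 3196482, 4207042, 4219842, 1755186, 4442210, 51303,
     10793732, 10795012, 10795524, 10795780, 10796036, 4895508, 10794804, 4896820, 1074226,
     1094706, 3180098, 11576130, 1076290, 704818, 1754162, 1755186, 7652914, 4442210,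
     51303, 9810179, 9810435, 9810691, 9811459, 9811715, 9811971, 9812227, 9810963,
     9811475, 9810723, 9812003, 9811251, 9811763, 9812275, 45845, 232210, 92978,
     101170, 3245746, 47207, 243473, 232210, 101170, 2181938, 3245234, 3246002, 47205,
     25909, 230754, 2150, 8790532, 8798739, 8819459, 8823043, 8823299, 8823555, 8824067,
     8824579, 8825091, 8825603, 8825107, 8823843, 8824099, 8824627, 2678, 10948868,
     10953220, 10965507, 10982147, 10990339, 10994179, 10994435, 10994947, 10995971, 10996227,
     10996483, 10995987, 10994723, 10994979, 10996275, 2630, 10748164, 10760964, 4862756,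
     4864292, 10763316, 2118706, 311858, 312626, 313650, 10733858, 3315138, 51543,
     10768899, 10785540, 10787076, 10787844, 4887332, 4887604, 4888884, 2118706, 10535986,
     3183938, 3196226, 4207298, 4215746, 2804018, 4442450, 51543, 10793732, 10795268,
     10796036, 4895524, 4895796, 4897076, 2118706, 10535986, 3183938, 3196226, 4207298,
     4215746, 2804018, 4442450, 51543, 8831747, 8831763, 2950, 12099843, 12100099, 12100371,
     12100627, 12101395, 12101683, 9153076, 12101699, 9153092, 2630, 10748164, 10760980,
     10768899, 10772739, 4888852, 4887332, 9811108, 4282786, 1182258, 11688498, 3766866,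
     2678, 10953220, 10969347, 10994435, 10797843, 374322, 47207, 534194, 47207]),
   ([1, 2, 3, 1, 3, 2, 2],
    [2179331, 2179587, 2179859, 2179875, 151811, 152323, 152579, 152083, 152595,
     152355, 1073667, 1073923, 1074179, 1074435, 1073683, 1073939, 1074195, 1074451,
     1074211, 1074467, 3174659, 3174915, 3175683, 3175939, 3174931, 3175187, 3175443,
     3175955, 3175203, 3175459, 3175715, 3175731, 3175987, 3244291, 3244547, 3244803,
     3245315, 3245571, 3245827, 3244563, 3245075, 3245587, 3245843, 3244835, 3245091,
     3245347, 3245859, 3245107, 3245619, 3245875, 3245923, 3313923, 3314179, 3314435,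
     3314947, 3315203, 3315459, 3315715, 3314195, 3314707, 3315219, 3315475, 3315731,
     3314723, 3314979, 3315747, 3314739, 3314995, 3315507, 3315539, 2390, 9769220,
     9781779, 9789699, 9798403, 9810179, 9810435, 9810691, 9811459, 9811715, 9811971,
     9810963, 9811475, 9812003, 9811763, 2150, 8790532, 8798739, 8802819, 8819459,
     8823555, 8824579, 8824835, 8825603, 8823571, 8824627, 8824883, 2934, 11997444,
     12001796, 12017923, 12026627, 12034819, 12042499, 12043011, 12043779, 12044291, 12044803,
     12045059, 12043283, 12043795, 12044323, 12044083, 12045107, 2886, 11796740, 11809540,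
     4928276, 4929556, 11811892, 1074226, 311602, 312882, 313394, 11782162, 3245762,
     51303, 11821315, 11830020, 11831300, 11832324, 4948756, 4949044, 4950068, 1074226,
     11584562, 3180098, 3196482, 4207042, 4219842, 1820722, 4442210, 51303, 11838212,
     11839492, 11840004, 11840260, 11840516, 4956948, 11839284, 4958260, 1074226, 1090610,
     3180098, 10531650, 1076290, 770354, 1819698, 1820722, 7652914, 4442210, 51303,
     8827651, 9810179, 9810435, 9810691, 9811459, 9811715, 9811971, 9812227, 9810963,
     9811475, 9810723, 9812003, 9811251, 9811763, 9812275, 45845, 232210, 92978,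
     101170, 3245746, 47207, 243473, 232210, 101170, 2181938, 3245234, 3246002, 47205,
     25909, 230754, 2150, 8790532, 8798739, 8819459, 8823555, 8823571, 2950, 12108035,
     12108291, 12108563, 12108819, 12109587, 12110643, 12110659, 3142, 12845316, 12858132,
     12866051, 12869891, 5019924, 5018404, 9811140, 4282818, 1182770, 11689010, 3767378,
     3190, 13050372, 13066499, 13083395, 12886803, 8831235, 8831491, 8831747, 8832259,
     8832771, 8833283, 8833795, 8833299, 8832035, 8832291, 8832819, 3190, 13046020,
     13050372, 13062659, 13079299, 13083139, 13083395, 13083907, 13084419, 13084931, 8169988,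
     13085443, 13084947, 13083683, 13083939, 13084467, 8170036, 3142, 12845316, 12858116,
     4993828, 4995364, 12859956, 2118706, 303666, 304434, 305458, 12822818, 3315106,
     43351, 12866051, 12882692, 12884228, 12884484, 5018404, 5018676, 5019956, 2118706,
     12624946, 3183938, 3188034, 4207266, 4215714, 2926898, 4434258, 43351, 12890884,
     12892420, 12892676, 5026596, 5026868, 5028148, 2118706, 12624946, 3183938, 3188034,
     4207266, 4215714, 2926898, 4434258, 43351, 13087491, 374322, 47207, 534194, 47207]),
   ([1, 2, 3, 2, 1, 1],
    [2179859, 2179875, 3244547, 3244803, 3245075, 3244835, 3245091, 3245107, 3315715,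
     3314723, 3315763, 3315779, 38983]),
   ([1, 2, 3, 2, 3, 1, 1],
    [2179331, 2179587, 2179859, 2179875, 151811, 152323, 152579, 152083, 152355,
     152611, 1073667, 1073923, 1074435, 1073683, 1073939, 1074211, 1074467, 3174659,
     3174915, 3175683, 3175939, 3174931, 3175187, 3175443, 3175955, 3175203, 3175459,
     3175715, 3175731, 3175987, 3244291, 3244547, 3244803, 3245315, 3245827, 3244563,
     3245091, 3245347, 3245107, 3245875, 3245923, 3313923, 3314179, 3314435, 3314947,
     3314451, 3315475, 3314979, 3315491, 3314739, 3315779, 3315539, 2374, 9699588,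
     9720323, 9724163, 9728787, 9745667, 9745171, 9746195, 9745187, 9745699, 9746211,
     9745459, 2150, 8790532, 8798739, 8802819, 8819459, 8823043, 8823299, 8823555,
     8824067, 8824579, 8823843, 8824099, 8824627, 2630, 10748164, 10760964, 10761988,
     4862756, 10762036, 4864820, 1355826, 2118706, 304434, 309042, 3454722, 2798898,
     3175858, 46935, 10768899, 10777348, 10778372, 4879140, 10778420, 10779188, 1355826,
     2118706, 304434, 309042, 309810, 3454722, 2798898, 3175858, 46935, 10797571,
     10799651, 1878, 7672068, 7684627, 7692547, 7701251, 7709443, 7717635, 7718659,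
     7719427, 7717667, 7718691, 5753380, 7719715, 7718707, 2139074, 10797828, 3950338,
     2116722, 2141298, 803698, 10961090, 10503106, 4373554, 3323842, 2930034, 5027634,
     46935, 8827667, 9745171, 9745187, 1878, 7672068, 7684627, 7692547, 7701251, 7709443,
     2150, 8790532, 8798739, 8802819, 8819459, 8823555, 8831235, 8831491, 8831747,
     8831507, 8831763, 3190, 13046020, 13050372, 13058579, 13079299, 13087507, 7713571])]

lemma pointInTriangleConfig_blockers_closed {x : List ℕ × List ℕ} (hx : x ∈ blockerCertificates) :
    (pointInTriangleConfig x.1 [(4, 1, 2), (5, 2, 0), (6, 0, 1), (7, 0, 3), (8, 1, 3), (9, 2, 3)]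
      [4, 3, 3, 3] false).Closed :=
  have h : ∀ x ∈ blockerCertificates, (pointInTriangleConfig x.1 [(4, 1, 2), (5, 2, 0), (6, 0, 1),
      (7, 0, 3), (8, 1, 3), (9, 2, 3)] [4, 3, 3, 3] false).check [] x.2 = true := by decide +kernel
  Config.closed_of_check (h x hx) (by simp)

/-- If the other colours occur at most three times, then they occur at most twice. -/
lemma pointInTriangleConfig_closed_of_need :
    (pointInTriangleConfig [] [] [4, 3, 3, 3] true).Closed :=
  Config.closed_of_check (L := blockerCertificates.map fun x => pointInTriangleConfig x.1
      [(4, 1, 2), (5, 2, 0), (6, 0, 1), (7, 0, 3), (8, 1, 3), (9, 2, 3)] [4, 3, 3, 3] false)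
    (by decide +kernel)
    (List.forall_mem_map.2 fun _ hx => pointInTriangleConfig_blockers_closed hx) (ts :=
    [534, 2179859, 2179875, 38, 262, 774, 3162643, 790, 3232259, 806, 3301635,
     175776974640219488265, 175776974640219488281, 806, 3301635, 158478929882041614361,
     140099757326461894681, 790, 3232259, 806, 3301635, 140099757326477623321,
     158478929882025885721, 806, 3301635, 175776974640203759641, 175776974640203759625, 1073923,
     1073939, 774, 3162643, 790, 3232259, 806, 3301635, 175776974640219488297,
     175776974640219488313, 806, 3301635, 175776974640219488329, 175776974640219488345, 3175939,
     3174931, 3175187, 3175955, 3175203, 3175987, 790, 3232259, 806, 3301635,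
     174695846842833371177, 174695846842833371193, 3245587, 3245859, 3245875, 3245923, 34663,
     806, 3301635, 175776974640219488393, 175776974640219488409, 8, 3127256026433747746985, 790,
     3232259, 806, 3301635, 174695846842833371209, 174695846842833371225, 806, 3301635,
     174695846842833371273, 174695846842833371289, 8, 3126174898636361629865, 806, 3301635,
     175776974640219488473, 8, 3127256026433747747049, 175776974640219488537, 1073923, 1073939, 774,
     3162643, 790, 3232259, 806, 3301635, 175776974640203759705, 175776974640203759689, 806,
     3301635, 175776974640203759673, 175776974640203759657, 790, 3232259, 806, 3301635,
     174695846842817642585, 174695846842817642569, 806, 3301635, 175776974640203759833,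
     175776974640203759897, 8, 3127256026433732018409, 806, 3301635, 174695846842817642633, 8,
     3126174898636345901225, 174695846842817642649, 3175939, 3174931, 3175187, 3175955, 3175203,
     3175987, 790, 3232259, 806, 3301635, 174695846842817642553, 174695846842817642537, 806,
     3301635, 175776974640203759753, 8, 3127256026433732018345, 175776974640203759769, 3245587,
     3245859, 3245875, 3245923, 34663, 152323, 152355, 262, 774, 3162643, 790,
     3232259, 806, 3301635, 158478929882041614377, 158478929882041614409, 806, 3301635,
     158478929882041614393, 158478929882041614425, 3175683, 3174931, 3175187, 3175203, 3175715,
     3175731, 790, 3232259, 806, 3301635, 3315475, 3314979, 3315507, 3315539, 38743,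
     158478929882041614473, 806, 3301635, 156316674287269380137, 158478929882041614489, 806,
     3301635, 156316674287269380153, 3315475, 3314979, 3315507, 3315539, 38743, 8,
     3109957981675569873065, 790, 3232259, 806, 3301635, 156316674287269380233,
     158478929882041614553, 806, 3301635, 156316674287269380169, 156316674287269380249, 8,
     3109957981675569873129, 806, 3301635, 156316674287269380185, 8, 3107795726080797638825,
     158478929882041614617, 774, 3162643, 790, 3232259, 806, 3301635, 139018629529090523177,
     140099757326476640409, 806, 3301635, 140099757326476640297, 140099757326476640329, 806,
     3301635, 139018629529090523289, 139018629529090523209, 8, 3091578809120004899065, 790, 3232259,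
     3244547, 3244803, 3245075, 3244835, 3245091, 3245107, 806, 3301635, 3315715,
     3314723, 3315763, 3315779, 38983, 140099757326476640393, 806, 3301635,
     139018629529090523273, 140099757326476640473, 790, 3232259, 3244547, 3244803, 3245075,
     3244835, 3245091, 3245107, 806, 3301635, 3315715, 3314723, 3315763, 3315779, 38983,
     139018629529090523193, 8, 3091578809120004899001, 806, 3301635, 140099757326476640313,
     140099757326476640345, 806, 3301635, 8, 3090497681322618781881, 139018629529090523225,
     140099757326476640537, 1073923, 1073939, 774, 3162643, 790, 3232259, 806, 3301635,
     175776974640219488553, 175776974640219488569, 806, 3301635, 158478929882025886009,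
     140099757326445183289, 8, 3127256026433747747145, 806, 3301635, 158478929882025885993, 8,
     3127256026433747747161, 139018629529058083129, 3175683, 3174931, 3175187, 3175203, 3175715,
     3175731, 790, 3232259, 3244547, 3244803, 3245075, 3244835, 3245091, 3245107, 806,
     3301635, 3315715, 3314723, 3315763, 3315779, 38983, 3315475, 3314979, 3315507,
     3315539, 38743, 8, 3107795726080779944297, 806, 3301635, 174695846842832388393,
     174695846842832388409, 806, 3301635, 8, 3127256026433747747209, 3315475, 3314979, 3315507,
     3315539, 38743, 139018629529058083113, 3175939, 3174931, 3175187, 3175955, 3175203,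
     3175987, 790, 3232259, 3244547, 3244803, 3245075, 3244835, 3245091, 3245107, 806,
     3301635, 3315715, 3314723, 3315763, 3315779, 38983, 8, 3109957981675554144649,
     156316674287251685673, 806, 3301635, 8, 3126174898636360647017, 140099757326445183273,
     156316674287251685689, 3245587, 3245859, 3245875, 3245923, 34663, 152323, 152355, 262,
     774, 3162643, 790, 3232259, 806, 3301635, 158478929882025885785, 158478929882025885753,
     806, 3301635, 158478929882025885769, 158478929882025885737, 790, 3232259, 806, 3301635,
     158478929882025885913, 156316674287253651593, 806, 3301635, 156316674287253651545,
     158478929882025885977, 8, 3107795726080781910185, 806, 3301635, 156316674287253651529, 8,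
     3109957981675554144489, 156316674287253651609, 3175683, 3174931, 3175187, 3175203, 3175715,
     3175731, 790, 3232259, 806, 3301635, 158478929882025885833, 3315475, 3314979, 3315507,
     3315539, 38743, 806, 3301635, 156316674287253651513, 8, 3109957981675554144425, 3315475,
     3314979, 3315507, 3315539, 38743, 806, 3301635, 156316674287253651497,
     158478929882025885849, 1073923, 1073939, 774, 3162643, 790, 3232259, 806, 3301635,
     175776974640203759929, 175776974640203759913, 806, 3301635, 158478929882041614633,
     139018629529059066169, 8, 3127256026433732018521, 806, 3301635, 158478929882041614649, 8,
     3127256026433732018505, 140099757326444200249, 3175939, 3174931, 3175187, 3175955, 3175203,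
     3175987, 790, 3232259, 3244547, 3244803, 3245075, 3244835, 3245091, 3245107, 806,
     3301635, 3315715, 3314723, 3315763, 3315779, 38983, 156316674287268397353, 8,
     3109957981675569873289, 3245587, 3245859, 3245875, 3245923, 34663, 806, 3301635, 8,
     3126174898636343935337, 156316674287268397369, 140099757326444200233, 3175683, 3174931, 3175187,
     3175203, 3175715, 3175731, 790, 3232259, 3244547, 3244803, 3245075, 3244835,
     3245091, 3245107, 806, 3301635, 3315715, 3314723, 3315763, 3315779, 38983, 8,
     3107795726080796655977, 3315475, 3314979, 3315507, 3315539, 38743, 806, 3301635, 8,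
     3127256026433732018569, 139018629529059066153, 3315475, 3314979, 3315507, 3315539, 38743,
     806, 3301635, 174695846842815676713, 174695846842815676729, 774, 3162643, 790, 3232259,
     806, 3301635, 140099757326459928729, 139018629529073811497, 806, 3301635,
     139018629529073811609, 8, 3091578809119988187385, 139018629529073811529, 806, 3301635,
     140099757326459928617, 140099757326459928649, 790, 3232259, 3244547, 3244803, 3245075,
     3244835, 3245091, 3245107, 806, 3301635, 3315715, 3314723, 3315763, 3315779, 38983,
     8, 3091578809119988187321, 139018629529073811513, 806, 3301635, 8, 3090497681322602070201,
     140099757326459928857, 139018629529073811545, 806, 3301635, 140099757326459928633,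
     140099757326459928665, 790, 3232259, 3244547, 3244803, 3245075, 3244835, 3245091,
     3245107, 806, 3301635, 3315715, 3314723, 3315763, 3315779, 38983, 140099757326459928713,
     806, 3301635, 139018629529073811593, 140099757326459928793, 2179859, 2179875, 38, 152323,
     152355, 262, 774, 3162643, 790, 3232259, 3244547, 3244803, 3245075, 3244835,
     3245091, 3245107, 806, 3301635, 3315715, 3314723, 3315763, 3315779, 38983,
     140099757326477623433, 806, 3301635, 139018629529091506313, 140099757326477623513, 790,
     3232259, 806, 3301635, 140099757326477623337, 140099757326477623369, 806, 3301635,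
     139018629529091506217, 140099757326477623449, 806, 3301635, 139018629529091506249,
     139018629529091506329, 8, 3091578809120005882089, 790, 3232259, 806, 3301635,
     140099757326477623353, 140099757326477623385, 3244547, 3244803, 3245075, 3244835, 3245091,
     3245107, 806, 3301635, 139018629529091506233, 3315715, 3314723, 3315763, 3315779, 38983,
     8, 3091578809120005882025, 806, 3301635, 139018629529091506265, 8, 3090497681322619764905,
     140099757326477623577, 774, 3162643, 3175683, 3174931, 3175187, 3175203, 3175715,
     3175731, 790, 3232259, 806, 3301635, 156316674287268397097, 158478929882040631449, 806,
     3301635, 3315475, 3314979, 3315507, 3315539, 38743, 158478929882040631433, 806, 3301635,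
     3315475, 3314979, 3315507, 3315539, 38743, 156316674287268397113, 8, 3109957981675568890041,
     790, 3232259, 806, 3301635, 158478929882040631337, 158478929882040631369, 806, 3301635,
     158478929882040631353, 158478929882040631385, 790, 3232259, 806, 3301635,
     156316674287268397209, 156316674287268397129, 8, 3109957981675568890105, 806, 3301635,
     156316674287268397193, 158478929882040631513, 806, 3301635, 8, 3107795726080796655801,
     156316674287268397145, 158478929882040631577, 1073923, 1073939, 774, 3162643, 3175683,
     3174931, 3175187, 3175203, 3175715, 3175731, 790, 3232259, 806, 3301635,
     174695846842833371433, 174695846842833371449, 3244547, 3244803, 3245075, 3244835, 3245091,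
     3245107, 806, 3301635, 3315475, 3314979, 3315507, 3315539, 38743, 3315715, 3314723,
     3315763, 3315779, 38983, 8, 3090497681322602070377, 806, 3301635, 3315475, 3314979,
     3315507, 3315539, 38743, 8, 3091578809119990153609, 139018629529073811753, 790, 3232259,
     806, 3301635, 140099757326461894969, 158478929882009174329, 8, 3126174898636361630025, 806,
     3301635, 175776974640218505513, 175776974640218505529, 806, 3301635, 8, 3127256026433746764137,
     158478929882009174313, 139018629529073811769, 3175939, 3174931, 3175187, 3175955, 3175203,
     3175987, 790, 3232259, 806, 3301635, 140099757326461894953, 8, 3126174898636361630041,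
     156316674287235957049, 3244547, 3244803, 3245075, 3244835, 3245091, 3245107, 806,
     3301635, 8, 3126174898636361630089, 3315715, 3314723, 3315763, 3315779, 38983,
     156316674287235957033, 3245587, 3245859, 3245875, 3245923, 34663, 262, 1073923, 1073939,
     774, 3162643, 3175939, 3174931, 3175187, 3175955, 3175203, 3175987, 790, 3232259,
     3245587, 3245859, 3245875, 3245923, 34663, 806, 3301635, 174695846842832388137,
     174695846842832388153, 806, 3301635, 175776974640218505369, 175776974640218505353, 8,
     3127256026433746763961, 790, 3232259, 806, 3301635, 175776974640218505257,
     175776974640218505273, 806, 3301635, 175776974640218505289, 175776974640218505305, 790,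
     3232259, 806, 3301635, 174695846842832388249, 174695846842832388233, 8, 3126174898636360646841,
     806, 3301635, 174695846842832388169, 174695846842832388185, 806, 3301635, 8,
     3127256026433746764025, 175776974640218505433, 175776974640218505497, 774, 3162643, 790,
     3232259, 806, 3301635, 175776974640218505225, 175776974640218505241, 806, 3301635,
     158478929882040631321, 140099757326445183001, 790, 3232259, 806, 3301635,
     140099757326476640281, 158478929882009174041, 806, 3301635, 175776974640187047961,
     175776974640187047945, 1073923, 1073939, 774, 3162643, 790, 3232259, 806, 3301635,
     175776974640187048217, 175776974640187048153, 8, 3127256026433715306761, 806, 3301635,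
     174695846842800930905, 174695846842800930889, 806, 3301635, 8, 3126174898636329189577,
     174695846842800930953, 174695846842800930969, 790, 3232259, 806, 3301635,
     175776974640187048025, 175776974640187048009, 806, 3301635, 175776974640187047993,
     175776974640187047977, 3175939, 3174931, 3175187, 3175955, 3175203, 3175987, 790,
     3232259, 806, 3301635, 8, 3127256026433715306697, 175776974640187048073, 175776974640187048089,
     806, 3301635, 174695846842800930873, 174695846842800930857, 3245587, 3245859, 3245875,
     3245923, 34663, 152323, 152355, 262, 1073923, 1073939, 774, 3162643, 3175939,
     3174931, 3175187, 3175955, 3175203, 3175987, 790, 3232259, 3245587, 3245859,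
     3245875, 3245923, 34663, 3244547, 3244803, 3245075, 3244835, 3245091, 3245107, 806,
     3301635, 156316674287269380393, 3315715, 3314723, 3315763, 3315779, 38983, 8,
     3090497681322604036489, 806, 3301635, 156316674287269380409, 8, 3091578809119988187497,
     140099757326459928873, 790, 3232259, 806, 3301635, 139018629529075777849,
     158478929882040631593, 8, 3109957981675568890217, 806, 3301635, 175776974640187048249,
     175776974640187048233, 806, 3301635, 8, 3107795726080797638985, 158478929882040631609,
     140099757326459928889, 3175683, 3174931, 3175187, 3175203, 3175715, 3175731, 790,
     3232259, 806, 3301635, 139018629529075777833, 8, 3107795726080797639049, 3315475, 3314979,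
     3315507, 3315539, 38743, 3244547, 3244803, 3245075, 3244835, 3245091, 3245107, 806,
     3301635, 8, 3107795726080797639001, 3315715, 3314723, 3315763, 3315779, 38983, 3315475,
     3314979, 3315507, 3315539, 38743, 806, 3301635, 174695846842799948089,
     174695846842799948073, 774, 3162643, 790, 3232259, 806, 3301635, 158478929882009174297,
     156316674287236939865, 8, 3107795726080765198537, 806, 3301635, 158478929882009174233,
     156316674287236939913, 806, 3301635, 8, 3109957981675537432841, 156316674287236939849,
     156316674287236939929, 790, 3232259, 806, 3301635, 158478929882009174105,
     158478929882009174073, 806, 3301635, 158478929882009174089, 158478929882009174057, 3175683,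
     3174931, 3175187, 3175203, 3175715, 3175731, 790, 3232259, 806, 3301635, 8,
     3109957981675537432777, 156316674287236939833, 3315475, 3314979, 3315507, 3315539, 38743,
     806, 3301635, 158478929882009174153, 3315475, 3314979, 3315507, 3315539, 38743, 806,
     3301635, 158478929882009174169, 156316674287236939817, 774, 3162643, 790, 3232259, 806,
     3301635, 140099757326444200217, 8, 3090497681322586341577, 139018629529058082905, 3244547,
     3244803, 3245075, 3244835, 3245091, 3245107, 806, 3301635, 8, 3091578809119972458697,
     3315715, 3314723, 3315763, 3315779, 38983, 139018629529058082873, 806, 3301635,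
     140099757326444200025, 140099757326444199993, 790, 3232259, 806, 3301635, 8,
     3091578809119972458761, 139018629529058082969, 139018629529058082889, 806, 3301635,
     140099757326444200089, 139018629529058082857, 806, 3301635, 140099757326444200009,
     140099757326444199977, 790, 3232259, 806, 3301635, 140099757326444200153,
     139018629529058082953, 3244547, 3244803, 3245075, 3244835, 3245091, 3245107, 806,
     3301635, 140099757326444200073, 3315715, 3314723, 3315763, 3315779, 38983, 2179859,
     2179875, 38, 152323, 152355, 262, 774, 3162643, 790, 3232259, 806, 3301635,
     140099757326461894873, 139018629529075777673, 3244547, 3244803, 3245075, 3244835, 3245091,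
     3245107, 806, 3301635, 140099757326461894793, 3315715, 3314723, 3315763, 3315779, 38983,
     790, 3232259, 806, 3301635, 140099757326461894745, 140099757326461894713, 806, 3301635,
     139018629529075777625, 140099757326461894937, 8, 3090497681322604036265, 3244547, 3244803,
     3245075, 3244835, 3245091, 3245107, 806, 3301635, 139018629529075777593, 8,
     3091578809119990153385, 3315715, 3314723, 3315763, 3315779, 38983, 790, 3232259, 806,
     3301635, 140099757326461894729, 140099757326461894697, 806, 3301635, 139018629529075777609, 8,
     3091578809119990153449, 139018629529075777689, 806, 3301635, 139018629529075777577,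
     140099757326461894809, 1073923, 1073939, 774, 3162643, 3175683, 3174931, 3175187,
     3175203, 3175715, 3175731, 790, 3232259, 806, 3301635, 174695846842817642809,
     174695846842817642793, 806, 3301635, 3315475, 3314979, 3315507, 3315539, 38743,
     139018629529090523433, 8, 3091578809120005882249, 3244547, 3244803, 3245075, 3244835,
     3245091, 3245107, 806, 3301635, 3315475, 3314979, 3315507, 3315539, 38743, 8,
     3090497681322618782057, 3315715, 3314723, 3315763, 3315779, 38983, 3175939, 3174931,
     3175187, 3175955, 3175203, 3175987, 790, 3232259, 806, 3301635, 140099757326477623593,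
     156316674287236940089, 8, 3126174898636345901401, 3245587, 3245859, 3245875, 3245923, 34663,
     3244547, 3244803, 3245075, 3244835, 3245091, 3245107, 806, 3301635, 8,
     3126174898636345901449, 156316674287236940073, 3315715, 3314723, 3315763, 3315779, 38983,
     790, 3232259, 806, 3301635, 140099757326477623609, 8, 3126174898636345901385,
     158478929882008191289, 806, 3301635, 8, 3127256026433730052457, 139018629529090523449,
     158478929882008191273, 806, 3301635, 175776974640201793833, 175776974640201793849, 774,
     3162643, 3175683, 3174931, 3175187, 3175203, 3175715, 3175731, 790, 3232259, 806,
     3301635, 158478929882023919769, 156316674287251685417, 806, 3301635, 3315475, 3314979,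
     3315507, 3315539, 38743, 8, 3109957981675552178361, 156316674287251685433, 806, 3301635,
     3315475, 3314979, 3315507, 3315539, 38743, 158478929882023919753, 790, 3232259, 806,
     3301635, 156316674287251685529, 8, 3109957981675552178425, 156316674287251685449, 806, 3301635,
     8, 3107795726080779944121, 158478929882023919897, 156316674287251685465, 806, 3301635,
     156316674287251685513, 158478929882023919833, 790, 3232259, 806, 3301635,
     158478929882023919657, 158478929882023919689, 806, 3301635, 158478929882023919673,
     158478929882023919705, 152323, 152355, 262, 1073923, 1073939, 774, 3162643, 3175939,
     3174931, 3175187, 3175955, 3175203, 3175987, 790, 3232259, 3245587, 3245859,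
     3245875, 3245923, 34663, 806, 3301635, 156316674287253651769, 140099757326476640553, 8,
     3091578809120004899177, 3244547, 3244803, 3245075, 3244835, 3245091, 3245107, 806,
     3301635, 156316674287253651753, 8, 3090497681322619765129, 3315715, 3314723, 3315763,
     3315779, 38983, 3175683, 3174931, 3175187, 3175203, 3175715, 3175731, 790, 3232259,
     806, 3301635, 139018629529091506473, 3315475, 3314979, 3315507, 3315539, 38743, 8,
     3107795726080781910409, 806, 3301635, 174695846842800931129, 174695846842800931113, 3244547,
     3244803, 3245075, 3244835, 3245091, 3245107, 806, 3301635, 8, 3107795726080781910361,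
     3315475, 3314979, 3315507, 3315539, 38743, 3315715, 3314723, 3315763, 3315779, 38983,
     790, 3232259, 806, 3301635, 139018629529091506489, 8, 3109957981675552178537,
     158478929882023919913, 806, 3301635, 8, 3107795726080781910345, 140099757326476640569,
     158478929882023919929, 806, 3301635, 175776974640186065209, 175776974640186065193, 774,
     3162643, 790, 3232259, 806, 3301635, 140099757326445183257, 139018629529059065945, 8,
     3090497681322587324617, 806, 3301635, 140099757326445183065, 140099757326445183033, 3244547,
     3244803, 3245075, 3244835, 3245091, 3245107, 806, 3301635, 8, 3091578809119973441737,
     139018629529059065913, 3315715, 3314723, 3315763, 3315779, 38983, 790, 3232259, 806,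
     3301635, 140099757326445183193, 139018629529059065993, 3244547, 3244803, 3245075, 3244835,
     3245091, 3245107, 806, 3301635, 140099757326445183113, 3315715, 3314723, 3315763,
     3315779, 38983, 790, 3232259, 806, 3301635, 8, 3091578809119973441801,
     139018629529059065929, 139018629529059066009, 806, 3301635, 140099757326445183049,
     140099757326445183017, 806, 3301635, 140099757326445183129, 139018629529059065897, 774,
     3162643, 790, 3232259, 806, 3301635, 158478929882008191257, 8, 3107795726080764215497,
     156316674287235956825, 806, 3301635, 8, 3109957981675536449801, 156316674287235956889,
     156316674287235956809, 806, 3301635, 158478929882008191193, 156316674287235956873, 3175683,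
     3174931, 3175187, 3175203, 3175715, 3175731, 790, 3232259, 806, 3301635, 8,
     3109957981675536449737, 3315475, 3314979, 3315507, 3315539, 38743, 156316674287235956793,
     806, 3301635, 158478929882008191129, 156316674287235956777, 806, 3301635,
     158478929882008191113, 3315475, 3314979, 3315507, 3315539, 38743, 790, 3232259, 806,
     3301635, 158478929882008191065, 158478929882008191033, 806, 3301635, 158478929882008191049,
     158478929882008191017, 262, 1073923, 1073939, 774, 3162643, 3175939, 3174931, 3175187,
     3175955, 3175203, 3175987, 790, 3232259, 3245587, 3245859, 3245875, 3245923, 34663,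
     806, 3301635, 175776974640201793689, 8, 3127256026433730052281, 175776974640201793673, 806,
     3301635, 174695846842815676457, 174695846842815676473, 790, 3232259, 806, 3301635,
     174695846842815676569, 8, 3126174898636343935161, 174695846842815676553, 806, 3301635, 8,
     3127256026433730052345, 175776974640201793817, 175776974640201793753, 806, 3301635,
     174695846842815676489, 174695846842815676505, 790, 3232259, 806, 3301635,
     175776974640201793577, 175776974640201793593, 806, 3301635, 175776974640201793609,
     175776974640201793625, 1073923, 1073939, 774, 3162643, 790, 3232259, 806, 3301635,
     175776974640186065177, 8, 3127256026433714323721, 175776974640186065113, 806, 3301635, 8,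
     3126174898636328206537, 174695846842799947929, 174695846842799947913, 806, 3301635,
     174695846842799947865, 174695846842799947849, 3175939, 3174931, 3175187, 3175955, 3175203,
     3175987, 790, 3232259, 806, 3301635, 8, 3127256026433714323657, 175776974640186065049,
     175776974640186065033, 3245587, 3245859, 3245875, 3245923, 34663, 806, 3301635,
     174695846842799947833, 174695846842799947817, 790, 3232259, 806, 3301635,
     175776974640186064985, 175776974640186064969, 806, 3301635, 175776974640186064953,
     175776974640186064937, 774, 3162643, 790, 3232259, 806, 3301635, 175776974640201793545,
     175776974640201793561, 806, 3301635, 158478929882023919641, 140099757326444199961, 790,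
     3232259, 806, 3301635, 140099757326459928601, 158478929882008191001, 806, 3301635,
     175776974640186064921, 175776974640186064905])

/-- If the other colours occur at most twice, then they occur at least twice. -/
lemma pointInTriangleConfig_closed_of_le_one :
    (pointInTriangleConfig [] [] [4, 2, 2, 1] false).Closed :=
  Config.closed_of_check (L := []) (by decide +kernel) (by simp) (ts :=
    [262, 518, 774, 3170835, 534, 790, 3232259, 806, 3293443, 790, 3232259, 806,
     3293443, 3170835, 534, 790, 3232259, 806, 3293443, 774, 3170835, 534, 790,
     3232259, 806, 3293443, 790, 3232259, 806, 3293443, 3170835, 534, 790, 3232259,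
     806, 3293443, 790, 3232259, 806, 3293443, 3170835, 534, 790, 3232259, 806,
     3293443, 790, 3232259, 806, 3293443, 774, 3170835, 534, 790, 3232259, 806,
     3293443, 3170835, 534, 790, 3232259, 806, 3293443, 790, 3232259, 806, 3293443,
     518, 774, 3170835, 534, 790, 3232259, 806, 3293443, 790, 3232259, 806,
     3293443, 3170835, 534, 790, 3232259, 806, 3293443, 790, 3232259, 806, 3293443,
     3170835, 534, 790, 3232259, 806, 3293443, 790, 3232259, 806, 3293443, 774,
     3170835, 534, 790, 3232259, 806, 3293443, 790, 3232259, 806, 3293443, 3170835,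
     534, 790, 3232259, 806, 3293443, 774, 3170835, 534, 790, 3232259, 806,
     3293443, 790, 3232259, 806, 3293443, 3170835, 534, 790, 3232259, 806, 3293443,
     518, 774, 3170835, 534, 790, 3232259, 806, 3293443, 3170835, 534, 790,
     3232259, 806, 3293443, 790, 3232259, 806, 3293443, 774, 3170835, 534, 790,
     3232259, 806, 3293443, 790, 3232259, 806, 3293443, 3170835, 534, 790, 3232259,
     806, 3293443])

lemma mem_convexHull_of_orient {e : ℝ} {x y z u : ℝ × ℝ} (h : 0 < e * orient x y z)
    (h1 : 0 ≤ e * orient y z u) (h2 : 0 ≤ e * orient z x u) (h3 : 0 ≤ e * orient x y u) :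
    u ∈ convexHull ℝ {x, y, z} := by
  have hs : e * orient y z u + e * orient z x u + e * orient x y u = e * orient x y z := by
    unfold orient; ring
  have hu : (e * orient x y z) • u =
      (e * orient y z u) • x + (e * orient z x u) • y + (e * orient x y u) • z := by
    ext <;> simp [orient] <;> ring
  set D := e * orient x y z
  have := (convex_convexHull ℝ {x, y, z}).sum_mem (t := Finset.univ)
    (w := ![e * orient y z u / D, e * orient z x u / D, e * orient x y u / D]) (z := ![x, y, z])
    (fun i _ => by fin_cases i <;> exact div_nonneg (by assumption) h.le)
    (by simp [Fin.sum_univ_three, ← add_div, hs, h.ne'])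
    (fun i _ => subset_convexHull ℝ _ (by fin_cases i <;> simp))
  convert this using 1
  rw [Fin.sum_univ_three]
  apply smul_right_injective _ h.ne'
  simp [smul_smul, hu, mul_div_cancel₀ _ h.ne']

namespace Config

lemma Ambient.exists_eq {R : Config} {P : Set (ℝ × ℝ)} {c : ℝ × ℝ → Fin 4} {e : ℝ}
    {f : ℕ → ℝ × ℝ} (hR : R.Ambient P c) (hf : R.Holds P c e f) (hlen : R.cols.length ≤ 16)
    (hext : R.ext = []) (hcap : R.cap.getD 0 0 ≤ PState.count ⟨R.cols, 0, 0, 0⟩ 0) {u : ℝ × ℝ}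
    (hu : u ∈ P) (hcu : c u = 0) : ∃ i < R.cols.length, f i = u := by
  by_contra! h
  have hS : (⟨R.cols, 0, 0, 0⟩ : PState).Sat R P c e f :=
    ⟨hlen, hf.mem, hf.col, hf.inj, .zero _ _, .zero _ _, .zero _ _, by simp [hext]⟩
  have h1 := hS.count_lt hR.finite hu h
  have h2 := hR.cap 0
  rw [hcu] at h1
  exact absurd (h1.trans_le (h2.trans hcap)) (lt_irrefl _)

/-- The conditions on the labelled points in terms of five points of colour `0`. -/
lemma Holds.five {R : Config} {P : Set (ℝ × ℝ)} {c : ℝ × ℝ → Fin 4} {e : ℝ} {f : ℕ → ℝ × ℝ}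
    (hR : R.Ambient P c) (hf : R.Holds P c e f) (hcols : R.cols = [0, 0, 0, 0, 0])
    (hext : R.ext = []) (hcap : R.cap.getD 0 0 = 5) :
    (∀ i < 5, f i ∈ P ∧ c (f i) = 0) ∧ [f 0, f 1, f 2, f 3, f 4].Nodup ∧
      ∀ u ∈ P, c u = 0 → u = f 0 ∨ u = f 1 ∨ u = f 2 ∨ u = f 3 ∨ u = f 4 := by
  have hlen : R.cols.length = 5 := by simp [hcols]
  refine ⟨fun i hi => ⟨hf.mem i (hlen ▸ hi), Fin.ext ?_⟩, ?_, fun u hu hcu => ?_⟩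
  · rw [hf.col i (hlen ▸ hi), hcols]
    interval_cases i <;> rfl
  · have := hf.inj
    rw [hlen] at this
    have h : ∀ i < 5, ∀ j < 5, i ≠ j → f i ≠ f j := fun i hi j hj hij e => hij (this i hi j hj e)
    simp [h]
  · obtain ⟨i, hi, rfl⟩ := hR.exists_eq hf (by omega) hext (by rw [hcap, hcols]; decide) hu hcu
    rw [hlen] at hi
    interval_cases i <;> simp

end Config

lemma orient_mul_pos_rotate {e : ℝ} {p q r : ℝ × ℝ} (h : 0 < e * orient p q r) :
    0 < e * orient q r p := by
  rwa [orient_rotate]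

lemma notMem_convexHull_of_orient_mul_pos {e : ℝ} {a b u : ℝ × ℝ} {S : Set (ℝ × ℝ)}
    (h : ∀ v ∈ S, 0 ≤ e * orient a b v) (hu : 0 < e * orient b a u) : u ∉ convexHull ℝ S :=
  fun hmem => by
    have := orient_mul_nonneg_of_mem_convexHull h hmem
    rw [orient_swap] at hu
    linarith

lemma pentagonConfig_closed : (pentagonConfig [5, 4, 4, 4]).Closed := by
  intro P c e f he hR hf
  obtain ⟨-, -, hA⟩ := hf.five hR rfl rfl rfl
  have hpos := hf.pos
  simp only [pentagonConfig, List.forall_mem_cons, List.not_mem_nil, false_imp_iff,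
    implies_true, and_true] at hpos
  obtain ⟨h1, h2, h3, h4, h5, h6, h7, h8, h9, h10⟩ := hpos
  have hS : IsPolygon e {f 0, f 1, f 2, f 3, f 4} := by
    rintro _ (rfl | rfl | rfl | rfl | rfl)
    on_goal 1 => refine ⟨f 1, f 4, ?_, ?_, ?_⟩
    on_goal 4 => refine ⟨f 2, f 0, ?_, ?_, ?_⟩
    on_goal 7 => refine ⟨f 3, f 1, ?_, ?_, ?_⟩
    on_goal 10 => refine ⟨f 4, f 2, ?_, ?_, ?_⟩
    on_goal 13 => refine ⟨f 0, f 3, ?_, ?_, ?_⟩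
    all_goals
      first
      | assumption
      | exact orient_mul_pos_rotate ‹_›
      | exact orient_mul_pos_rotate (orient_mul_pos_rotate ‹_›)
      | rintro _ (rfl | rfl | rfl | rfl | rfl) <;>
        first
        | exact le_of_lt ‹_›
        | exact (orient_mul_pos_rotate ‹_›).le
        | exact (orient_mul_pos_rotate (orient_mul_pos_rotate ‹_›)).le
        | simp [orient_self_right, orient_self_outer]
  have hin : ∀ i < 5, f i ∈ convexHull ℝ {f 0, f 1, f 2, f 3, f 4} := fun i hi =>
    subset_convexHull ℝ _ (by interval_cases i <;> simp)
  refine pentagonConfig_closed_of_le_two (P ∩ convexHull ℝ {f 0, f 1, f 2, f 3, f 4}) c e f he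
    ⟨hR.finite.inter_of_left _, hR.blocked.inter (convex_convexHull ℝ _), fun j => ?_, nofun⟩
    ⟨fun i hi => ⟨hf.mem i hi, hin i hi⟩, hf.col, hf.inj, hf.pos, hf.btw, nofun⟩
  by_cases hj : j = 0
  · subst hj
    exact (Set.ncard_le_ncard (Set.inter_subset_inter_left _ Set.inter_subset_left)
      (hR.finite.inter_of_left _)).trans (hR.cap 0)
  · refine (hR.blocked.ncard_inter_convexHull_le_two hR.finite he hS hj
      fun u hu hcu _ => hA u hu hcu).trans ?_
    fin_cases j <;> simp_all [pentagonConfig]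

lemma pointInQuadConfig_closed : pointInQuadConfig.Closed := by
  intro P c e f he hR hf
  obtain ⟨hm, hnd, hA⟩ := hf.five hR rfl rfl rfl
  have hpos := hf.pos
  simp only [pointInQuadConfig, List.forall_mem_cons, List.not_mem_nil, false_imp_iff,
    implies_true, and_true] at hpos
  obtain ⟨h012, h013, h023, h123, h014, h204, h134⟩ := hpos
  obtain ⟨m0, c0⟩ := hm 0 (by norm_num)
  obtain ⟨m1, c1⟩ := hm 1 (by norm_num)
  obtain ⟨m2, c2⟩ := hm 2 (by norm_num)
  obtain ⟨m3, c3⟩ := hm 3 (by norm_num)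
  obtain ⟨m4, c4⟩ := hm 4 (by norm_num)
  generalize f 0 = x₀ at *
  generalize f 1 = x₁ at *
  generalize f 2 = x₂ at *
  generalize f 3 = x₃ at *
  generalize f 4 = x₄ at *
  have h124 : 0 < e * orient x₁ x₂ x₄ := by
    refine pos_of_mul_pos_left (?_ : 0 < e * orient x₁ x₂ x₄ * (e * orient x₀ x₁ x₃)) h013.le
    rw [show e * orient x₁ x₂ x₄ * (e * orient x₀ x₁ x₃) = e * orient x₁ x₃ x₄ *
      (e * orient x₀ x₁ x₂) + e * orient x₁ x₂ x₃ * (e * orient x₀ x₁ x₄) by unfold orient; ring]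
    positivity
  have h304 : 0 < e * orient x₃ x₀ x₄ := by
    refine pos_of_mul_pos_left (?_ : 0 < e * orient x₃ x₀ x₄ * (e * orient x₀ x₁ x₂)) h012.le
    rw [show e * orient x₃ x₀ x₄ * (e * orient x₀ x₁ x₂) = e * orient x₀ x₁ x₃ *
      (e * orient x₂ x₀ x₄) + e * orient x₀ x₂ x₃ * (e * orient x₀ x₁ x₄) by unfold orient; ring]
    positivity
  have h234 : 0 < e * orient x₂ x₃ x₄ := by
    refine pos_of_mul_pos_left (?_ : 0 < e * orient x₂ x₃ x₄ * (e * orient x₀ x₁ x₂)) h012.le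
    rw [show e * orient x₂ x₃ x₄ * (e * orient x₀ x₁ x₂) = e * orient x₀ x₂ x₃ *
      (e * orient x₁ x₂ x₄) + e * orient x₁ x₂ x₃ * (e * orient x₂ x₀ x₄) by unfold orient; ring]
    positivity
  have h423 := orient_mul_pos_rotate (orient_mul_pos_rotate h234)
  have h341 := orient_mul_pos_rotate h134
  have Q₁ : ConvexQuad P c e x₀ x₄ x₂ x₃ :=
    ⟨he, ⟨m0, m4, m2, m3⟩, by simp [*], orient_mul_pos_rotate h204, h423,
      orient_mul_pos_rotate h023, h304⟩
  have Q₂ : ConvexQuad P c e x₁ x₂ x₃ x₄ :=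
    ⟨he, ⟨m1, m2, m3, m4⟩, by simp [*], h123, h234, h341,
      orient_mul_pos_rotate (orient_mul_pos_rotate h124)⟩
  obtain ⟨o, p, q, r, s, B⟩ := Q₁.exists_quadBlockers hR.finite hR.blocked fun u hu hcu hull => by
    rcases hA u hu (hcu.trans c0) with rfl | rfl | rfl | rfl | rfl
    on_goal 2 =>
      refine absurd hull (notMem_convexHull_of_orient_mul_pos (a := x₄) (b := x₂) (e := e) ?_
        (orient_mul_pos_rotate h124))
      rintro _ (rfl | rfl | rfl | rfl)
      · exact (orient_mul_pos_rotate (orient_mul_pos_rotate h204)).le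
    all_goals simp [orient_self_right, orient_self_outer, h423.le]
  obtain ⟨o', p', q', r', s', B'⟩ := Q₂.exists_quadBlockers hR.finite hR.blocked
    fun u hu hcu hull => by
    rcases hA u hu (hcu.trans c1) with rfl | rfl | rfl | rfl | rfl
    on_goal 1 =>
      refine absurd hull (notMem_convexHull_of_orient_mul_pos (a := x₃) (b := x₄) (e := e) ?_
        (orient_mul_pos_rotate (orient_mul_pos_rotate h304)))
      rintro _ (rfl | rfl | rfl | rfl)
    all_goals simp [orient_self_right, orient_self_outer, h341.le,
      (orient_mul_pos_rotate h234).le]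
  obtain ⟨mo, mp, mq, mr, ms⟩ := B.mem
  obtain ⟨mo', mp', mq', mr', ms'⟩ := B'.mem
  obtain rfl : r' = o := hR.blocked.eq_of_mem_openSegment_of_mem hR.finite mo mr' m4 m3
    Q₁.ne.2.2.2.2.1 B.diag₂ (openSegment_symm ℝ x₃ x₄ ▸ B'.side₃)
  obtain rfl : o' = q := hR.blocked.eq_of_mem_openSegment_of_mem hR.finite mq mo' m4 m2
    Q₁.ne.2.2.2.1 B.side₂ (openSegment_symm ℝ x₂ x₄ ▸ B'.diag₂)
  refine hR.blocked.orient_ne_zero_of_between hR.finite mr' mq ms mp' B.ne₂ B.between₂ B'.ne₁ ?_ ?_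
    (orient_eq_zero_of_between B.between₂ ?_)
  · rintro rfl
    exact B'.col_ne.1 rfl
  · rintro rfl
    exact B'.col_ne.1 B.col₂
  · rw [← orient_rotate, orient_eq_zero_of_mem_openSegment (openSegment_symm ℝ p' r' ▸ B'.between₁)]

lemma exists_perm_four : ∀ α o q p : Fin 4, o ≠ α → q ≠ α → p ≠ α → o ≠ q → o ≠ p → q ≠ p →
    ∃ σ : Equiv.Perm (Fin 4), σ α = 0 ∧ σ o = 3 ∧ σ q = 1 ∧ σ p = 2 := by
  decide +kernel

lemma twoPointsInTriangleConfig_closed : (twoPointsInTriangleConfig [] [] []).Closed := by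
  intro P c e f he hR hf
  obtain ⟨hm, hnd, hA⟩ := hf.five hR rfl rfl rfl
  have hpos := hf.pos
  simp only [twoPointsInTriangleConfig, List.forall_mem_cons, List.not_mem_nil, false_imp_iff,
    implies_true, and_true] at hpos
  obtain ⟨h012, h013, h123, h203, h014, h124, h204, h143, h243, h340⟩ := hpos
  obtain ⟨m0, c0⟩ := hm 0 (by norm_num)
  obtain ⟨m1, c1⟩ := hm 1 (by norm_num)
  obtain ⟨m2, c2⟩ := hm 2 (by norm_num)
  obtain ⟨m3, c3⟩ := hm 3 (by norm_num)
  obtain ⟨m4, c4⟩ := hm 4 (by norm_num)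
  have hcap := hR.cap
  generalize f 0 = x₀ at *
  generalize f 1 = x₁ at *
  generalize f 2 = x₂ at *
  generalize f 3 = x₃ at *
  generalize f 4 = x₄ at *
  have h431 := orient_mul_pos_rotate h143
  have Q : ConvexQuad P c e x₁ x₂ x₄ x₃ :=
    ⟨he, ⟨m1, m2, m4, m3⟩, by simp [*], h124, h243, h431,
      orient_mul_pos_rotate (orient_mul_pos_rotate h123)⟩
  obtain ⟨o, p, q, r, s, B⟩ := Q.exists_quadBlockers hR.finite hR.blocked fun u hu hcu hull => by
    rcases hA u hu (hcu.trans c1) with rfl | rfl | rfl | rfl | rfl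
    on_goal 1 =>
      refine absurd hull (notMem_convexHull_of_orient_mul_pos (a := x₄) (b := x₃) (e := e) ?_ h340)
      rintro _ (rfl | rfl | rfl | rfl)
    all_goals simp [orient_self_right, orient_self_outer, h431.le,
      (orient_mul_pos_rotate h243).le]
  obtain ⟨mo, mp, mq, mr, ms⟩ := B.mem
  obtain ⟨hop, hoq, hpq⟩ := B.col_ne
  obtain ⟨hoa, hpa, hqa⟩ := B.col_ne'
  rw [c1] at hoa hpa hqa
  obtain ⟨σ, σ0, σo, σq, σp⟩ := exists_perm_four _ _ _ _ hoa hqa hpa hoq hop hpq.symm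
  have hT : IsPolygon e {x₀, x₁, x₂} := by
    rintro _ (rfl | rfl | rfl)
    on_goal 1 => refine ⟨x₁, x₂, ?_, ?_, orient_mul_pos_rotate (orient_mul_pos_rotate h012)⟩
    on_goal 3 => refine ⟨x₂, x₀, ?_, ?_, h012⟩
    on_goal 5 => refine ⟨x₀, x₁, ?_, ?_, orient_mul_pos_rotate h012⟩
    all_goals
      rintro _ (rfl | rfl | rfl) <;>
      first
      | exact h012.le
      | exact (orient_mul_pos_rotate h012).le
      | exact (orient_mul_pos_rotate (orient_mul_pos_rotate h012)).le
      | simp [orient_self_right, orient_self_outer]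
  have hconv := convex_convexHull ℝ {x₀, x₁, x₂}
  have t0 : x₀ ∈ convexHull ℝ {x₀, x₁, x₂} := subset_convexHull ℝ _ (by simp)
  have t1 : x₁ ∈ convexHull ℝ {x₀, x₁, x₂} := subset_convexHull ℝ _ (by simp)
  have t2 : x₂ ∈ convexHull ℝ {x₀, x₁, x₂} := subset_convexHull ℝ _ (by simp)
  have t3 := mem_convexHull_of_orient h012 h123.le h203.le h013.le
  have t4 := mem_convexHull_of_orient h012 h124.le h204.le h014.le
  have t5 := hconv.openSegment_subset t1 t4 B.diag₁
  have t6 := hconv.openSegment_subset t1 t2 B.side₁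
  have t7 := hconv.openSegment_subset t2 t4 B.side₂
  have t8 := hconv.openSegment_subset t4 t3 B.side₃
  have t9 := hconv.openSegment_subset t3 t1 B.side₄
  refine twoPointsInTriangleConfig_quadBlockers_closed.elim (hR.finite.inter_of_left _)
    (hR.blocked.inter hconv) σ he [x₀, x₁, x₂, x₃, x₄, o, s, q, p, r] ?_ ?_ ?_ ?_ ?_ ?_ ?_ nofun
  · simp [*]
  · simp [twoPointsInTriangleConfig, *, ← B.col₁, ← B.col₂]
  · have hne : ∀ {u v}, c u ≠ c v → u ≠ v := fun h e => h (e ▸ rfl)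
    refine List.Nodup.append hnd (l₂ := [o, s, q, p, r]) ?_ fun x hx hx' => ?_
    · simp [hne hoq, hne hop, hne hpq.symm, B.ne₁, B.ne₂.symm, hne (B.col₁ ▸ hop : c o ≠ c r),
        hne (B.col₂ ▸ hoq : c o ≠ c s), hne (B.col₂ ▸ hpq.symm : c s ≠ c p),
        hne (B.col₁ ▸ hpq.symm : c q ≠ c r), hne (B.col₂ ▸ B.col₁ ▸ hpq.symm : c s ≠ c r)]
    · have hx0 : c x = 0 := by
        simp only [List.mem_cons, List.not_mem_nil, or_false] at hx
        rcases hx with rfl | rfl | rfl | rfl | rfl <;> assumption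
      simp only [List.mem_cons, List.not_mem_nil, or_false] at hx'
      rcases hx' with rfl | rfl | rfl | rfl | rfl
      · exact hoa hx0
      · exact hqa (B.col₂.trans hx0)
      · exact hqa hx0
      · exact hpa hx0
      · exact hpa (B.col₁.trans hx0)
  · refine fun j => (Set.ncard_le_ncard (Set.inter_subset_inter_left _ Set.inter_subset_left)
      (hR.finite.inter_of_left _)).trans (le_getD_of_perm (N := fun j => (P ∩ c ⁻¹' {j}).ncard)
        σ0 (hcap 0) (fun j hj => ?_) j)
    have := hcap j
    fin_cases j <;> simp_all [twoPointsInTriangleConfig]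
  · simp [twoPointsInTriangleConfig, *]
  · have hs := openSegment_symm ℝ x₁ x₃ ▸ B.side₄
    have hr := openSegment_symm ℝ x₃ x₄ ▸ B.side₃
    have ho := openSegment_symm ℝ s q ▸ B.between₂
    simp [twoPointsInTriangleConfig, *, B.diag₁, B.diag₂, B.side₁, B.side₂, B.between₁]
  · simpa [twoPointsInTriangleConfig] using ⟨hT.notMem_convexHull he (a := x₀) (P := P) (by simp),
      hT.notMem_convexHull he (a := x₁) (P := P) (by simp),
      hT.notMem_convexHull he (a := x₂) (P := P) (by simp)⟩

lemma fivePointsConfig_closed : fivePointsConfig.Closed :=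
  fivePointsConfig_closed_of pentagonConfig_closed pointInQuadConfig_closed
    twoPointsInTriangleConfig_closed

/-! ### Sizes of colour classes -/

lemma Set.Finite.exists_nodup_list {α : Type*} {s : Set α} (hs : s.Finite) :
    ∃ l : List α, l.Nodup ∧ l.length = s.ncard ∧ ∀ x, x ∈ l ↔ x ∈ s :=
  ⟨hs.toFinset.toList, Finset.nodup_toList _,
    by rw [Finset.length_toList, ← Set.ncard_eq_toFinset_card s hs], by simp⟩

lemma exists_perm_zero : ∀ i j k : Fin 4, i ≠ j → k ≠ 0 →
    ∃ σ : Equiv.Perm (Fin 4), σ i = 0 ∧ σ j = k := by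
  decide +kernel

namespace BlockedColouring

variable {P : Set (ℝ × ℝ)} {c : ℝ × ℝ → Fin 4}

lemma diff_singleton_inter_of_ne {p : ℝ × ℝ} {i : Fin 4} (h : c p ≠ i) :
    P \ {p} ∩ c ⁻¹' {i} = P ∩ c ⁻¹' {i} := by
  ext x
  refine ⟨fun hx => ⟨hx.1.1, hx.2⟩, fun hx => ⟨⟨hx.1, ?_⟩, hx.2⟩⟩
  rintro rfl
  exact h hx.2

lemma ncard_diff_singleton_inter_add_one (hfin : P.Finite) {p : ℝ × ℝ} (hp : p ∈ P) :
    (P \ {p} ∩ c ⁻¹' {c p}).ncard + 1 = (P ∩ c ⁻¹' {c p}).ncard := by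
  have : P \ {p} ∩ c ⁻¹' {c p} = (P ∩ c ⁻¹' {c p}) \ {p} := by
    ext x
    simp only [Set.mem_inter_iff, Set.mem_sdiff]
    tauto
  rw [this]
  exact Set.ncard_sdiff_singleton_add_one ⟨hp, rfl⟩ (hfin.inter_of_left _)

/-- Every colour class has at most four points. -/
lemma ncard_le_four (hc : BlockedColouring P c) (hfin : P.Finite) (j : Fin 4) :
    (P ∩ c ⁻¹' {j}).ncard ≤ 4 := by
  induction hn : P.ncard using Nat.strong_induction_on generalizing P j with
  | _ n ih =>
    by_contra! h
    obtain ⟨p, hp, hext⟩ := exists_notMem_convexHull_diff_singleton hfin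
      ((Set.nonempty_of_ncard_ne_zero (s := P ∩ c ⁻¹' {j}) (by omega)).mono Set.inter_subset_left)
    have ih' := fun i => ih _ (hn ▸ Set.ncard_sdiff_singleton_lt_of_mem hp hfin)
      (hc.diff_singleton hext) (hfin.subset Set.sdiff_subset) i rfl
    obtain rfl : c p = j := by
      by_contra hpj
      have := ih' j
      rw [diff_singleton_inter_of_ne hpj] at this
      omega
    have h5 := ncard_diff_singleton_inter_add_one (c := c) hfin hp
    have hp4 := ih' (c p)
    obtain ⟨l, hnd, hlen, hl⟩ := (hfin.inter_of_left (c ⁻¹' {c p})).exists_nodup_list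
    replace hlen : l.length = 5 := by omega
    rcases l with _ | ⟨x, _ | ⟨y, _ | ⟨z, _ | ⟨u, _ | ⟨v, _ | ⟨w, l⟩⟩⟩⟩⟩⟩ <;>
      simp only [List.length_cons, List.length_nil] at hlen <;> try omega
    have hmem : ∀ t ∈ [x, y, z, u, v], t ∈ P ∧ c t = c p := fun t ht => (hl t).1 ht
    simp only [List.forall_mem_cons, List.not_mem_nil, false_imp_iff, implies_true, and_true]
      at hmem
    obtain ⟨⟨hx, hcx⟩, ⟨hy, hcy⟩, ⟨hz, hcz⟩, ⟨hu, hcu⟩, hv, hcv⟩ := hmem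
    have h0 : orient x y z ≠ 0 := by
      simp only [List.nodup_cons, List.mem_cons, not_or] at hnd
      exact hc.orient_ne_zero hfin hx hy hz hnd.1.1 hnd.2.1.1 (Ne.symm hnd.1.2.1)
        (hcx.trans hcy.symm) (hcy.trans hcz.symm)
    refine fivePointsConfig_closed.elim hfin hc (Equiv.swap (c p) 0) h0 [x, y, z, u, v]
      (fun t ht => ((hl t).1 ht).1) ?_ hnd
      (le_getD_of_perm (N := fun i => (P ∩ c ⁻¹' {i}).ncard) (Equiv.swap_apply_left _ _)
        (by omega) fun i hi => ?_) ?_ nofun nofun nofun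
    · simp [fivePointsConfig, *]
    · rw [← diff_singleton_inter_of_ne hi.symm]
      exact ih' i
    · simpa [fivePointsConfig] using mul_self_pos.2 h0

/-- A colour class of size four that is not in convex position is a triangle with a point in it. -/
lemma exists_pointInTriangle (hc : BlockedColouring P c) (hfin : P.Finite) {i : Fin 4}
    (h4 : (P ∩ c ⁻¹' {i}).ncard = 4) (hconv : ¬ ConvexPosition (P ∩ c ⁻¹' {i})) :
    ∃ e x y z u, e ≠ 0 ∧ [x, y, z, u].Nodup ∧ (∀ t ∈ [x, y, z, u], t ∈ P ∧ c t = i) ∧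
      0 < e * orient x y z ∧ 0 < e * orient x y u ∧ 0 < e * orient y z u ∧
      0 < e * orient z x u := by
  unfold ConvexPosition at hconv
  push Not at hconv
  obtain ⟨u, hu, hull⟩ := hconv
  have h3 := Set.ncard_sdiff_singleton_add_one hu (hfin.inter_of_left _)
  obtain ⟨x, y, z, hxy, hxz, hyz, hS⟩ :=
    Set.ncard_eq_three.1 (show ((P ∩ c ⁻¹' {i}) \ {u}).ncard = 3 by omega)
  have hmem : ∀ t ∈ ({x, y, z} : Set (ℝ × ℝ)), (t ∈ P ∧ c t = i) ∧ t ≠ u := by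
    rw [← hS]
    exact fun t ht => ht
  obtain ⟨⟨hx, hcx⟩, hxu⟩ := hmem x (by simp)
  obtain ⟨⟨hy, hcy⟩, hyu⟩ := hmem y (by simp)
  obtain ⟨⟨hz, hcz⟩, hzu⟩ := hmem z (by simp)
  have hcu : c u = i := hu.2
  rw [hS] at hull
  have hne := fun {p q r : ℝ × ℝ} => hc.orient_ne_zero hfin (x := p) (y := q) (z := r)
  have h0 := hne hx hy hz hxy hyz hxz.symm (by simp [*]) (by simp [*])
  have hxyu := hne hx hy hu.1 hxy hyu hxu.symm (by simp [*]) (by simp [*])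
  have hyzu := hne hy hz hu.1 hyz hzu hyu.symm (by simp [*]) (by simp [*])
  have hzxu := hne hz hx hu.1 hxz.symm hxu hzu.symm (by simp [*]) (by simp [*])
  have hD := mul_self_pos.2 h0
  have hDy := orient_mul_pos_rotate hD
  have hDz := orient_mul_pos_rotate hDy
  refine ⟨orient x y z, x, y, z, u, h0, by simp [*], by simp [*, hu.1], hD,
    (orient_mul_nonneg_of_mem_convexHull ?_ hull).lt_of_ne' (mul_ne_zero h0 hxyu),
    (orient_mul_nonneg_of_mem_convexHull ?_ hull).lt_of_ne' (mul_ne_zero h0 hyzu),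
    (orient_mul_nonneg_of_mem_convexHull ?_ hull).lt_of_ne' (mul_ne_zero h0 hzxu)⟩ <;>
  · rintro _ (rfl | rfl | rfl) <;>
    simp only [orient_self_right, orient_self_outer, mul_zero, le_refl, hD.le, hDy.le, hDz.le]

lemma false_of_pointInTriangleConfig (hc : BlockedColouring P c) (hfin : P.Finite) {i : Fin 4}
    (h4 : (P ∩ c ⁻¹' {i}).ncard = 4) (hconv : ¬ ConvexPosition (P ∩ c ⁻¹' {i})) {cap : List ℕ}
    {need : Bool} (hQ : (pointInTriangleConfig [] [] cap need).Closed) {σ : Equiv.Perm (Fin 4)}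
    (hσ : σ i = 0) (hcap : ∀ j, (P ∩ c ⁻¹' {j}).ncard ≤ cap.getD (σ j) 0)
    (hneed : need = true → 3 ≤ (P ∩ c ⁻¹' {σ.symm 1}).ncard) : False := by
  obtain ⟨e, x, y, z, u, he, hnd, hmem, h1, h2, h3, h4⟩ := hc.exists_pointInTriangle hfin h4 hconv
  refine hQ.elim hfin hc σ he [x, y, z, u] (fun t ht => (hmem t ht).1) ?_ hnd hcap ?_ nofun nofun
    hneed
  · simp only [List.forall_mem_cons] at hmem
    simp [pointInTriangleConfig, hmem, hσ]
  · simpa [pointInTriangleConfig] using ⟨h1, h2, h3, h4⟩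

/-- If no colour class consists of four points in convex position and one colour class has four
points, then the other colour classes have at most two points. -/
lemma ncard_le_two (hc : BlockedColouring P c) (hfin : P.Finite)
    (hno : ∀ i, ¬ ((P ∩ c ⁻¹' {i}).ncard = 4 ∧ ConvexPosition (P ∩ c ⁻¹' {i}))) {i j : Fin 4}
    (hij : i ≠ j) (hi : (P ∩ c ⁻¹' {i}).ncard = 4) : (P ∩ c ⁻¹' {j}).ncard ≤ 2 := by
  induction hn : P.ncard using Nat.strong_induction_on generalizing P i j with
  | _ n ih =>
    by_contra! hj
    by_cases hothers : ∀ k ≠ i, (P ∩ c ⁻¹' {k}).ncard ≤ 3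
    · obtain ⟨σ, hσi, hσj⟩ := exists_perm_zero i j 1 hij (by decide)
      refine hc.false_of_pointInTriangleConfig hfin hi (fun h => hno i ⟨hi, h⟩)
        pointInTriangleConfig_closed_of_need hσi
        (le_getD_of_perm (N := fun i => (P ∩ c ⁻¹' {i}).ncard) hσi hi.le hothers) fun _ => ?_
      rwa [← hσj, Equiv.symm_apply_apply]
    · push Not at hothers
      obtain ⟨k, hki, hk⟩ := hothers
      obtain ⟨p, hp, hext⟩ := exists_notMem_convexHull_diff_singleton hfin
        ((Set.nonempty_of_ncard_ne_zero (s := P ∩ c ⁻¹' {j}) (by omega)).mono Set.inter_subset_left)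
      have hp1 := ncard_diff_singleton_inter_add_one (c := c) hfin hp
      have hp4 := hc.ncard_le_four hfin (c p)
      have hk4 := hc.ncard_le_four hfin k
      have ih' := fun {i' j'} => ih _ (hn ▸ Set.ncard_sdiff_singleton_lt_of_mem hp hfin)
        (hc.diff_singleton hext) (hfin.subset Set.sdiff_subset) (fun l hl => ?_)
        (i := i') (j := j')
      · by_cases hpi : c p = i
        · subst hpi
          have := ih' hki (by rw [diff_singleton_inter_of_ne hki.symm]; omega) rfl
          omega
        · have := ih' hki.symm (by rwa [diff_singleton_inter_of_ne hpi]) rfl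
          by_cases hpk : c p = k
          · subst hpk
            omega
          · rw [diff_singleton_inter_of_ne hpk] at this
            omega
      · by_cases hpl : c p = l
        · subst hpl
          omega
        · rw [diff_singleton_inter_of_ne hpl] at hl
          exact hno l hl

/-- If one colour class consists of four points not in convex position and the other colour
classes have at most two points, then they have exactly two points. -/
lemma two_le_ncard (hc : BlockedColouring P c) (hfin : P.Finite) {i : Fin 4}
    (hi : (P ∩ c ⁻¹' {i}).ncard = 4) (hconv : ¬ ConvexPosition (P ∩ c ⁻¹' {i}))
    (h2 : ∀ j ≠ i, (P ∩ c ⁻¹' {j}).ncard ≤ 2) {j : Fin 4} (hj : j ≠ i) :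
    2 ≤ (P ∩ c ⁻¹' {j}).ncard := by
  by_contra! h
  obtain ⟨σ, hσi, hσj⟩ := exists_perm_zero i j 3 hj.symm (by decide)
  refine hc.false_of_pointInTriangleConfig hfin hi hconv pointInTriangleConfig_closed_of_le_one
    hσi (fun k => ?_) nofun
  have hle := le_getD_of_perm (N := fun i => (P ∩ c ⁻¹' {i}).ncard) hσi hi.le h2 k
  by_cases hkj : k = j
  · subst hkj
    rw [hσj]
    exact Nat.lt_succ_iff.1 h
  · have h3 : σ k ≠ 3 := fun e => hkj (σ.injective (e.trans hσj.symm))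
    generalize σ k = m at hle h3
    fin_cases m <;> simp_all

end BlockedColouring

/-- If no colour class of a 4-blocked set `P` consists of exactly four points in
convex position, but some colour class consists of exactly four points not in convex
position, then `P` is `{4,2,2,2}`-blocked. -/
theorem nonconvex_class_4222 (P : Set (ℝ × ℝ)) (hfin : P.Finite)
    (c : (ℝ × ℝ) → Fin 4) (hc : BlockedColouring P c)
    (hno : ∀ i : Fin 4, ¬ ((P ∩ c ⁻¹' {i}).ncard = 4 ∧ ConvexPosition (P ∩ c ⁻¹' {i})))
    (hsome : ∃ i : Fin 4, (P ∩ c ⁻¹' {i}).ncard = 4 ∧ ¬ ConvexPosition (P ∩ c ⁻¹' {i})) :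
    IsNBlocked ({4, 2, 2, 2} : Multiset ℕ) P := by
  obtain ⟨i, hi, hconv⟩ := hsome
  have h2 : ∀ j ≠ i, (P ∩ c ⁻¹' {j}).ncard ≤ 2 := fun j hj => hc.ncard_le_two hfin hno hj.symm hi
  have hcard : (fun j => (P ∩ c ⁻¹' {j}).ncard) = fun j => if j = i then 4 else 2 := by
    ext j
    split_ifs with hj
    · rw [hj, hi]
    · exact le_antisymm (h2 j hj) (hc.two_le_ncard hfin hi hconv h2 hj)
  refine ⟨hfin, 4, c, hc, ?_⟩
  rw [hcard]
  clear hi hconv h2 hcard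
  revert i
  decide
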